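/- Let G be a finite group and k₁, k₂ two fields of the same characteristic p dividing |G|. Then the generating hypothesis holds for k₁G if and only if it holds for k₂G. -/

import Mathlib

open CategoryTheory

namespace StmodGH

/-- The trivial `kG`-module `k`, as a module over the group algebra. -/
noncomputable def triv (k G : Type) [Field k] [Group G] : ModuleCat (MonoidAlgebra k G) :=
  ModuleCat.of _ (Representation.trivial k (G := G) (V := k)).asModule

variable {A : Type} [Ring A]

/-- A map is zero in the stable module category iff it factors through a projective. -/
def StablyZero {M N : ModuleCat A} (f : M ⟶ N) : Prop :=
  ∃ P : ModuleCat A, Projective P ∧ ∃ (g : M ⟶ P) (h : P ⟶ N), f = g ≫ h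

/-- Two modules are isomorphic in the stable module category. -/
def StablyIso (M N : ModuleCat A) : Prop :=
  ∃ (f : M ⟶ N) (g : N ⟶ M), StablyZero (f ≫ g - 𝟙 M) ∧ StablyZero (g ≫ f - 𝟙 N)

/-- A short exact sequence `0 → X → Y → Z → 0` of modules. -/
structure SES (X Y Z : ModuleCat A) where
  i : X ⟶ Y
  p : Y ⟶ Z
  inj : Function.Injective i
  surj : Function.Surjective p
  exact : ∀ y : Y, p y = 0 ↔ ∃ x, i x = y

/-- `Ω` is a family of syzygies/cosyzygies of `M`: `Ω 0 ≃ M` stably, and each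
`Ω (i+1)` is the kernel of a surjection from a (finitely generated) projective onto `Ω i`. -/
def IsSyzygyFamily (M : ModuleCat A) (Ω : ℤ → ModuleCat A) : Prop :=
  (∀ i, Module.Finite A (Ω i)) ∧ StablyIso (Ω 0) M ∧
    ∀ i : ℤ, ∃ P : ModuleCat A, Projective P ∧ Nonempty (SES (Ω (i + 1)) P (Ω i))

/-- Indecomposability, via idempotent endomorphisms. -/
def Indecomp (M : ModuleCat A) : Prop :=
  ¬ Limits.IsZero M ∧ ∀ f : M ⟶ M, f ≫ f = f → f = 0 ∨ f = 𝟙 M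

/-- Membership in the thick subcategory of the stable module category generated by `G₀`:
the smallest class containing `G₀`, containing the (stably trivial) projective modules,
closed under stable isomorphism, under exact triangles (equivalently, two-out-of-three for
short exact sequences), and under direct summands. -/
inductive InThick (G₀ : ModuleCat A) : ModuleCat A → Prop
  | gen : InThick G₀ G₀
  | proj (P : ModuleCat A) : Projective P → InThick G₀ P
  | iso {M N : ModuleCat A} : StablyIso M N → InThick G₀ M → InThick G₀ N
  | ext₁ {X Y Z : ModuleCat A} : SES X Y Z → InThick G₀ X → InThick G₀ Y → InThick G₀ Z
  | ext₂ {X Y Z : ModuleCat A} : SES X Y Z → InThick G₀ X → InThick G₀ Z → InThick G₀ Y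
  | ext₃ {X Y Z : ModuleCat A} : SES X Y Z → InThick G₀ Y → InThick G₀ Z → InThick G₀ X
  | summand {M N : ModuleCat A} : (∃ (s : M ⟶ N) (r : N ⟶ M), s ≫ r = 𝟙 M) →
      InThick G₀ N → InThick G₀ M

/-- A short exact sequence `0 → X → B → N → 0` is almost split: it is non-split, has
indecomposable end terms, and every map to `N` that is not a split epimorphism factors
through the middle term `B`. -/
def IsAlmostSplit {X B N : ModuleCat A} (s : SES X B N) : Prop :=
  Indecomp X ∧ Indecomp N ∧ (¬ ∃ sec : N ⟶ B, sec ≫ s.p = 𝟙 N) ∧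
    ∀ (M : ModuleCat A) (f : M ⟶ N),
      (¬ ∃ sec : N ⟶ M, sec ≫ f = 𝟙 N) → ∃ g : M ⟶ B, g ≫ s.p = f

/-- The generating hypothesis for `kG`: every map in the thick subcategory generated by the
trivial module which induces the zero map on Tate cohomology
`Ĥ^i(G,−) = Hom_stmod(Ω^i k, −)` is zero in the stable module category. -/
def GHolds (k G : Type) [Field k] [Group G] [Fintype G] : Prop :=
  ∀ Ωk : ℤ → ModuleCat (MonoidAlgebra k G), IsSyzygyFamily (triv k G) Ωk →
    ∀ M N : ModuleCat (MonoidAlgebra k G), InThick (triv k G) M → InThick (triv k G) N →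
      ∀ f : M ⟶ N, (∀ (i : ℤ) (g : Ωk i ⟶ M), StablyZero (g ≫ f)) → StablyZero f

set_option linter.unusedSectionVars false

section Generic

variable {k S U V W X : Type} [Field k] [Group S]
  [AddCommGroup U] [Module k U] [DistribMulAction S U] [SMulCommClass S k U]
  [AddCommGroup V] [Module k V] [DistribMulAction S V] [SMulCommClass S k V]
  [AddCommGroup W] [Module k W] [DistribMulAction S W] [SMulCommClass S k W]
  [AddCommGroup X] [Module k X] [DistribMulAction S X] [SMulCommClass S k X]

/-- Equivariance of a `k`-linear map. -/
def IsHom (S : Type) [Group S] [DistribMulAction S V] [DistribMulAction S W]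
    (f : V →ₗ[k] W) : Prop := ∀ (g : S) (v : V), f (g • v) = g • f v

theorem IsHom.comp {f : V →ₗ[k] W} {h : U →ₗ[k] V} (hf : IsHom S f) (hh : IsHom S h) :
    IsHom S (f ∘ₗ h) := fun g v => by simp [hf g, hh g]

theorem IsHom.id : IsHom S (LinearMap.id : V →ₗ[k] V) := fun _ _ => rfl

theorem IsHom.zero : IsHom S (0 : V →ₗ[k] W) := fun _ _ => by simp

theorem IsHom.add {f h : V →ₗ[k] W} (hf : IsHom S f) (hh : IsHom S h) : IsHom S (f + h) :=
  fun g v => by simp [hf g, hh g]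

theorem IsHom.sub {f h : V →ₗ[k] W} (hf : IsHom S f) (hh : IsHom S h) : IsHom S (f - h) :=
  fun g v => by simp [hf g, hh g, smul_sub]

theorem IsHom.smul {f : V →ₗ[k] W} (c : k) (hf : IsHom S f) : IsHom S (c • f) :=
  fun g v => by simp [hf g, smul_comm]

theorem IsHom.sum {ι : Type} (s : Finset ι) {f : ι → V →ₗ[k] W} (hf : ∀ i ∈ s, IsHom S (f i)) :
    IsHom S (∑ i ∈ s, f i) := fun g v => by
  simp only [LinearMap.sum_apply, Finset.smul_sum]
  exact Finset.sum_congr rfl fun i hi => hf i hi g v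

theorem IsHom.restrict {f : V →ₗ[k] W} (hf : IsHom S f) (P : Subgroup S) : IsHom P f :=
  fun g v => hf g v

/-- The trace (transfer from the trivial group) of a `k`-linear map. -/
noncomputable def tr (S : Type) [Group S] [DistribMulAction S V] [SMulCommClass S k V]
    [DistribMulAction S W] [SMulCommClass S k W] [Finite S] (s : V →ₗ[k] W) : V →ₗ[k] W :=
  letI := Fintype.ofFinite S
  ∑ g : S, DistribSMul.toLinearMap k W g ∘ₗ s ∘ₗ DistribSMul.toLinearMap k V g⁻¹

theorem tr_apply [Fintype S] (s : V →ₗ[k] W) (v : V) : tr S s v = ∑ g : S, g • s (g⁻¹ • v) := by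
  rw [tr, LinearMap.sum_apply]
  refine Finset.sum_congr (by ext; simp) fun g _ => rfl

/-- A map is a trace of a linear map. -/
def SZ (S : Type) [Group S] [DistribMulAction S V] [SMulCommClass S k V]
    [DistribMulAction S W] [SMulCommClass S k W] [Finite S] (f : V →ₗ[k] W) : Prop :=
  ∃ s, tr S s = f

variable [Finite S]

theorem tr_isHom (s : V →ₗ[k] W) : IsHom S (tr S s) := fun g v => by
  have := Fintype.ofFinite S
  rw [tr_apply, tr_apply, Finset.smul_sum]
  refine Fintype.sum_equiv (Equiv.mulLeft g⁻¹) _ _ fun x => ?_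
  simp [smul_smul]

theorem SZ.isHom {f : V →ₗ[k] W} (h : SZ S f) : IsHom S f := by
  obtain ⟨s, rfl⟩ := h
  exact tr_isHom s

theorem comp_tr {f : W →ₗ[k] X} (hf : IsHom S f) (s : V →ₗ[k] W) :
    f ∘ₗ tr S s = tr S (f ∘ₗ s) := by
  have := Fintype.ofFinite S
  ext v
  simp [tr_apply, hf _]

theorem tr_comp {f : U →ₗ[k] V} (hf : IsHom S f) (s : V →ₗ[k] W) :
    tr S s ∘ₗ f = tr S (s ∘ₗ f) := by
  have := Fintype.ofFinite S
  ext v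
  simp [tr_apply, hf _]

theorem tr_add (s t : V →ₗ[k] W) : tr S (s + t) = tr S s + tr S t := by
  have := Fintype.ofFinite S
  ext v
  simp [tr_apply, Finset.sum_add_distrib]

theorem tr_smul (c : k) (s : V →ₗ[k] W) : tr S (c • s) = c • tr S s := by
  have := Fintype.ofFinite S
  ext v
  simp [tr_apply, Finset.smul_sum, smul_comm]

theorem SZ.add {f h : V →ₗ[k] W} (hf : SZ S f) (hh : SZ S h) : SZ S (f + h) := by
  obtain ⟨s, rfl⟩ := hf
  obtain ⟨t, rfl⟩ := hh
  exact ⟨s + t, tr_add s t⟩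

theorem SZ.smul {f : V →ₗ[k] W} (c : k) (hf : SZ S f) : SZ S (c • f) := by
  obtain ⟨s, rfl⟩ := hf
  exact ⟨c • s, tr_smul c s⟩

theorem SZ.neg {f : V →ₗ[k] W} (hf : SZ S f) : SZ S (-f) := by
  simpa using hf.smul (-1)

theorem SZ.sub {f h : V →ₗ[k] W} (hf : SZ S f) (hh : SZ S h) : SZ S (f - h) := by
  simpa [sub_eq_add_neg] using hf.add hh.neg

theorem SZ.zero : SZ S (0 : V →ₗ[k] W) := by
  have := Fintype.ofFinite S
  exact ⟨0, by ext; simp [tr_apply]⟩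

theorem SZ.sum {ι : Type} (s : Finset ι) {f : ι → V →ₗ[k] W} (hf : ∀ i ∈ s, SZ S (f i)) :
    SZ S (∑ i ∈ s, f i) := by
  classical
  induction s using Finset.induction_on with
  | empty => simpa using SZ.zero
  | insert a s ha ih =>
    rw [Finset.sum_insert ha]
    exact (hf a (by simp)).add (ih fun i hi => hf i (by simp [hi]))

theorem SZ.comp_left {s : V →ₗ[k] W} (hs : SZ S s) {f : W →ₗ[k] X} (hf : IsHom S f) :
    SZ S (f ∘ₗ s) := by
  obtain ⟨s, rfl⟩ := hs
  exact ⟨_, (comp_tr hf s).symm⟩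

theorem SZ.comp_right {s : V →ₗ[k] W} (hs : SZ S s) {f : U →ₗ[k] V} (hf : IsHom S f) :
    SZ S (s ∘ₗ f) := by
  obtain ⟨s, rfl⟩ := hs
  exact ⟨_, (tr_comp hf s).symm⟩

/-- Relative projectivity: the identity is a trace. -/
def Proj (k S V : Type) [Field k] [Group S] [AddCommGroup V] [Module k V] [DistribMulAction S V]
    [SMulCommClass S k V] [Finite S] : Prop := SZ S (LinearMap.id : V →ₗ[k] V)

theorem Proj.sz_from (h : Proj k S V) {f : V →ₗ[k] W} (hf : IsHom S f) : SZ S f := by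
  simpa using SZ.comp_left h hf

theorem Proj.sz_to (h : Proj k S W) {f : V →ₗ[k] W} (hf : IsHom S f) : SZ S f := by
  simpa using SZ.comp_right h hf

theorem SZ.exists_lift {h : V →ₗ[k] X} (hh : SZ S h) {p : W →ₗ[k] X} (hp : IsHom S p)
    (hs : Function.Surjective p) : ∃ t : V →ₗ[k] W, SZ S t ∧ p ∘ₗ t = h := by
  obtain ⟨s, rfl⟩ := hh
  obtain ⟨s', rfl⟩ := Module.projective_lifting_property p s hs
  exact ⟨tr S s', ⟨_, rfl⟩, comp_tr hp s'⟩

theorem SZ.exists_extend {h : V →ₗ[k] X} (hh : SZ S h) {i : V →ₗ[k] W} (hi : IsHom S i)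
    (hinj : Function.Injective i) : ∃ t : W →ₗ[k] X, SZ S t ∧ t ∘ₗ i = h := by
  obtain ⟨s, rfl⟩ := hh
  obtain ⟨r, hr⟩ := LinearMap.exists_leftInverse_of_injective i (LinearMap.ker_eq_bot.2 hinj)
  refine ⟨tr S (s ∘ₗ r), ⟨_, rfl⟩, ?_⟩
  rw [tr_comp hi, LinearMap.comp_assoc, hr, LinearMap.comp_id]

/-- Factor an equivariant map through an equivariant surjection whose kernel it kills. -/
theorem exists_factor_surj {f : V →ₗ[k] X} (hf : IsHom S f) {p : V →ₗ[k] W} (hp : IsHom S p)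
    (hs : Function.Surjective p) (hk : ∀ v, p v = 0 → f v = 0) :
    ∃ t : W →ₗ[k] X, IsHom S t ∧ t ∘ₗ p = f := by
  obtain ⟨r, hr⟩ := LinearMap.exists_rightInverse_of_surjective p (LinearMap.range_eq_top.2 hs)
  have hr' : ∀ w, p (r w) = w := fun w => LinearMap.congr_fun hr w
  have key : ∀ v, f (r (p v)) = f v := fun v => by
    have := hk (r (p v) - v) (by simp [hr'])
    simpa [sub_eq_zero] using this
  refine ⟨f ∘ₗ r, fun g w => ?_, LinearMap.ext key⟩
  obtain ⟨v, rfl⟩ := hs w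
  simp only [LinearMap.comp_apply, key]
  rw [← hp, key, hf]

/-- Factor an equivariant map through an equivariant injection containing its image. -/
theorem exists_factor_inj {f : X →ₗ[k] W} (hf : IsHom S f) {i : V →ₗ[k] W} (hi : IsHom S i)
    (hinj : Function.Injective i) (hk : ∀ x, ∃ v, i v = f x) :
    ∃ t : X →ₗ[k] V, IsHom S t ∧ i ∘ₗ t = f := by
  obtain ⟨r, hr⟩ := LinearMap.exists_leftInverse_of_injective i (LinearMap.ker_eq_bot.2 hinj)
  have hr' : ∀ w, r (i w) = w := fun w => LinearMap.congr_fun hr w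
  have key : ∀ x, i (r (f x)) = f x := fun x => by
    obtain ⟨v, hv⟩ := hk x
    rw [← hv, hr']
  refine ⟨r ∘ₗ f, fun g w => ?_, LinearMap.ext key⟩
  apply hinj
  rw [hi]
  rw [LinearMap.comp_apply, key, hf, LinearMap.comp_apply, key]

section Triple
variable {X' Q X Y' R Y : Type}
  [AddCommGroup X'] [Module k X'] [DistribMulAction S X'] [SMulCommClass S k X']
  [AddCommGroup Q] [Module k Q] [DistribMulAction S Q] [SMulCommClass S k Q]
  [AddCommGroup X] [Module k X] [DistribMulAction S X] [SMulCommClass S k X]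
  [AddCommGroup Y'] [Module k Y'] [DistribMulAction S Y'] [SMulCommClass S k Y']
  [AddCommGroup R] [Module k R] [DistribMulAction S R] [SMulCommClass S k R]
  [AddCommGroup Y] [Module k Y] [DistribMulAction S Y] [SMulCommClass S k Y]

/-- An equivariant short exact sequence. -/
structure EqSES (S : Type) [Group S] [DistribMulAction S X'] [DistribMulAction S Q]
    [DistribMulAction S X] (i : X' →ₗ[k] Q) (p : Q →ₗ[k] X) : Prop where
  hi : IsHom S i
  hp : IsHom S p
  inj : Function.Injective i
  surj : Function.Surjective p
  zero : ∀ x, p (i x) = 0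
  exact : ∀ y, p y = 0 → ∃ x, i x = y

theorem sz_right_of_left {i : X' →ₗ[k] Q} {p : Q →ₗ[k] X} {j : Y' →ₗ[k] R} {q : R →ₗ[k] Y}
    (E : EqSES S i p) (F : EqSES S j q) {a : X' →ₗ[k] Y'} {b : Q →ₗ[k] R} {c : X →ₗ[k] Y}
    (hb : IsHom S b) (h1 : b ∘ₗ i = j ∘ₗ a) (h2 : q ∘ₗ b = c ∘ₗ p)
    (hR : Proj k S R) (ha : SZ S a) : SZ S c := by
  obtain ⟨t, ht, hti⟩ := ha.exists_extend E.hi E.inj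
  obtain ⟨u, hu, hup⟩ := exists_factor_surj (hb.sub (F.hi.comp ht.isHom)) E.hp E.surj (by
    intro v hv
    obtain ⟨x, rfl⟩ := E.exact v hv
    have h1 := LinearMap.congr_fun h1 x
    have h3 := LinearMap.congr_fun hti x
    simp only [LinearMap.comp_apply] at h1 h3
    simp [h1, h3])
  have : c = q ∘ₗ u := by
    ext x
    obtain ⟨y, rfl⟩ := E.surj x
    have h2 := LinearMap.congr_fun h2 y
    have h3 := LinearMap.congr_fun hup y
    simp only [LinearMap.comp_apply] at h2 h3
    simp [h3, ← h2, F.zero]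
  rw [this]
  exact (hR.sz_to hu).comp_left F.hp

theorem sz_left_of_right {i : X' →ₗ[k] Q} {p : Q →ₗ[k] X} {j : Y' →ₗ[k] R} {q : R →ₗ[k] Y}
    (E : EqSES S i p) (F : EqSES S j q) {a : X' →ₗ[k] Y'} {b : Q →ₗ[k] R} {c : X →ₗ[k] Y}
    (hb : IsHom S b) (h1 : b ∘ₗ i = j ∘ₗ a) (h2 : q ∘ₗ b = c ∘ₗ p)
    (hQ : Proj k S Q) (hc : SZ S c) : SZ S a := by
  obtain ⟨t, ht, htq⟩ := hc.exists_lift F.hp F.surj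
  obtain ⟨u, hu, hup⟩ := exists_factor_inj (hb.sub (ht.isHom.comp E.hp)) F.hi F.inj (by
    intro x
    apply F.exact
    have h2 := LinearMap.congr_fun h2 x
    have h3 := LinearMap.congr_fun htq (p x)
    simp only [LinearMap.comp_apply] at h2 h3
    simp [h2, h3])
  have : a = u ∘ₗ i := by
    ext x
    apply F.inj
    have h1 := LinearMap.congr_fun h1 x
    have h3 := LinearMap.congr_fun hup (i x)
    simp only [LinearMap.comp_apply, LinearMap.sub_apply] at h1 h3
    simp [h3, ← h1, E.zero]
  rw [this]
  exact (hQ.sz_from hu).comp_right E.hi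

end Triple

theorem sum_out_mul {W : Type} [AddCommMonoid W] [Fintype S] (P : Subgroup S) [Fintype P]
    [Fintype (S ⧸ P)] (F : S → W) :
    ∑ g, F g = ∑ q : S ⧸ P, ∑ h : P, F (q.out * h) := by
  rw [← Fintype.sum_prod_type']
  refine (Function.Bijective.sum_comp (e := fun x : (S ⧸ P) × P => x.1.out * (x.2 : S))
    ⟨?_, ?_⟩ F).symm
  · rintro ⟨q, h⟩ ⟨q', h'⟩ e
    have hq : q = q' := by
      have := congrArg (QuotientGroup.mk (s := P)) e
      simpa [QuotientGroup.mk_mul_of_mem] using this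
    subst hq
    simpa using e
  · intro g
    have h := QuotientGroup.mk_out_eq_mul P g
    obtain ⟨h, hh⟩ := h
    exact ⟨(g, h⁻¹), by simp [hh]⟩

theorem sum_mul_out {W : Type} [AddCommMonoid W] [Fintype S] (P : Subgroup S) [Fintype P]
    [Fintype (S ⧸ P)] (F : S → W) :
    ∑ g, F g = ∑ q : S ⧸ P, ∑ h : P, F (h * q.out⁻¹) := by
  rw [← Equiv.sum_comp (Equiv.inv S), sum_out_mul P]
  refine Finset.sum_congr rfl fun q _ => ?_
  rw [← Equiv.sum_comp (Equiv.inv P)]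
  simp

theorem SZ.restrict {f : V →ₗ[k] W} (hf : SZ S f) (P : Subgroup S) : SZ P f := by
  have := Fintype.ofFinite S
  have := Fintype.ofFinite P
  have := Fintype.ofFinite (S ⧸ P)
  obtain ⟨s, rfl⟩ := hf
  refine ⟨∑ q : S ⧸ P, DistribSMul.toLinearMap k W q.out⁻¹ ∘ₗ s ∘ₗ
    DistribSMul.toLinearMap k V q.out, ?_⟩
  ext v
  rw [tr_apply, tr_apply, sum_mul_out P, Finset.sum_comm]
  simp [Finset.smul_sum, mul_smul, Subgroup.smul_def]

theorem SZ.of_restrict {f : V →ₗ[k] W} (hf : IsHom S f) (P : Subgroup S) (h : SZ P f)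
    (hm : (P.index : k) ≠ 0) : SZ S f := by
  have := Fintype.ofFinite S
  have := Fintype.ofFinite P
  have := Fintype.ofFinite (S ⧸ P)
  obtain ⟨s, rfl⟩ := h
  refine ⟨(P.index : k)⁻¹ • s, ?_⟩
  ext v
  have h1 : ∀ q : S ⧸ P, q.out • tr P s (q.out⁻¹ • v) = tr P s v := fun q => by
    rw [← hf]; simp
  have h2 : tr S s v = (P.index : k) • tr P s v := by
    rw [tr_apply, sum_out_mul P, Nat.cast_smul_eq_nsmul, Subgroup.index_eq_card,
      Nat.card_eq_fintype_card, ← Finset.card_univ, ← Finset.sum_const]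
    refine Finset.sum_congr rfl fun q _ => ?_
    rw [← h1 q, tr_apply, Finset.smul_sum]
    simp [mul_smul, Subgroup.smul_def]
  rw [tr_smul, LinearMap.smul_apply, h2, smul_smul, inv_mul_cancel₀ hm, one_smul]

end Generic

/-! ### Modules over the group algebra as `k`-spaces with a group action -/

open scoped ModuleCat

/-- Modules over the group algebra. -/
abbrev GMod (k G : Type) [Field k] [Group G] := ModuleCat.{0} (MonoidAlgebra k G)

section Bridge

variable {k G : Type} [Field k] [Group G]

/-- The group action on a module over the group algebra. -/
noncomputable instance actMod (M : GMod k G) : DistribMulAction G M :=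
  DistribMulAction.compHom M (MonoidAlgebra.of k G)

theorem act_def (M : GMod k G) (g : G) (v : M) :
    g • v = MonoidAlgebra.of k G g • v := rfl

theorem scal_def (M : GMod k G) (c : k) (v : M) :
    c • v = algebraMap k (MonoidAlgebra k G) c • v := rfl

instance actComm (M : GMod k G) : SMulCommClass G k M :=
  ⟨fun g c v => by
    rw [act_def, act_def, scal_def, scal_def, smul_smul, smul_smul, Algebra.commutes]⟩

theorem single_smul_eq (M : GMod k G) (g : G) (c : k) (v : M) :
    MonoidAlgebra.single g c • v = c • g • v := by
  rw [act_def, scal_def, smul_smul]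
  congr 1
  simp [MonoidAlgebra.of, MonoidAlgebra.single_mul_single]

/-- The underlying `k`-linear map of a morphism. -/
noncomputable def lin {M N : GMod k G} (f : M ⟶ N) : M →ₗ[k] N where
  toFun := f
  map_add' := map_add f.hom
  map_smul' c v := map_smul f.hom (algebraMap k (MonoidAlgebra k G) c) v

@[simp] theorem lin_apply {M N : GMod k G} (f : M ⟶ N) (v : M) :
    lin f v = f v := rfl

theorem lin_isHom {M N : GMod k G} (f : M ⟶ N) : IsHom G (lin f) :=
  fun g v => map_smul f.hom (MonoidAlgebra.of k G g) v

theorem map_act {M N : GMod k G} (f : M ⟶ N) (g : G) (v : M) :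
    f (g • v) = g • f v := lin_isHom f g v

theorem map_scal {M N : GMod k G} (f : M ⟶ N) (c : k) (v : M) :
    f (c • v) = c • f v := map_smul (lin f) c v

/-- The morphism given by an equivariant linear map. -/
noncomputable def mkHom {M N : GMod k G} (f : M →ₗ[k] N) (hf : IsHom G f) : M ⟶ N :=
  ModuleCat.ofHom
    { toFun := f
      map_add' := map_add f
      map_smul' := fun r v => by
        induction r using MonoidAlgebra.induction_linear with
        | zero => simp
        | add a b ha hb => simp only [add_smul, map_add, ha, hb, RingHom.id_apply] at *
        | single g c => simp [single_smul_eq, hf g] }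

@[simp] theorem mkHom_apply {M N : GMod k G} (f : M →ₗ[k] N)
    (hf : IsHom G f) (v : M) : mkHom f hf v = f v := rfl

@[simp] theorem lin_mkHom {M N : GMod k G} (f : M →ₗ[k] N)
    (hf : IsHom G f) : lin (mkHom f hf) = f := rfl

theorem hom_ext' {M N : GMod k G} {f g : M ⟶ N} (h : ∀ v, f v = g v) :
    f = g := by
  ext v
  exact h v

theorem lin_comp {M N L : GMod k G} (f : M ⟶ N) (g : N ⟶ L) :
    lin (f ≫ g) = lin g ∘ₗ lin f := rfl

theorem lin_id (M : GMod k G) : lin (𝟙 M) = LinearMap.id := rfl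

theorem SES.eqSES {X Y Z : GMod k G} (s : SES X Y Z) :
    EqSES G (lin s.i) (lin s.p) where
  hi := lin_isHom _
  hp := lin_isHom _
  inj := s.inj
  surj := s.surj
  zero x := (s.exact _).2 ⟨x, rfl⟩
  exact y h := (s.exact y).1 h

theorem EqSES.restrict {S X' Q X : Type} [Group S]
    [AddCommGroup X'] [Module k X'] [DistribMulAction S X']
    [AddCommGroup Q] [Module k Q] [DistribMulAction S Q]
    [AddCommGroup X] [Module k X] [DistribMulAction S X]
    {i : X' →ₗ[k] Q} {p : Q →ₗ[k] X} (E : EqSES S i p) (P : Subgroup S) : EqSES P i p where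
  hi g v := E.hi g v
  hp g v := E.hp g v
  inj := E.inj
  surj := E.surj
  zero := E.zero
  exact := E.exact

variable (k G)

/-- A space with a group action as a module over the group algebra. -/
noncomputable def toMod (V : Type) [AddCommGroup V] [Module k V] [DistribMulAction G V]
    [SMulCommClass G k V] : GMod k G :=
  ModuleCat.of _ (Representation.ofDistribMulAction k G V).asModule

noncomputable def toModEquiv (V : Type) [AddCommGroup V] [Module k V] [DistribMulAction G V]
    [SMulCommClass G k V] : toMod k G V ≃ₗ[k] V where
  __ := (Representation.ofDistribMulAction k G V).asModuleEquiv.toAddEquiv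
  map_smul' c v := by
    have := (Representation.ofDistribMulAction k G V).asModuleEquiv_map_smul
      (algebraMap k (MonoidAlgebra k G) c) v
    rw [AlgHom.commutes] at this
    exact this

theorem toModEquiv_smul (V : Type) [AddCommGroup V] [Module k V] [DistribMulAction G V]
    [SMulCommClass G k V] (g : G) (v : toMod k G V) :
    toModEquiv k G V (g • v) = g • toModEquiv k G V v := by
  have := (Representation.ofDistribMulAction k G V).asModuleEquiv_map_smul
      (MonoidAlgebra.of k G g) v
  rw [Representation.asAlgebraHom_of] at this
  exact this

noncomputable def trivEquiv : triv k G ≃ₗ[k] k where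
  __ := (Representation.trivial k (G := G) (V := k)).asModuleEquiv.toAddEquiv
  map_smul' c v := by
    have := (Representation.trivial k (G := G) (V := k)).asModuleEquiv_map_smul
      (algebraMap k (MonoidAlgebra k G) c) v
    rw [AlgHom.commutes] at this
    exact this

variable {k G}

theorem triv_smul (g : G) (v : triv k G) : g • v = v := by
  apply (trivEquiv k G).injective
  have := (Representation.trivial k (G := G) (V := k)).asModuleEquiv_map_smul
      (MonoidAlgebra.of k G g) v
  rw [Representation.asAlgebraHom_of] at this
  exact this

/-- Functions on a group with values in a space, with the action by right translation. -/
@[ext] structure Fn (S V : Type) where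
  of ::
  ev : S → V

instance (S V : Type) : CoeFun (Fn S V) fun _ => S → V := ⟨Fn.ev⟩

/-- The tautological equivalence with functions. -/
def Fn.equiv (S V : Type) : Fn S V ≃ (S → V) := ⟨Fn.ev, Fn.of, fun _ => rfl, fun _ => rfl⟩

section Fn
variable (S V : Type) [Group S] [AddCommGroup V] [Module k V]

instance : AddCommGroup (Fn S V) := (Fn.equiv S V).addCommGroup
instance : Module k (Fn S V) := (Fn.equiv S V).module k
instance : DistribMulAction S (Fn S V) where
  smul a f := .of fun x => f (x * a)
  one_smul f := Fn.ext (funext fun x => congrArg f (mul_one x))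
  mul_smul a b f := Fn.ext (funext fun x => congrArg f (mul_assoc x a b).symm)
  smul_zero _ := rfl
  smul_add _ _ _ := rfl
instance : SMulCommClass S k (Fn S V) := ⟨fun _ _ _ => rfl⟩

variable (k) in
/-- The tautological linear equivalence with functions. -/
def Fn.lequiv : Fn S V ≃ₗ[k] (S → V) :=
  { Fn.equiv S V with
    map_add' := fun _ _ => rfl
    map_smul' := fun _ _ => rfl }

instance [Finite S] [Module.Finite k V] : Module.Finite k (Fn S V) :=
  Module.Finite.equiv (Fn.lequiv k S V).symm

variable {S V}
@[simp] theorem Fn.of_apply (f : S → V) (x : S) : Fn.of f x = f x := rfl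
@[simp] theorem Fn.smul_apply (a : S) (f : Fn S V) (x : S) : (a • f) x = f (x * a) := rfl
@[simp] theorem Fn.scal_apply (a : k) (f : Fn S V) (x : S) : (a • f) x = a • f x := rfl
@[simp] theorem Fn.add_apply (a f : Fn S V) (x : S) : (a + f) x = a x + f x := rfl
@[simp] theorem Fn.zero_apply (x : S) : (0 : Fn S V) x = 0 := rfl
@[simp] theorem Fn.sub_apply (a f : Fn S V) (x : S) : (a - f) x = a x - f x := rfl
@[simp] theorem Fn.neg_apply (f : Fn S V) (x : S) : (-f) x = -f x := rfl

theorem Fn.ext' {f g : Fn S V} (h : ∀ x, f x = g x) : f = g := Fn.ext (funext h)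

@[simp] theorem Fn.sum_apply {ι : Type} (s : Finset ι) (f : ι → Fn S V) (x : S) :
    (∑ i ∈ s, f i) x = ∑ i ∈ s, f i x :=
  map_sum ({ toFun := fun f => f x, map_zero' := rfl, map_add' := fun _ _ => rfl } :
    Fn S V →+ V) f s

theorem Fn.proj [Finite S] : Proj k S (Fn S V) := by
  classical
  have := Fintype.ofFinite S
  refine ⟨{ toFun := fun f => Fn.of fun x => if x = 1 then f 1 else 0,
            map_add' := ?_, map_smul' := ?_ }, ?_⟩
  · intro f g
    ext x
    by_cases h : x = 1 <;> simp [h]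
  · intro c f
    ext x
    by_cases h : x = 1 <;> simp [h]
  · ext f x
    rw [tr_apply, Fn.sum_apply, Finset.sum_eq_single x⁻¹]
    · simp
    · intro b _ hb
      have : x * b ≠ 1 := fun h => hb (eq_inv_of_mul_eq_one_right h)
      simp [this]
    · simp

end Fn

variable (k G) in
/-- The coinduced module of functions on `G`. -/
noncomputable def CV (V : Type) [AddCommGroup V] [Module k V] : GMod k G :=
  toMod k G (Fn G V)

variable (k G) in
noncomputable def cvEquiv (V : Type) [AddCommGroup V] [Module k V] : CV k G V ≃ₗ[k] Fn G V :=
  toModEquiv k G (Fn G V)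

theorem cvEquiv_smul (V : Type) [AddCommGroup V] [Module k V] (g : G) (f : CV k G V) :
    cvEquiv k G V (g • f) = g • cvEquiv k G V f := toModEquiv_smul k G (Fn G V) g f

theorem cvEquiv_symm_smul (V : Type) [AddCommGroup V] [Module k V] (g : G) (f : Fn G V) :
    (cvEquiv k G V).symm (g • f) = g • (cvEquiv k G V).symm f := by
  apply (cvEquiv k G V).injective
  rw [cvEquiv_smul]
  simp

theorem CV.proj (V : Type) [AddCommGroup V] [Module k V] [Finite G] : Proj k G (CV k G V) := by
  have h : (LinearMap.id : CV k G V →ₗ[k] CV k G V) =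
      (cvEquiv k G V).symm.toLinearMap ∘ₗ (LinearMap.id ∘ₗ (cvEquiv k G V).toLinearMap) := by
    ext; simp
  rw [Proj, h]
  exact SZ.comp_left (SZ.comp_right Fn.proj (fun g v => cvEquiv_smul V g v))
    (fun g v => cvEquiv_symm_smul V g v)

/-- The linear map underlying `toC`. -/
noncomputable def toCLin {M : GMod k G} {V : Type} [AddCommGroup V] [Module k V]
    (l : M →ₗ[k] V) : M →ₗ[k] Fn G V where
  toFun v := Fn.of fun x => l (x • v)
  map_add' v w := by
    ext x
    simp
  map_smul' c v := by
    ext x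
    simp [smul_comm x c]

theorem toCLin_isHom {M : GMod k G} {V : Type} [AddCommGroup V] [Module k V]
    (l : M →ₗ[k] V) : IsHom G ((cvEquiv k G V).symm.toLinearMap ∘ₗ toCLin l) := fun g v => by
  simp only [LinearMap.comp_apply, LinearEquiv.coe_coe]
  rw [← cvEquiv_symm_smul]
  congr 1
  ext x
  simp [toCLin, mul_smul]

/-- The morphism into a coinduced module adjoint to a linear map. -/
noncomputable def toC {M : GMod k G} {V : Type} [AddCommGroup V] [Module k V]
    (l : M →ₗ[k] V) : M ⟶ CV k G V := mkHom _ (toCLin_isHom l)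

theorem toC_apply {M : GMod k G} {V : Type} [AddCommGroup V] [Module k V]
    (l : M →ₗ[k] V) (v : M) (x : G) : cvEquiv k G V (toC l v) x = l (x • v) := by
  rw [toC, mkHom_apply, LinearMap.comp_apply, LinearEquiv.coe_coe, LinearEquiv.apply_symm_apply]
  rfl

theorem CV.ext {V : Type} [AddCommGroup V] [Module k V] {f g : CV k G V}
    (h : ∀ x, cvEquiv k G V f x = cvEquiv k G V g x) : f = g :=
  (cvEquiv k G V).injective (Fn.ext' h)

variable [Fintype G]

theorem fromC_isHom {M : GMod k G} {V : Type} [AddCommGroup V] [Module k V] (l : V →ₗ[k] M) :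
    IsHom G (({ toFun := fun f => ∑ x : G, x⁻¹ • l (f x)
                map_add' := fun v w => by simp [Finset.sum_add_distrib]
                map_smul' := fun c v => by simp [Finset.smul_sum, smul_comm _ c] } :
      Fn G V →ₗ[k] M) ∘ₗ (cvEquiv k G V).toLinearMap) := fun g v => by
  simp only [LinearMap.comp_apply, LinearEquiv.coe_coe, cvEquiv_smul, LinearMap.coe_mk,
    AddHom.coe_mk]
  rw [Finset.smul_sum]
  refine Fintype.sum_equiv (Equiv.mulRight g) _ _ fun x => ?_
  simp [smul_smul]

/-- The morphism out of a coinduced module adjoint to a linear map. -/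
noncomputable def fromC {M : GMod k G} {V : Type} [AddCommGroup V]
    [Module k V] (l : V →ₗ[k] M) : CV k G V ⟶ M := mkHom _ (fromC_isHom l)

/-- The counit of coinduction. -/
noncomputable def eps (M : GMod k G) : CV k G M ⟶ M := fromC LinearMap.id

theorem eps_apply {M : GMod k G} (f : CV k G M) :
    eps M f = ∑ x : G, x⁻¹ • (cvEquiv k G M f x) := rfl

theorem eps_surj (M : GMod k G) : Function.Surjective (eps M) := fun v => by
  classical
  refine ⟨(cvEquiv k G M).symm (Fn.of (Pi.single 1 v)), ?_⟩
  rw [eps_apply, LinearEquiv.apply_symm_apply, Finset.sum_eq_single 1]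
  · simp
  · intro b _ hb
    simp [hb]
  · simp

/-- The unit of coinduction. -/
noncomputable def iot (M : GMod k G) : M ⟶ CV k G M := toC LinearMap.id

theorem iot_apply {M : GMod k G} (v : M) (x : G) :
    cvEquiv k G M (iot M v) x = x • v := toC_apply _ _ _

theorem iot_inj (M : GMod k G) : Function.Injective (iot M) := fun v w h => by
  have := iot_apply v 1
  rw [h, iot_apply] at this
  simpa using this.symm

theorem projective_iff (Q : GMod k G) : Projective Q ↔ Proj k G Q := by
  constructor
  · intro h
    have : Epi (eps Q) := (ModuleCat.epi_iff_surjective _).2 (eps_surj Q)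
    obtain ⟨s, hs⟩ := h.factors (𝟙 Q) (eps Q)
    have : (LinearMap.id : Q →ₗ[k] Q) = lin (eps Q) ∘ₗ lin s := by
      rw [← lin_comp, hs, lin_id]
    rw [Proj, this]
    exact ((CV.proj Q).sz_to (lin_isHom s)).comp_left (lin_isHom _)
  · intro h
    refine ⟨fun {E X} f e he => ?_⟩
    obtain ⟨t, ht, hte⟩ := (h.sz_from (lin_isHom f)).exists_lift (lin_isHom e)
      (show Function.Surjective e from (ModuleCat.epi_iff_surjective _).1 he)
    exact ⟨mkHom t ht.isHom, hom_ext' fun v => LinearMap.congr_fun hte v⟩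

theorem stablyZero_iff {M N : GMod k G} (f : M ⟶ N) :
    StablyZero f ↔ SZ G (lin f) := by
  constructor
  · rintro ⟨P, hP, g, h, rfl⟩
    exact (((projective_iff P).1 hP).sz_to (lin_isHom g)).comp_left (lin_isHom h)
  · intro h
    obtain ⟨t, ht, hte⟩ := h.exists_lift (lin_isHom (eps N)) (eps_surj N)
    exact ⟨CV k G N, (projective_iff _).2 (CV.proj N), mkHom t ht.isHom, eps N,
      hom_ext' fun v => (LinearMap.congr_fun hte v).symm⟩

theorem finite_iff (M : GMod k G) :
    Module.Finite (MonoidAlgebra k G) M ↔ Module.Finite k M := by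
  have : Module.Finite k (MonoidAlgebra k G) := inferInstance
  exact ⟨fun h => Module.Finite.trans (MonoidAlgebra k G) M,
    fun h => Module.Finite.of_restrictScalars_finite k (MonoidAlgebra k G) M⟩

/-! Kernels and cokernels. -/

noncomputable def kerObj {M N : GMod k G} (f : M ⟶ N) :
    GMod k G := ModuleCat.of _ (LinearMap.ker f.hom)

noncomputable def kerI {M N : GMod k G} (f : M ⟶ N) : kerObj f ⟶ M :=
  ModuleCat.ofHom (LinearMap.ker f.hom).subtype

theorem kerI_inj {M N : GMod k G} (f : M ⟶ N) :
    Function.Injective (kerI f) := Subtype.val_injective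

theorem exists_kerI {M N : GMod k G} (f : M ⟶ N) (v : M) :
    f v = 0 ↔ ∃ x, kerI f x = v :=
  ⟨fun h => ⟨⟨v, h⟩, rfl⟩, by rintro ⟨x, rfl⟩; exact x.2⟩

noncomputable def kerSES {M N : GMod k G} (f : M ⟶ N)
    (h : Function.Surjective f) : SES (kerObj f) M N :=
  ⟨kerI f, f, kerI_inj f, h, exists_kerI f⟩

noncomputable def cokObj {M N : GMod k G} (f : M ⟶ N) :
    GMod k G := ModuleCat.of _ (N ⧸ LinearMap.range f.hom)

noncomputable def cokP {M N : GMod k G} (f : M ⟶ N) : N ⟶ cokObj f :=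
  ModuleCat.ofHom (LinearMap.range f.hom).mkQ

theorem cokP_surj {M N : GMod k G} (f : M ⟶ N) :
    Function.Surjective (cokP f) := Submodule.mkQ_surjective _

theorem cokP_eq_zero {M N : GMod k G} (f : M ⟶ N) (v : N) :
    cokP f v = 0 ↔ ∃ x, f x = v := by
  change (LinearMap.range f.hom).mkQ v = 0 ↔ _
  simp

noncomputable def cokSES {M N : GMod k G} (f : M ⟶ N)
    (h : Function.Injective f) : SES M N (cokObj f) :=
  ⟨f, cokP f, h, cokP_surj f, cokP_eq_zero f⟩

noncomputable def kObj (M : GMod k G) : GMod k G :=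
  kerObj (eps M)

noncomputable def sObj (M : GMod k G) : GMod k G :=
  cokObj (iot M)

noncomputable def kSES (M : GMod k G) : SES (kObj M) (CV k G M) M :=
  kerSES _ (eps_surj M)

noncomputable def sSES (M : GMod k G) : SES M (CV k G M) (sObj M) :=
  cokSES _ (iot_inj M)

theorem CV.projective (V : Type) [AddCommGroup V] [Module k V] : Projective (CV k G V) :=
  (projective_iff _).2 (CV.proj V)

theorem inThick_kObj {M : GMod k G} (h : InThick (triv k G) M) :
    InThick (triv k G) (kObj M) := .ext₃ (kSES M) (.proj _ (CV.projective _)) h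

theorem inThick_sObj {M : GMod k G} (h : InThick (triv k G) M) :
    InThick (triv k G) (sObj M) := .ext₁ (sSES M) h (.proj _ (CV.projective _))

end Bridge

/-! ### Maps over cyclic groups of order two and three -/

section LinearAlgebra

variable {k U V W : Type} [Field k] [AddCommGroup U] [Module k U] [AddCommGroup V] [Module k V]
  [AddCommGroup W] [Module k W]

theorem exists_lift_on (K : Submodule k V) (f : V →ₗ[k] W) (q : U →ₗ[k] W)
    (h : ∀ v ∈ K, ∃ u, q u = f v) : ∃ s : V →ₗ[k] U, ∀ v ∈ K, q (s v) = f v := by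
  obtain ⟨t, ht⟩ := Module.projective_lifting_property q.rangeRestrict
    ((f ∘ₗ K.subtype).codRestrict (LinearMap.range q) fun v => h v v.2)
    q.surjective_rangeRestrict
  obtain ⟨s, hs⟩ := t.exists_extend
  refine ⟨s, fun v hv => ?_⟩
  have h1 := LinearMap.congr_fun hs ⟨v, hv⟩
  have h2 := congrArg Subtype.val (LinearMap.congr_fun ht ⟨v, hv⟩)
  simp only [LinearMap.comp_apply, Submodule.subtype_apply] at h1 h2
  rw [h1]
  exact h2

theorem exists_comp_eq (f : V →ₗ[k] W) (q : V →ₗ[k] U) (h : ∀ v, q v = 0 → f v = 0) :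
    ∃ s : U →ₗ[k] W, ∀ v, s (q v) = f v := by
  obtain ⟨r, hr⟩ := q.rangeRestrict.exists_rightInverse_of_surjective
    (LinearMap.range_eq_top.2 q.surjective_rangeRestrict)
  obtain ⟨s, hs⟩ := (f ∘ₗ r).exists_extend
  refine ⟨s, fun v => ?_⟩
  have h1 := LinearMap.congr_fun hs ⟨q v, v, rfl⟩
  have h2 := congrArg Subtype.val (LinearMap.congr_fun hr ⟨q v, v, rfl⟩)
  simp only [LinearMap.comp_apply, Submodule.subtype_apply] at h1
  rw [h1, ← sub_eq_zero, ← map_sub]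
  apply h
  rw [map_sub, sub_eq_zero]
  exact h2

theorem exists_sum_two (f : V →ₗ[k] W) (x : V →ₗ[k] V) (y : W →ₗ[k] W)
    (hx : ∀ v, x (x v) = 0) (hy : ∀ w, y (y w) = 0)
    (hf : ∀ v, f (x v) = y (f v)) (h : ∀ v, x v = 0 → ∃ w, y w = f v) :
    ∃ s : V →ₗ[k] W, ∀ v, f v = s (x v) + y (s v) := by
  obtain ⟨s₁, hs₁⟩ := exists_lift_on (LinearMap.ker x) f y h
  obtain ⟨s, hs⟩ := exists_comp_eq
    (LinearMap.codRestrict (LinearMap.ker y) (f - (s₁ ∘ₗ x + y ∘ₗ s₁)) fun v => by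
      have := hs₁ (x v) (hx v)
      simp only [LinearMap.mem_ker, LinearMap.sub_apply, LinearMap.add_apply,
        LinearMap.comp_apply, map_sub, map_add, hy, this, hf, add_zero]
      rw [← hf, ← this, sub_self]) x (fun v hv => by
      have := hs₁ v hv
      ext
      simp [hv, this])
  refine ⟨s₁ + (LinearMap.ker y).subtype ∘ₗ s, fun v => ?_⟩
  have h1 := congrArg Subtype.val (hs v)
  have h2 := (s v).2
  rw [LinearMap.mem_ker] at h2
  simp only [LinearMap.codRestrict_apply, LinearMap.sub_apply, LinearMap.add_apply,
    LinearMap.comp_apply] at h1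
  simp only [LinearMap.add_apply, LinearMap.comp_apply, Submodule.subtype_apply, map_add, h1, h2]
  abel

theorem exists_sum_three (f : V →ₗ[k] W) (x : V →ₗ[k] V) (y : W →ₗ[k] W)
    (hx : ∀ v, x (x (x v)) = 0) (hy : ∀ w, y (y (y w)) = 0)
    (hf : ∀ v, f (x v) = y (f v)) (h : ∀ v, x v = 0 → ∃ w, y (y w) = f v)
    (h' : ∀ v, x (x v) = 0 → ∃ w, y w = f v) :
    ∃ s : V →ₗ[k] W, ∀ v, f v = s (x (x v)) + y (s (x v)) + y (y (s v)) := by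
  obtain ⟨s₁, hs₁⟩ := exists_lift_on (LinearMap.ker x) f (y ∘ₗ y) h
  simp only [LinearMap.mem_ker, LinearMap.comp_apply] at hs₁
  obtain ⟨f₁, hf₁⟩ : ∃ f₁ : V →ₗ[k] W, ∀ v, f₁ v =
      f v - (s₁ (x (x v)) + y (s₁ (x v)) + y (y (s₁ v))) :=
    ⟨f - (s₁ ∘ₗ x ∘ₗ x + y ∘ₗ s₁ ∘ₗ x + y ∘ₗ y ∘ₗ s₁), fun v => rfl⟩
  have hk₁ : ∀ v, x v = 0 → f₁ v = 0 := fun v hv => by simp [hf₁, hv, hs₁ v hv]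
  have hc₁ : ∀ v, f₁ (x v) = y (f₁ v) := fun v => by
    simp only [hf₁, hx, hf, map_zero, map_sub, map_add, hy]
    abel
  obtain ⟨t, ht⟩ := exists_lift_on (LinearMap.range x) LinearMap.id x fun v hv => hv
  obtain ⟨s₂, hs₂⟩ := exists_lift_on (LinearMap.range x ⊓ LinearMap.ker x) (f₁ ∘ₗ t)
    (y ∘ₗ (LinearMap.ker (y ∘ₗ y)).subtype) (by
      rintro v ⟨hv1, hv2⟩
      have e : x (t v) = v := ht v hv1
      rw [SetLike.mem_coe, LinearMap.mem_ker] at hv2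
      obtain ⟨w, hw⟩ := h' (t v) (by rw [e, hv2])
      refine ⟨⟨w - (s₁ (x (t v)) + y (s₁ (t v))), ?_⟩, ?_⟩
      · have := hs₁ v hv2
        simp only [LinearMap.mem_ker, LinearMap.comp_apply, map_sub, map_add, hy, hw, e, this]
        rw [← hf, e]
        simp
      · simp [hf₁, e, hv2, hw])
  simp only [Submodule.mem_inf, LinearMap.mem_range, LinearMap.mem_ker, LinearMap.comp_apply,
    Submodule.subtype_apply] at hs₂
  have hs₂' : ∀ v, x (x v) = 0 → y (s₂ (x v)) = f₁ v := fun v hv => by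
    rw [hs₂ (x v) ⟨⟨v, rfl⟩, hv⟩, ← sub_eq_zero, ← map_sub]
    apply hk₁
    have : x (t (x v)) = x v := ht (x v) ⟨v, rfl⟩
    simp [this]
  have hy₂ : ∀ v, y (y (s₂ v : W)) = 0 := fun v => (s₂ v).2
  obtain ⟨f₂, hf₂⟩ : ∃ f₂ : V →ₗ[k] W, ∀ v, f₂ v =
      f₁ v - (s₂ (x (x v)) + y (s₂ (x v))) :=
    ⟨f₁ - ((LinearMap.ker (y ∘ₗ y)).subtype ∘ₗ s₂ ∘ₗ x ∘ₗ x +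
      y ∘ₗ (LinearMap.ker (y ∘ₗ y)).subtype ∘ₗ s₂ ∘ₗ x), fun v => rfl⟩
  have hk₂ : ∀ v, x (x v) = 0 → f₂ v = 0 := fun v hv => by simp [hf₂, hv, hs₂' v hv]
  have hc₂ : ∀ v, f₂ (x v) = y (f₂ v) := fun v => by
    simp [hf₂, hx, hc₁, hy₂]
  obtain ⟨s₃, hs₃⟩ := exists_comp_eq (LinearMap.codRestrict (LinearMap.ker y) f₂ fun v => by
      rw [LinearMap.mem_ker, ← hc₂, hk₂ _ (hx v)]) (x ∘ₗ x) (fun v hv => by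
      ext
      simpa using hk₂ v hv)
  have hy₃ : ∀ v, y (s₃ v : W) = 0 := fun v => (s₃ v).2
  refine ⟨s₁ + (LinearMap.ker (y ∘ₗ y)).subtype ∘ₗ s₂ + (LinearMap.ker y).subtype ∘ₗ s₃,
    fun v => ?_⟩
  have h1 := congrArg Subtype.val (hs₃ v)
  simp only [LinearMap.codRestrict_apply, LinearMap.comp_apply, hf₂, hf₁] at h1
  simp only [LinearMap.add_apply, LinearMap.comp_apply, Submodule.subtype_apply, map_add, h1,
    hy₃, hy₂, map_zero]
  abel

end LinearAlgebra

section Cyclic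

variable {k S V W : Type} [Field k] [Group S]
  [AddCommGroup V] [Module k V] [DistribMulAction S V] [SMulCommClass S k V]
  [AddCommGroup W] [Module k W] [DistribMulAction S W] [SMulCommClass S k W]

/-- The norm map of the cyclic group of order `p` generated by `a`. -/
def nm (a : S) (p : ℕ) (v : V) : V := ∑ i ∈ Finset.range p, a ^ i • v

theorem tr_cyclic [Finite S] {a : S} (ha : ∀ x, x ∈ Subgroup.zpowers a) (s : V →ₗ[k] W) (v : V) :
    tr S s v = ∑ i ∈ Finset.range (orderOf a), a ^ i • s ((a ^ i)⁻¹ • v) := by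
  classical
  have := Fintype.ofFinite S
  rw [tr_apply, ← IsCyclic.image_range_orderOf ha, Finset.sum_image]
  intro i hi j hj h
  exact pow_injOn_Iio_orderOf (by simpa using hi) (by simpa using hj) h

theorem sz_cyclic_two [Finite S] [CharP k 2] {a : S} (ha : ∀ x, x ∈ Subgroup.zpowers a)
    (ho : orderOf a = 2) {f : V →ₗ[k] W} (hf : IsHom S f)
    (h1 : ∀ v, a • v = v → ∃ w : W, f v = nm a 2 w) : SZ S f := by
  have ha2 : a * a = 1 := by rw [← pow_two, ← ho, pow_orderOf_eq_one]
  have hai : a⁻¹ = a := inv_eq_of_mul_eq_one_left ha2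
  have two : ∀ w : W, w + w = 0 := fun w => by
    rw [← two_smul k w, CharTwo.two_eq_zero, zero_smul]
  have twoV : ∀ w : V, w + w = 0 := fun w => by
    rw [← two_smul k w, CharTwo.two_eq_zero, zero_smul]
  obtain ⟨s, hs⟩ := exists_sum_two f
    (LinearMap.id + DistribSMul.toLinearMap k V a) (LinearMap.id + DistribSMul.toLinearMap k W a)
    (fun v => by simp only [LinearMap.add_apply, LinearMap.id_apply,
        DistribSMul.toLinearMap_apply, smul_add, smul_smul, ha2, one_smul]
                 rw [add_comm (a • v) v]; exact twoV _)
    (fun v => by simp only [LinearMap.add_apply, LinearMap.id_apply,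
        DistribSMul.toLinearMap_apply, smul_add, smul_smul, ha2, one_smul]
                 rw [add_comm (a • v) v]; exact two _)
    (fun v => by simp [hf a])
    (fun v hv => by
      obtain ⟨w, hw⟩ := h1 v (by
        have : v + a • v = 0 := hv
        have h2 := twoV v
        rw [← this] at h2
        exact (add_left_cancel h2).symm)
      exact ⟨w, by simp [hw, nm, Finset.sum_range_succ]⟩)
  refine ⟨DistribSMul.toLinearMap k W a ∘ₗ s, ?_⟩
  ext v
  rw [tr_cyclic ha, ho, hs v]
  simp only [Finset.sum_range_succ, Finset.sum_range_zero, LinearMap.comp_apply, pow_zero, pow_one,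
    hai, DistribSMul.toLinearMap_apply, smul_smul, ha2, one_smul, inv_one, map_add,
    LinearMap.add_apply, LinearMap.id_apply, one_mul]
  have := two (s v)
  linear_combination (norm := abel) -this

theorem sz_cyclic_three [Finite S] [CharP k 3] {a : S} (ha : ∀ x, x ∈ Subgroup.zpowers a)
    (ho : orderOf a = 3) {f : V →ₗ[k] W} (hf : IsHom S f)
    (h1 : ∀ v, a • v = v → ∃ w : W, f v = nm a 3 w)
    (h2 : ∀ v, nm a 3 v = 0 → ∃ w : W, f v = a • w - w) : SZ S f := by
  have ha3 : a * (a * a) = 1 := by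
    have := pow_orderOf_eq_one a
    rwa [ho, pow_succ', pow_two] at this
  have hai : a⁻¹ = a * a := inv_eq_of_mul_eq_one_right ha3
  have hai2 : (a * a)⁻¹ = a := inv_eq_of_mul_eq_one_left ha3
  have k3 : (3 : k) = 0 := by exact_mod_cast CharP.cast_eq_zero k 3
  have three : ∀ w : W, w + w + w = 0 := fun w => by
    have : (3 : k) • w = 0 := by rw [k3, zero_smul]
    rw [← this]; module
  have threeV : ∀ w : V, w + w + w = 0 := fun w => by
    have : (3 : k) • w = 0 := by rw [k3, zero_smul]
    rw [← this]; module
  have nmW : ∀ w : W, nm a 3 w = w + a • w + (a * a) • w := fun w => by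
    simp [nm, Finset.sum_range_succ, pow_two]
  have nmV : ∀ w : V, nm a 3 w = w + a • w + (a * a) • w := fun w => by
    simp [nm, Finset.sum_range_succ, pow_two]
  obtain ⟨s, hs⟩ := exists_sum_three f
    (DistribSMul.toLinearMap k V a - LinearMap.id) (DistribSMul.toLinearMap k W a - LinearMap.id)
    (fun v => by
      simp only [LinearMap.sub_apply, LinearMap.id_apply,
        DistribSMul.toLinearMap_apply, smul_sub, smul_smul, ha3, one_smul]
      linear_combination (norm := abel) -threeV ((a * a) • v) + threeV (a • v))
    (fun v => by
      simp only [LinearMap.sub_apply, LinearMap.id_apply,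
        DistribSMul.toLinearMap_apply, smul_sub, smul_smul, ha3, one_smul]
      linear_combination (norm := abel) -three ((a * a) • v) + three (a • v))
    (fun v => by simp [hf a])
    (fun v hv => by
      obtain ⟨w, hw⟩ := h1 v (sub_eq_zero.1 hv)
      refine ⟨w, ?_⟩
      rw [hw, nmW]
      simp only [LinearMap.sub_apply, LinearMap.id_apply,
        DistribSMul.toLinearMap_apply, smul_sub, smul_smul]
      linear_combination (norm := abel) -three (a • w))
    (fun v hv => by
      obtain ⟨w, hw⟩ := h2 v (by
        rw [nmV, ← hv]
        simp only [LinearMap.sub_apply, LinearMap.id_apply,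
          DistribSMul.toLinearMap_apply, smul_sub, smul_smul]
        linear_combination (norm := abel) threeV (a • v))
      exact ⟨w, hw.symm⟩)
  refine ⟨DistribSMul.toLinearMap k W (a * a) ∘ₗ s, ?_⟩
  ext v
  rw [tr_cyclic ha, ho, hs v]
  simp only [Finset.sum_range_succ, Finset.sum_range_zero, LinearMap.comp_apply, pow_zero, pow_one,
    hai, hai2, DistribSMul.toLinearMap_apply, smul_smul, ha3, one_smul, inv_one, map_sub,
    LinearMap.sub_apply, LinearMap.id_apply, pow_two, mul_assoc, mul_one, one_mul]
  linear_combination (norm := abel) three (s (a • v)) + three (a • s v) - three (s v)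

end Cyclic

/-! ### Norms, thick subcategories and ghosts -/

section Norm

variable {k S V W : Type} [Field k] [Group S]
  [AddCommGroup V] [Module k V] [DistribMulAction S V] [SMulCommClass S k V]
  [AddCommGroup W] [Module k W] [DistribMulAction S W] [SMulCommClass S k W]

/-- The norm of an element: the sum of its translates. -/
noncomputable def nrm (S : Type) [Group S] {V : Type} [AddCommGroup V] [DistribMulAction S V]
    [Finite S] (v : V) : V := letI := Fintype.ofFinite S; ∑ g : S, g • v

variable [Finite S]

theorem nrm_apply [Fintype S] (v : V) : nrm S v = ∑ g : S, g • v :=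
  Finset.sum_congr (by ext; simp) fun g _ => rfl

theorem nrm_add (v w : V) : nrm S (v + w) = nrm S v + nrm S w := by
  simp [nrm, Finset.sum_add_distrib]

theorem nrm_sub (v w : V) : nrm S (v - w) = nrm S v - nrm S w := by
  simp [nrm, smul_sub]

theorem nrm_neg (v : V) : nrm S (-v) = -nrm S v := by
  simp [nrm]

theorem nrm_zero : nrm S (0 : V) = 0 := by
  simp [nrm]

theorem nrm_scal (c : k) (v : V) : nrm S (c • v) = c • nrm S v := by
  simp [nrm, Finset.smul_sum, smul_comm _ c]

theorem map_nrm {f : V →ₗ[k] W} (hf : IsHom S f) (v : V) : f (nrm S v) = nrm S (f v) := by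
  simp [nrm, hf _]

theorem smul_nrm (g : S) (v : V) : g • nrm S v = nrm S v := by
  rw [nrm, Finset.smul_sum]
  let := Fintype.ofFinite S
  refine Fintype.sum_equiv (Equiv.mulLeft g) _ _ fun x => ?_
  simp [smul_smul]

theorem nrm_smul (g : S) (v : V) : nrm S (g • v) = nrm S v := by
  let := Fintype.ofFinite S
  refine Fintype.sum_equiv (Equiv.mulRight g) _ _ fun x => ?_
  simp [smul_smul]

theorem tr_fixed (s : V →ₗ[k] W) {v : V} (hv : ∀ g : S, g • v = v) : tr S s v = nrm S (s v) := by
  have := Fintype.ofFinite S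
  simp [tr_apply, nrm_apply, hv]

/-- Traces send elements of norm zero into the span of the `g • w - w`. -/
theorem tr_nrm_zero (s : V →ₗ[k] W) {v : V} (hv : nrm S v = 0) (R : Submodule k W)
    (hR : ∀ (g : S) (w : W), g • w - w ∈ R) : tr S s v ∈ R := by
  have := Fintype.ofFinite S
  have h : tr S s v = ∑ g : S, (g • s (g⁻¹ • v) - s (g⁻¹ • v)) := by
    have h0 : ∑ g : S, g⁻¹ • v = 0 := by
      rw [← hv, nrm_apply]
      exact Equiv.sum_comp (Equiv.inv S) (fun x => x • v)
    rw [Finset.sum_sub_distrib, ← tr_apply, ← map_sum, h0, map_zero, sub_zero]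
  rw [h]
  exact Submodule.sum_mem _ fun g _ => hR _ _

theorem nrm_eq_nm {a : S} (ha : ∀ x, x ∈ Subgroup.zpowers a) (v : V) :
    nrm S v = nm a (orderOf a) v := by
  classical
  have := Fintype.ofFinite S
  rw [nrm_apply, ← IsCyclic.image_range_orderOf ha, Finset.sum_image, nm]
  intro i hi j hj h
  exact pow_injOn_Iio_orderOf (by simpa using hi) (by simpa using hj) h

theorem nrm_restrict (P : Subgroup S) (v : V) : ∃ w : V, nrm S v = nrm P w := by
  have := Fintype.ofFinite S
  have := Fintype.ofFinite P
  have := Fintype.ofFinite (S ⧸ P)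
  refine ⟨∑ q : S ⧸ P, q.out⁻¹ • v, ?_⟩
  rw [nrm_apply, sum_mul_out P, nrm_apply, Finset.sum_comm]
  simp [Finset.smul_sum, mul_smul, Subgroup.smul_def]

end Norm

section CyclicSub

variable {k G V : Type} [Field k] [Group G] [Finite G]
  [AddCommGroup V] [Module k V] [DistribMulAction G V] [SMulCommClass G k V]

theorem fixed_zpowers {a : G} {v : V} (h : a • v = v) (g : Subgroup.zpowers a) : g • v = v := by
  have : Subgroup.zpowers a ≤ MulAction.stabilizer G v := by
    rw [Subgroup.zpowers_le]
    exact h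
  exact this g.2

theorem smul_nrm_of_comm {a t : G} (h : t * a = a * t) (v : V) :
    t • nrm (Subgroup.zpowers a) v = nrm (Subgroup.zpowers a) (t • v) := by
  have := Fintype.ofFinite (Subgroup.zpowers a)
  rw [nrm_apply, nrm_apply, Finset.smul_sum]
  refine Finset.sum_congr rfl fun g _ => ?_
  obtain ⟨g, n, rfl⟩ := g
  rw [Subgroup.smul_def, Subgroup.smul_def, smul_smul, smul_smul]
  congr 1
  exact ((show SemiconjBy t a a from h).zpow_right n)

theorem smul_nrm_of_inv {a t : G} (h : t * a = a⁻¹ * t) (v : V) :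
    t • nrm (Subgroup.zpowers a) v = nrm (Subgroup.zpowers a) (t • v) := by
  have := Fintype.ofFinite (Subgroup.zpowers a)
  rw [nrm_apply, nrm_apply, Finset.smul_sum, ← Equiv.sum_comp (Equiv.inv _)]
  refine Finset.sum_congr rfl fun g _ => ?_
  obtain ⟨g, n, rfl⟩ := g
  rw [Subgroup.smul_def, Subgroup.smul_def, smul_smul, smul_smul]
  congr 1
  have := ((show SemiconjBy t a a⁻¹ from h).zpow_right (-n)).eq
  simpa using this

/-- The subspace of differences `a • w - w`. -/
def dif (k : Type) {G V : Type} [Field k] [Group G] [AddCommGroup V] [Module k V]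
    [DistribMulAction G V] [SMulCommClass G k V] (a : G) : Submodule k V :=
  LinearMap.range (DistribSMul.toLinearMap k V a - LinearMap.id)

theorem mem_dif {a : G} {v : V} : v ∈ dif k a ↔ ∃ w, v = a • w - w :=
  ⟨fun ⟨w, h⟩ => ⟨w, h.symm⟩, fun ⟨w, h⟩ => ⟨w, h.symm⟩⟩

theorem dif_zpowers (a : G) (g : Subgroup.zpowers a) (w : V) : g • w - w ∈ dif k a := by
  obtain ⟨g, hg⟩ := g
  rw [Subgroup.smul_def]
  change g • w - w ∈ _
  obtain ⟨n, rfl⟩ := (mem_powers_iff_mem_zpowers (x := a)).2 hg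
  induction n with
  | zero => simp
  | succ n ih =>
    have := (dif k a).add_mem (ih (pow_mem (Subgroup.mem_zpowers a) n))
      (mem_dif.2 ⟨a ^ n • w, rfl⟩)
    convert this using 1
    simp only [pow_succ', mul_smul]
    abel

end CyclicSub

section Thick

variable {k G : Type} [Field k] [Group G] [Fintype G]

theorem thick_exact (α β D : MonoidAlgebra k G) (h1 : α * β = 0) (h2 : β * α = 0)
    (h3 : D * α = α * D) (h4 : D * β = β * D) (h5 : D * D = D)
    (h6 : ∀ v : triv k G, D • v = 0)
    (h7 : ∀ (M N : GMod k G) (f : M ⟶ N), StablyZero f → ∀ v, α • v = 0 → ∃ u, f v = β • u)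
    (h8 : ∀ (M N : GMod k G) (f : M ⟶ N), StablyZero f → ∀ v, β • v = 0 → ∃ u, f v = α • u)
    {M : GMod k G} (hM : InThick (triv k G) M) :
    (∀ v : M, α • v = 0 → ∃ u, D • v = β • u) ∧ (∀ v : M, β • v = 0 → ∃ u, D • v = α • u) := by
  have isoAux : ∀ (γ δ : MonoidAlgebra k G), D * γ = γ * D → D * δ = δ * D →
      (∀ (M N : GMod k G) (f : M ⟶ N), StablyZero f → ∀ v, γ • v = 0 → ∃ u, f v = δ • u) →
      ∀ M N : GMod k G, StablyIso M N → (∀ v : M, γ • v = 0 → ∃ u, D • v = δ • u) →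
      ∀ v : N, γ • v = 0 → ∃ u, D • v = δ • u := by
    rintro γ δ hγ hδ hf M N ⟨f, g, -, hfg⟩ hM v hv
    obtain ⟨u, hu⟩ := hM (g v) (by rw [← map_smul, hv, map_zero])
    obtain ⟨u', hu'⟩ := hf _ _ _ hfg v hv
    refine ⟨f u - D • u', ?_⟩
    have e : (g ≫ f - 𝟙 N) v = f (g v) - v := rfl
    have : v = f (g v) - δ • u' := by rw [← hu', e]; abel
    have h := congrArg (D • ·) this
    simp only [smul_sub, ← map_smul, hu] at h ⊢
    rw [h, smul_smul, smul_smul, hδ, map_smul]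
  have ext1 : ∀ (γ δ : MonoidAlgebra k G), δ * γ = 0 → D * γ = γ * D → ∀ X Y Z : GMod k G,
      SES X Y Z → (∀ v : X, δ • v = 0 → ∃ u, D • v = γ • u) →
      (∀ v : Y, γ • v = 0 → ∃ u, D • v = δ • u) →
      ∀ v : Z, γ • v = 0 → ∃ u, D • v = δ • u := by
    intro γ δ h0 hγ X Y Z s hX hY v hv
    obtain ⟨y, rfl⟩ := s.surj v
    obtain ⟨x, hx⟩ := (s.exact (γ • y)).1 (by rw [map_smul, hv])
    obtain ⟨x', hx'⟩ := hX x (s.inj (by rw [map_smul, hx, smul_smul, h0, zero_smul, map_zero]))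
    obtain ⟨y', hy'⟩ := hY (D • y - s.i x') (by
      rw [smul_sub, smul_smul, ← hγ, ← smul_smul, ← hx, ← map_smul, ← map_smul, hx', sub_self])
    refine ⟨s.p y', ?_⟩
    have := congrArg s.p hy'
    rw [map_smul, map_smul, map_sub, map_smul, (s.exact _).2 ⟨x', rfl⟩, sub_zero, smul_smul,
      h5] at this
    exact this
  have ext2 : ∀ (γ δ : MonoidAlgebra k G), γ * δ = 0 → D * γ = γ * D → D * δ = δ * D →
      ∀ X Y Z : GMod k G,
      SES X Y Z → (∀ v : X, γ • v = 0 → ∃ u, D • v = δ • u) →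
      (∀ v : Z, γ • v = 0 → ∃ u, D • v = δ • u) →
      ∀ v : Y, γ • v = 0 → ∃ u, D • v = δ • u := by
    intro γ δ h0 hγ hδ X Y Z s hX hZ v hv
    obtain ⟨u, hu⟩ := hZ (s.p v) (by rw [← map_smul, hv, map_zero])
    obtain ⟨y, rfl⟩ := s.surj u
    obtain ⟨x, hx⟩ := (s.exact (D • v - δ • y)).1 (by rw [map_sub, map_smul, map_smul, hu, sub_self])
    obtain ⟨x', hx'⟩ := hX x (s.inj (by
      rw [map_smul, hx, smul_sub, smul_smul, smul_smul, h0, ← hγ, mul_smul, hv, map_zero]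
      simp))
    refine ⟨D • y + s.i x', ?_⟩
    have := congrArg s.i hx'
    rw [map_smul, map_smul, hx, smul_sub, smul_smul, smul_smul, h5, hδ] at this
    rw [smul_add, ← this, smul_smul]
    abel
  have ext3 : ∀ (γ δ : MonoidAlgebra k G), δ * γ = 0 → D * δ = δ * D →
      ∀ X Y Z : GMod k G,
      SES X Y Z → (∀ v : Y, γ • v = 0 → ∃ u, D • v = δ • u) →
      (∀ v : Z, δ • v = 0 → ∃ u, D • v = γ • u) →
      ∀ v : X, γ • v = 0 → ∃ u, D • v = δ • u := by
    intro γ δ h0 hδ X Y Z s hY hZ x hx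
    obtain ⟨y, hy⟩ := hY (s.i x) (by rw [← map_smul, hx, map_zero])
    obtain ⟨z, hz⟩ := hZ (s.p y) (by
      rw [← map_smul, ← hy, ← map_smul]
      exact (s.exact _).2 ⟨_, rfl⟩)
    obtain ⟨y2, rfl⟩ := s.surj z
    obtain ⟨x2, hx2⟩ := (s.exact (D • y - γ • y2)).1 (by
      rw [map_sub, map_smul, map_smul, hz, sub_self])
    refine ⟨x2, s.inj ?_⟩
    rw [map_smul, map_smul, hx2, smul_sub, smul_smul, smul_smul, h0, ← hδ, mul_smul, ← hy,
      smul_smul, h5]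
    simp
  induction hM with
  | gen => exact ⟨fun v _ => ⟨0, by simp [h6]⟩, fun v _ => ⟨0, by simp [h6]⟩⟩
  | proj P hP =>
    have : StablyZero (𝟙 P) := ⟨P, hP, 𝟙 P, 𝟙 P, by simp⟩
    constructor
    · intro v hv
      obtain ⟨u, hu⟩ := h7 _ _ _ this v hv
      exact ⟨D • u, by rw [smul_smul, ← h4, mul_smul, ← hu]; rfl⟩
    · intro v hv
      obtain ⟨u, hu⟩ := h8 _ _ _ this v hv
      exact ⟨D • u, by rw [smul_smul, ← h3, mul_smul, ← hu]; rfl⟩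
  | iso h _ ih => exact ⟨isoAux α β h3 h4 h7 _ _ h ih.1, isoAux β α h4 h3 h8 _ _ h ih.2⟩
  | ext₁ s _ _ ihX ihY =>
    exact ⟨ext1 α β h2 h3 _ _ _ s ihX.2 ihY.1, ext1 β α h1 h4 _ _ _ s ihX.1 ihY.2⟩
  | ext₂ s _ _ ihX ihZ =>
    exact ⟨ext2 α β h1 h3 h4 _ _ _ s ihX.1 ihZ.1, ext2 β α h2 h4 h3 _ _ _ s ihX.2 ihZ.2⟩
  | ext₃ s _ _ ihY ihZ =>
    exact ⟨ext3 α β h2 h4 _ _ _ s ihY.1 ihZ.2, ext3 β α h1 h3 _ _ _ s ihY.2 ihZ.1⟩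
  | summand h _ ih =>
    obtain ⟨s, r, hsr⟩ := h
    have e : ∀ v, r (s v) = v := fun v => by
      have := CategoryTheory.ConcreteCategory.congr_hom hsr v
      exact this
    constructor
    · intro v hv
      obtain ⟨u, hu⟩ := ih.1 (s v) (by rw [← map_smul, hv, map_zero])
      exact ⟨r u, by rw [← map_smul, ← hu, map_smul, e]⟩
    · intro v hv
      obtain ⟨u, hu⟩ := ih.2 (s v) (by rw [← map_smul, hv, map_zero])
      exact ⟨r u, by rw [← map_smul, ← hu, map_smul, e]⟩

end Thick

/-! ### Sylow subgroups of order two or three -/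

section FixedVectors

variable {k G V : Type} [Field k] [Group G] [Fintype G]
  [AddCommGroup V] [Module k V] [DistribMulAction G V] [SMulCommClass G k V]

/-- The norm of a group as a linear map. -/
noncomputable def nrmLin (k S V : Type) [Field k] [Group S] [Finite S] [AddCommGroup V] [Module k V]
    [DistribMulAction S V] [SMulCommClass S k V] : V →ₗ[k] V where
  toFun := nrm S
  map_add' := nrm_add
  map_smul' := nrm_scal

theorem mem_range_nrm {S : Type} [Group S] [Finite S] [DistribMulAction S V] [SMulCommClass S k V]
    {v : V} : v ∈ LinearMap.range (nrmLin k S V) ↔ ∃ w, v = nrm S w :=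
  ⟨fun ⟨w, h⟩ => ⟨w, h.symm⟩, fun ⟨w, h⟩ => ⟨w, h.symm⟩⟩

theorem nrm_zpowers (a : G) (v : V) :
    nrm (Subgroup.zpowers a) v = ∑ i ∈ Finset.range (orderOf a), a ^ i • v := by
  have h : ∀ x : Subgroup.zpowers a,
      x ∈ Subgroup.zpowers (⟨a, Subgroup.mem_zpowers a⟩ : Subgroup.zpowers a) := by
    rintro ⟨x, n, rfl⟩
    exact ⟨n, by ext; simp⟩
  rw [nrm_eq_nm h, nm, Subgroup.orderOf_mk]
  rfl

theorem exists_fixed {p : ℕ} (hp : p.Prime) [CharP k p] {a : G} (ho : orderOf a = p)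
    (hm : ((Subgroup.zpowers a).index : k) ≠ 0) {v : V} (hv : a • v = v)
    (hN : ∀ t : G, t⁻¹ * a * t ∈ Subgroup.zpowers a →
      ∃ w, t • v - v = nrm (Subgroup.zpowers a) w) :
    ∃ u : V, (∀ g : G, g • u = u) ∧ ∃ w, v - u = nrm (Subgroup.zpowers a) w := by
  classical
  set P := Subgroup.zpowers a with hP
  have hPv : ∀ h : P, h • v = v := fixed_zpowers hv
  have hcard : Nat.card P = p := by rw [hP, Nat.card_zpowers, ho]
  have : Fintype (G ⧸ P) := Fintype.ofFinite _
  have : Fintype P := Fintype.ofFinite _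
  have : Fact p.Prime := ⟨hp⟩
  have hF : ∀ (g : G), (g : G ⧸ P).out • v = g • v := fun g => by
    obtain ⟨h, hh⟩ := QuotientGroup.mk_out_eq_mul P g
    rw [hh, mul_smul]
    congr 1
    exact hPv h
  have hFs : ∀ (g : G) (q : G ⧸ P), (g • q).out • v = g • q.out • v := fun g q => by
    obtain ⟨t, rfl⟩ := QuotientGroup.mk_surjective q
    rw [hF t, ← mul_smul, ← hF (g * t)]
    rfl
  set fx : Finset (G ⧸ P) := Finset.univ.filter fun q => ∀ h : P, h • q = q with hfx
  set R := LinearMap.range (nrmLin k P V) with hR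
  have hfixed : ∀ q ∈ fx, q.out • v - v ∈ R := by
    intro q hq
    obtain ⟨t, rfl⟩ := QuotientGroup.mk_surjective q
    rw [hF]
    refine mem_range_nrm.2 (hN t ?_)
    have := (Finset.mem_filter.1 hq).2 ⟨a, Subgroup.mem_zpowers a⟩
    have h2 : ((a * t : G) : G ⧸ P) = t := this
    have := QuotientGroup.eq.1 h2.symm
    simpa [mul_assoc] using this
  have hcount : (fx.card : k) = (P.index : k) := by
    have h1 : IsPGroup p P := IsPGroup.of_card (n := 1) (by simpa using hcard)
    have h2 := h1.card_modEq_card_fixedPoints (G ⧸ P)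
    have h3 : Nat.card (MulAction.fixedPoints P (G ⧸ P)) = fx.card := by
      rw [Nat.card_eq_fintype_card, Fintype.card_subtype]
      congr 1
      ext
      simp [hfx, MulAction.mem_fixedPoints]
    rw [h3] at h2
    exact ((CharP.natCast_eq_natCast k p).2 h2).symm
  let rep : G ⧸ P → G ⧸ P := fun q =>
    Quotient.out (Quotient.mk (MulAction.orbitRel P (G ⧸ P)) q)
  have hrep : ∀ q, ∃ h : P, h • q = rep q := fun q => by
    have := Quotient.exact (Quotient.out_eq (Quotient.mk (MulAction.orbitRel P (G ⧸ P)) q))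
    exact this
  have hrep' : ∀ (h : P) (q), rep (h • q) = rep q := fun h q => by
    have : Quotient.mk (MulAction.orbitRel P (G ⧸ P)) (h • q) = Quotient.mk _ q :=
      Quotient.sound ⟨h, rfl⟩
    simp only [rep, this]
  let w : G ⧸ P → k := fun q => if q ∈ fx then 0 else if q = rep q then 1 else 0
  have hnf : ∀ (h : P) (q), h • q ∈ fx ↔ q ∈ fx := fun h q => by
    simp only [hfx, Finset.mem_filter, Finset.mem_univ, true_and]
    constructor
    · intro hq h'
      have h2 := hq (h * h' * h⁻¹)
      rw [smul_smul, inv_mul_cancel_right, mul_smul] at h2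
      exact (MulAction.injective h) h2
    · intro hq h'
      rw [hq h, hq h']
  have hfree : ∀ q ∉ fx, ∀ h : P, h • q = q → h = 1 := fun q hq h hh => by
    have : Fact (Nat.card P).Prime := ⟨hcard ▸ hp⟩
    rcases Subgroup.eq_bot_or_eq_top_of_prime_card (MulAction.stabilizer P q) with h0 | h0
    · have : h ∈ MulAction.stabilizer P q := hh
      rw [h0] at this
      exact this
    · refine (hq ?_).elim
      simp only [hfx, Finset.mem_filter, Finset.mem_univ, true_and]
      intro h'
      have : h' ∈ MulAction.stabilizer P q := h0 ▸ Subgroup.mem_top h'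
      exact this
  have hw : ∀ q, ∑ h : P, w (h⁻¹ • q) = if q ∈ fx then 0 else 1 := by
    intro q
    split_ifs with hq
    · simp [w, hnf, hq]
    · obtain ⟨h0, hh0⟩ := hrep q
      rw [Finset.sum_eq_single h0⁻¹]
      · have h1 : rep q ∉ fx := by rw [← hh0, hnf]; exact hq
        have h2 : rep (rep q) = rep q := by rw [← hh0, hrep', hh0]
        simp only [w, inv_inv, hh0, if_neg h1, h2, if_true]
      · intro h _ hne
        simp only [w, hnf, hq, hrep', if_false]
        rw [if_neg]
        intro h1
        apply hne
        have := hfree q hq (h0⁻¹ * h⁻¹) (by rw [mul_smul, h1, ← hh0, inv_smul_smul])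
        rw [mul_eq_one_iff_eq_inv, inv_inv] at this
        exact this.symm
      · simp
  have hsum : nrm P (∑ q, w q • q.out • v) = ∑ q, if q ∈ fx then 0 else q.out • v := by
    rw [nrm_apply]
    simp only [Finset.smul_sum]
    have : ∀ h : P, ∑ q, h • w q • q.out • v = ∑ q, w (h⁻¹ • q) • q.out • v := by
      intro h
      rw [← Equiv.sum_comp (MulAction.toPerm h) fun q => w (h⁻¹ • q) • q.out • v]
      refine Finset.sum_congr rfl fun q _ => ?_
      rw [MulAction.toPerm_apply, inv_smul_smul, smul_comm h]
      congr 1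
      exact (hFs h q).symm
    rw [Finset.sum_congr rfl fun h _ => this h, Finset.sum_comm]
    refine Finset.sum_congr rfl fun q _ => ?_
    rw [← Finset.sum_smul, hw]
    split_ifs <;> simp
  have hu : (∑ q : G ⧸ P, q.out • v) - (P.index : k) • v ∈ R := by
    have e : (∑ q : G ⧸ P, q.out • v) - (P.index : k) • v =
        (∑ q ∈ fx, (q.out • v - v)) + nrm P (∑ q, w q • q.out • v) := by
      rw [hsum, ← hcount, Finset.sum_sub_distrib, Finset.sum_const, ← Nat.cast_smul_eq_nsmul k,
        Finset.sum_ite, Finset.sum_const_zero, zero_add]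
      have h0 := Finset.sum_filter_add_sum_filter_not Finset.univ (· ∈ fx)
        (fun q : G ⧸ P => q.out • v)
      rw [← h0, Finset.filter_mem_eq_inter, Finset.univ_inter]
      abel
    rw [e]
    exact R.add_mem (R.sum_mem hfixed) (mem_range_nrm.2 ⟨_, rfl⟩)
  refine ⟨(P.index : k)⁻¹ • ∑ q : G ⧸ P, q.out • v, fun g => ?_, ?_⟩
  · rw [smul_comm, Finset.smul_sum]
    congr 1
    rw [← Equiv.sum_comp (MulAction.toPerm g) fun q : G ⧸ P => q.out • v]
    exact Finset.sum_congr rfl fun q _ => (hFs g q).symm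
  · rw [← mem_range_nrm (k := k)]
    have := R.smul_mem (-(P.index : k)⁻¹) hu
    convert this using 1
    rw [smul_sub, smul_smul, neg_mul, inv_mul_cancel₀ hm]
    simp
    abel

end FixedVectors

section Centralizer

variable {k G : Type} [Field k] [Group G] [Fintype G] {p : ℕ} [Fact p.Prime] [CharP k p] {a : G}

theorem thick_comm_aux (ho : orderOf a = p) {m : ℕ} (hm : (m : k) ≠ 0) {d : G} (hd : d * a = a * d)
    (hdm : d ^ m = 1) {M : GMod k G} (hM : InThick (triv k G) M) {v : M} (hv : a • v = v) :
    ∃ u, d • v - v = nrm (Subgroup.zpowers a) u := by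
  let A : MonoidAlgebra k G := MonoidAlgebra.of k G a
  let B : MonoidAlgebra k G := MonoidAlgebra.of k G d
  have hA : A ^ p = 1 := by rw [← map_pow, ← ho, pow_orderOf_eq_one, map_one]
  have hB : B ^ m = 1 := by rw [← map_pow, hdm, map_one]
  have hBA : Commute B A := by
    change B * A = A * B
    rw [← map_mul, hd, map_mul]
  let α := A - 1
  let β := ∑ i ∈ Finset.range p, A ^ i
  let e := ∑ i ∈ Finset.range m, B ^ i
  let D := 1 - (m : k)⁻¹ • e
  have hBe : B * e = e := by
    have := mul_geom_sum B m
    rw [hB, sub_self, sub_mul, one_mul, sub_eq_zero] at this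
    exact this
  have hBie : ∀ i, B ^ i * e = e := fun i => by
    induction i with
    | zero => simp
    | succ i ih => rw [pow_succ, mul_assoc, hBe, ih]
  have hee : e * e = (m : k) • e := by
    change (∑ i ∈ Finset.range m, B ^ i) * e = _
    rw [Finset.sum_mul, Finset.sum_congr rfl fun i _ => hBie i, Finset.sum_const,
      Finset.card_range, Nat.cast_smul_eq_nsmul]
  have heA : Commute e A := Commute.sum_left _ _ _ fun i _ => hBA.pow_left i
  have hDA : Commute D A := (Commute.one_left _).sub_left (heA.smul_left _)
  have hDα : Commute D α := hDA.sub_right (Commute.one_right _)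
  have hDβ : Commute D β := Commute.sum_right _ _ _ fun i _ => hDA.pow_right i
  have hα : ∀ (N : GMod k G) (v : N), α • v = a • v - v := fun N v => by
    rw [sub_smul, one_smul]; rfl
  have hβ : ∀ (N : GMod k G) (v : N), β • v = nrm (Subgroup.zpowers a) v := fun N v => by
    rw [Finset.sum_smul, nrm_zpowers, ho]
    refine Finset.sum_congr rfl fun i _ => ?_
    rw [act_def, map_pow]
  have hDD : D * D = D := by
    change (1 - (m : k)⁻¹ • e) * (1 - (m : k)⁻¹ • e) = 1 - (m : k)⁻¹ • e
    have : ((m : k)⁻¹ • e) * ((m : k)⁻¹ • e) = (m : k)⁻¹ • e := by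
      rw [smul_mul_smul_comm, hee, smul_smul, mul_assoc, inv_mul_cancel₀ hm, mul_one]
    rw [mul_sub, mul_one, sub_mul, one_mul, this, sub_self, sub_zero]
  have hDt : ∀ v : triv k G, D • v = 0 := fun v => by
    have h1 : ∀ i, B ^ i • v = v := fun i => by
      rw [← map_pow]; exact triv_smul (d ^ i) v
    rw [sub_smul, one_smul, smul_assoc, Finset.sum_smul, Finset.sum_congr rfl fun i _ => h1 i,
      Finset.sum_const, Finset.card_range, ← Nat.cast_smul_eq_nsmul k, smul_smul,
      inv_mul_cancel₀ hm, one_smul, sub_self]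
  have key := (thick_exact α β D (by
      rw [mul_geom_sum, hA, sub_self]) (by rw [geom_sum_mul, hA, sub_self]) hDα hDβ hDD hDt
    (fun M N f hf v hv => by
      rw [hα, sub_eq_zero] at hv
      obtain ⟨s, hs⟩ := ((stablyZero_iff f).1 hf).restrict (Subgroup.zpowers a)
      refine ⟨s v, ?_⟩
      rw [hβ, ← tr_fixed s (fixed_zpowers hv), hs]
      rfl)
    (fun M N f hf v hv => by
      rw [hβ] at hv
      obtain ⟨s, hs⟩ := ((stablyZero_iff f).1 hf).restrict (Subgroup.zpowers a)
      have := tr_nrm_zero s hv (dif k a) (dif_zpowers a)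
      rw [hs, mem_dif] at this
      obtain ⟨w, hw⟩ := this
      exact ⟨w, by rw [hα, ← hw]; rfl⟩) hM).1 v (by rw [hα, hv, sub_self])
  obtain ⟨u, hu⟩ := key
  refine ⟨B • u - u, ?_⟩
  have hB' : Commute β B := Commute.sum_left _ _ _ fun i _ => hBA.symm.pow_left i
  rw [← hβ, smul_sub, smul_smul, hB', ← smul_smul, ← hu, smul_smul, sub_smul, one_smul,
    mul_sub, mul_one, mul_smul_comm, hBe, sub_smul]
  change B • v - v = _
  abel

theorem thick_comm (ho : orderOf a = p) (hm : ((Subgroup.zpowers a).index : k) ≠ 0) {c : G}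
    (hc : c * a = a * c) {M : GMod k G} (hM : InThick (triv k G) M) {v : M} (hv : a • v = v) :
    ∃ u, c • v - v = nrm (Subgroup.zpowers a) u := by
  set P := Subgroup.zpowers a with hP
  have hcard : Nat.card P = p := by rw [hP, Nat.card_zpowers, ho]
  have hfix : ∀ g : P, g • v = v := fixed_zpowers hv
  let S : Subgroup G :=
    { carrier := {g | g * a = a * g ∧ ∃ u, g • v - v = nrm P u}
      one_mem' := ⟨by simp, 0, by simp [nrm_zero]⟩
      mul_mem' := by
        rintro g h ⟨hg, u, hu⟩ ⟨hh, w, hw⟩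
        refine ⟨by rw [mul_assoc, hh, ← mul_assoc, hg, mul_assoc], g • w + u, ?_⟩
        rw [nrm_add, ← smul_nrm_of_comm hg, ← hw, ← hu, mul_smul, smul_sub]
        abel
      inv_mem' := by
        rintro g ⟨hg, u, hu⟩
        have hg' : g⁻¹ * a = a * g⁻¹ := by
          rw [inv_mul_eq_iff_eq_mul, ← mul_assoc, hg, mul_inv_cancel_right]
        refine ⟨hg', -(g⁻¹ • u), ?_⟩
        rw [nrm_neg, ← smul_nrm_of_comm hg', ← hu, smul_sub, inv_smul_smul]
        abel }
  have h1 : c ^ P.index ∈ S := by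
    have hle : P ≤ Subgroup.centralizer {a} := by
      rw [hP, Subgroup.zpowers_le, Subgroup.mem_centralizer_singleton_iff]
    have : (P.subgroupOf (Subgroup.centralizer {a})).Normal := by
      refine ⟨fun n hn g => ?_⟩
      rw [Subgroup.mem_subgroupOf] at hn ⊢
      have h2 := Subgroup.mem_centralizer_singleton_iff.1 g.2
      have h3 : (g : G) * n = n * g := by
        obtain ⟨i, hi⟩ := hn
        change a ^ i = n at hi
        rw [← hi]
        exact (show Commute (g : G) a from h2).zpow_right i
      rw [Subgroup.coe_mul, Subgroup.coe_mul, h3, Subgroup.coe_inv, mul_inv_cancel_right]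
      exact hn
    have hcC : c ∈ Subgroup.centralizer {a} := Subgroup.mem_centralizer_singleton_iff.2 hc
    have h2 := Subgroup.pow_index_mem (P.subgroupOf (Subgroup.centralizer {a})) ⟨c, hcC⟩
    rw [Subgroup.mem_subgroupOf] at h2
    have h3 : c ^ P.index ∈ P := by
      obtain ⟨n, hn⟩ := Subgroup.relIndex_dvd_index_of_le hle
      rw [hn, pow_mul]
      exact pow_mem h2 n
    refine ⟨(show Commute c a from hc).pow_left _, 0, ?_⟩
    rw [nrm_zero, sub_eq_zero]
    exact hfix ⟨_, h3⟩
  have h2 : c ^ p ∈ S := by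
    have hc' : Commute (c ^ p) a := (show Commute c a from hc).pow_left _
    refine ⟨hc', thick_comm_aux ho hm hc' ?_ hM hv⟩
    rw [← pow_mul, ← hcard, Subgroup.card_mul_index, Nat.card_eq_fintype_card, pow_card_eq_one]
  have hcop : Nat.Coprime p P.index := by
    rw [Nat.Prime.coprime_iff_not_dvd Fact.out]
    exact fun h => hm ((CharP.cast_eq_zero_iff k p _).2 h)
  have h3 : c ∈ S := by
    have h4 := Nat.gcd_eq_gcd_ab p P.index
    rw [hcop.gcd_eq_one, Nat.cast_one] at h4
    have := S.mul_mem (S.zpow_mem h2 (Nat.gcdA p P.index)) (S.zpow_mem h1 (Nat.gcdB p P.index))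
    rwa [← zpow_natCast, ← zpow_natCast, ← zpow_mul, ← zpow_mul, ← zpow_add, ← h4,
      zpow_one] at this
  exact h3.2

end Centralizer

section Ghosts

variable {k G : Type} [Field k] [Group G] [Fintype G]

/-- Maps killed by all maps from the syzygies. -/
def IsGhost (Ω : ℤ → GMod k G) {M N : GMod k G} (f : M ⟶ N) : Prop :=
  ∀ (i : ℤ) (g : Ω i ⟶ M), StablyZero (g ≫ f)

variable {Ω : ℤ → GMod k G} (hΩ : IsSyzygyFamily (triv k G) Ω)

include hΩ in
theorem IsGhost.fixed {M N : GMod k G} {f : M ⟶ N} (hf : IsGhost Ω f) {v : M}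
    (hv : ∀ g : G, g • v = v) : ∃ w, f v = nrm G w := by
  obtain ⟨-, ⟨φ, ψ, -, h⟩, -⟩ := hΩ
  let e : triv k G ⟶ M := mkHom ((LinearMap.toSpanSingleton k M v) ∘ₗ (trivEquiv k G).toLinearMap)
    (fun g x => by
      rw [triv_smul]
      simp only [LinearMap.comp_apply, LinearMap.toSpanSingleton_apply, LinearEquiv.coe_coe]
      rw [smul_comm, hv])
  let o := (trivEquiv k G).symm 1
  have he : e o = v := by
    change trivEquiv k G ((trivEquiv k G).symm 1) • v = v
    rw [LinearEquiv.apply_symm_apply, one_smul]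
  have h1 : SZ G (lin (e ≫ f)) := by
    have h2 : SZ G (lin ((φ ≫ e) ≫ f) ∘ₗ lin ψ) :=
      ((stablyZero_iff _).1 (hf 0 (φ ≫ e))).comp_right (lin_isHom ψ)
    have h3 : SZ G (lin (e ≫ f) ∘ₗ lin (ψ ≫ φ - 𝟙 _)) :=
      ((stablyZero_iff _).1 h).comp_left (lin_isHom (e ≫ f))
    convert h2.sub h3 using 1
    ext x
    change _ = f (e (φ (ψ x))) - f (e (φ (ψ x) - x))
    rw [map_sub, map_sub, sub_sub_cancel]
    rfl
  obtain ⟨s, hs⟩ := h1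
  refine ⟨s o, ?_⟩
  rw [← tr_fixed s fun g => triv_smul g o, hs]
  change f v = f (e o)
  rw [he]

/-- A map induces a compatible map on cosyzygies. -/
theorem exists_sMap {M N : GMod k G} (f : M ⟶ N) :
    ∃ (h : sObj M ⟶ sObj N) (b : CV k G M ⟶ CV k G N),
      (∀ v, b (iot M v) = iot N (f v)) ∧ ∀ v, h ((sSES M).p v) = (sSES N).p (b v) := by
  let ev : CV k G M →ₗ[k] M :=
    { toFun := fun x => cvEquiv k G M x 1
      map_add' := fun x y => by rw [map_add]; rfl
      map_smul' := fun c x => by rw [map_smul]; rfl }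
  let b : CV k G M ⟶ CV k G N := toC (lin f ∘ₗ ev)
  have hb : ∀ v, b (iot M v) = iot N (f v) := fun v => CV.ext fun x => by
    rw [toC_apply, iot_apply, ← map_act, ← map_act]
    change f (cvEquiv k G M (iot M (x • v)) 1) = _
    rw [iot_apply, one_smul]
  obtain ⟨t, ht, ht'⟩ := exists_factor_surj (lin_isHom (b ≫ (sSES N).p)) (lin_isHom (sSES M).p)
    (sSES M).surj (fun v hv => by
      obtain ⟨x, rfl⟩ := ((sSES M).exact v).1 hv
      exact ((sSES N).exact _).2 ⟨f x, (hb x).symm⟩)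
  exact ⟨mkHom t ht, b, hb, fun v => LinearMap.congr_fun ht' v⟩

include hΩ in
theorem IsGhost.sMap {M N : GMod k G} {f : M ⟶ N} (hf : IsGhost Ω f) {h : sObj M ⟶ sObj N}
    {b : CV k G M ⟶ CV k G N} (hb : ∀ v, b (iot M v) = iot N (f v))
    (hh : ∀ v, h ((sSES M).p v) = (sSES N).p (b v)) : IsGhost Ω h := by
  intro i g
  obtain ⟨Q, hQ, ⟨s⟩⟩ := hΩ.2.2 i
  have : Epi (sSES M).p := (ModuleCat.epi_iff_surjective _).2 (sSES M).surj
  let l := Projective.factorThru (s.p ≫ g) (sSES M).p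
  have hl : ∀ v, (sSES M).p (l v) = g (s.p v) := fun v =>
    CategoryTheory.ConcreteCategory.congr_hom (Projective.factorThru_comp (s.p ≫ g) (sSES M).p) v
  obtain ⟨t, ht, ht'⟩ := exists_factor_inj (lin_isHom (s.i ≫ l)) (lin_isHom (sSES M).i)
    (sSES M).inj (fun x => by
      refine ((sSES M).exact _).1 ?_
      change (sSES M).p (l (s.i x)) = 0
      rw [hl, (s.exact _).2 ⟨x, rfl⟩, map_zero])
  rw [stablyZero_iff]
  refine sz_right_of_left s.eqSES (sSES N).eqSES (a := lin (mkHom t ht ≫ f)) (b := lin (l ≫ b))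
    (lin_isHom _) ?_ ?_ (CV.proj _) ((stablyZero_iff _).1 (hf _ _))
  · ext x
    change b (l (s.i x)) = iot N (f (t x))
    rw [← hb]
    congr 1
    exact (LinearMap.congr_fun ht' x).symm
  · ext x
    change (sSES N).p (b (l x)) = h (g (s.p x))
    rw [← hh, hl]

end Ghosts

section SmallSylow

variable {k G : Type} [Field k] [Group G] [Fintype G] {a : G}

theorem exists_nrm_of_proj {Q : GMod k G} (hQ : Proj k G Q) {x : Q} (hx : a • x = x) :
    ∃ c, x = nrm (Subgroup.zpowers a) c := by
  obtain ⟨s, hs⟩ := SZ.restrict hQ (Subgroup.zpowers a)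
  exact ⟨s x, by rw [← tr_fixed s (fixed_zpowers hx), hs]; rfl⟩

theorem exists_dif_of_proj {Q : GMod k G} (hQ : Proj k G Q) {x : Q}
    (hx : nrm (Subgroup.zpowers a) x = 0) : ∃ c, x = a • c - c := by
  obtain ⟨s, hs⟩ := SZ.restrict hQ (Subgroup.zpowers a)
  have := tr_nrm_zero s hx (dif k a) (dif_zpowers a)
  rw [hs] at this
  exact mem_dif.1 this

theorem map_nrm_sub {M N : GMod k G} (f : M ⟶ N) (P : Subgroup G) (v : M) :
    f (nrm P v) = nrm P (f v) :=
  map_nrm (S := P) (f := lin f) (fun g v => lin_isHom f (g : G) v) v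

theorem nrm_dif (v : GMod k G) (x : v) : nrm (Subgroup.zpowers a) (a • x - x) = 0 := by
  rw [nrm_sub, sub_eq_zero]
  exact nrm_smul (⟨a, Subgroup.mem_zpowers a⟩ : Subgroup.zpowers a) x

theorem nrm_zpowers_fixed (v : GMod k G) (x : v) :
    a • nrm (Subgroup.zpowers a) x = nrm (Subgroup.zpowers a) x :=
  smul_nrm (⟨a, Subgroup.mem_zpowers a⟩ : Subgroup.zpowers a) x

theorem sSES_p_iot (M : GMod k G) (v : M) : (sSES M).p (iot M v) = 0 :=
  ((sSES M).exact _).2 ⟨v, rfl⟩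

section Squares

variable {M N : GMod k G} {f : M ⟶ N} {h : sObj M ⟶ sObj N} {b : CV k G M ⟶ CV k G N}
  (hb : ∀ v, b (iot M v) = iot N (f v)) (hh : ∀ v, h ((sSES M).p v) = (sSES N).p (b v))

include hb hh

theorem dif_of_sMap {w : M} {c : CV k G M} (hw : iot M w = a • c - c) {y : sObj N}
    (hy : h ((sSES M).p c) = nrm (Subgroup.zpowers a) y) : ∃ n, f w = a • n - n := by
  obtain ⟨r, rfl⟩ := (sSES N).surj y
  obtain ⟨n, hn⟩ := ((sSES N).exact (b c - nrm (Subgroup.zpowers a) r)).1 (by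
    rw [map_sub, ← hh, hy, map_nrm_sub, sub_self])
  refine ⟨n, iot_inj N ?_⟩
  change iot N n = _ at hn
  rw [← hb, hw, map_sub, map_sub, map_act, map_act, hn, smul_sub, nrm_zpowers_fixed]
  abel

theorem nrm_of_sMap {v : M} {c : CV k G M} (hv : iot M v = nrm (Subgroup.zpowers a) c)
    {y : sObj N} (hy : h ((sSES M).p c) = a • y - y) :
    ∃ n, f v = nrm (Subgroup.zpowers a) n := by
  obtain ⟨r, rfl⟩ := (sSES N).surj y
  obtain ⟨n, hn⟩ := ((sSES N).exact (b c - (a • r - r))).1 (by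
    rw [map_sub, ← hh, hy, map_sub, map_act, sub_self])
  refine ⟨n, iot_inj N ?_⟩
  change iot N n = _ at hn
  rw [← hb, hv, map_nrm_sub, map_nrm_sub, hn, nrm_sub _ (a • r - r), nrm_dif, sub_zero]

end Squares

variable {p : ℕ} [Fact p.Prime] [CharP k p] {Ω : ℤ → GMod k G}
  (hΩ : IsSyzygyFamily (triv k G) Ω) (ho : orderOf a = p)
  (hm : ((Subgroup.zpowers a).index : k) ≠ 0)

include hΩ ho hm

theorem IsGhost.nrm_of_normalizer {M N : GMod k G} {f : M ⟶ N} (hf : IsGhost Ω f) {v : M}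
    (hv : a • v = v) (hN : ∀ t : G, t⁻¹ * a * t ∈ Subgroup.zpowers a →
      ∃ w, t • v - v = nrm (Subgroup.zpowers a) w) :
    ∃ n, f v = nrm (Subgroup.zpowers a) n := by
  obtain ⟨u, hu, w, hw⟩ := exists_fixed (Fact.out : p.Prime) ho hm hv hN
  obtain ⟨y, hy⟩ := hf.fixed hΩ hu
  obtain ⟨y', hy'⟩ := nrm_restrict (Subgroup.zpowers a) y
  refine ⟨y' + f w, ?_⟩
  rw [nrm_add, ← hy', ← hy, ← map_nrm_sub, ← hw, map_sub]
  abel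

theorem IsGhost.nrm_of_skew {M N : GMod k G} (hM : InThick (triv k G) M) {f : M ⟶ N}
    (hf : IsGhost Ω f)
    (hP : ∀ t : G, t⁻¹ * a * t ∈ Subgroup.zpowers a → t * a = a * t ∨ t * a = a⁻¹ * t)
    {v : M} (hv : a • v = v)
    (hN : ∀ t : G, t * a = a⁻¹ * t → ∃ w, t • v + v = nrm (Subgroup.zpowers a) w) :
    ∃ n, f v = nrm (Subgroup.zpowers a) n := by
  obtain ⟨h, b, hb, hh⟩ := exists_sMap f
  obtain ⟨h', b', hb', hh'⟩ := exists_sMap h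
  have hg := (hf.sMap hΩ hb hh).sMap hΩ hb' hh'
  obtain ⟨c, hc⟩ := exists_nrm_of_proj (CV.proj _) (x := iot M v) (a := a) (by
    rw [← map_act, hv])
  set w := (sSES M).p c with hw
  obtain ⟨c', hc'⟩ := exists_dif_of_proj (CV.proj _) (x := iot (sObj M) w) (a := a) (by
    rw [← map_nrm_sub, hw, ← map_nrm_sub, ← hc, sSES_p_iot, map_zero])
  set z := (sSES (sObj M)).p c' with hz
  have hzf : a • z = z := by
    rw [← sub_eq_zero, hz, ← map_act, ← map_sub, ← hc']
    exact ((sSES (sObj M)).exact _).2 ⟨w, rfl⟩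
  have hzN : ∀ t : G, t⁻¹ * a * t ∈ Subgroup.zpowers a →
      ∃ w, t • z - z = nrm (Subgroup.zpowers a) w := by
    intro t ht
    rcases hP t ht with hta | hta
    · exact thick_comm ho hm hta (inThick_sObj (inThick_sObj hM)) hzf
    · obtain ⟨m', hm'⟩ := hN t hta
      obtain ⟨e', he'⟩ := exists_dif_of_proj (CV.proj _) (a := a)
        (x := iot M m' - (a • t • c + c)) (by
          rw [nrm_sub, nrm_add, ← map_nrm_sub, ← hm', map_add, map_act, hc,
            smul_nrm_of_inv hta]
          have : nrm (Subgroup.zpowers a) (a • t • c) = nrm (Subgroup.zpowers a) (t • c) :=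
            nrm_smul (⟨a, Subgroup.mem_zpowers a⟩ : Subgroup.zpowers a) _
          rw [this, sub_self])
      set e := (sSES M).p e' with he
      have he2 : -(a • t • w + w) = a • e - e := by
        have := congrArg (sSES M).p he'
        rw [map_sub, map_sub, map_add, map_act, map_act, map_act,
          sSES_p_iot, zero_sub] at this
        exact this
      have hat : a * (t * a) = t := by rw [hta, mul_inv_cancel_left]
      obtain ⟨c2, hc2⟩ := exists_nrm_of_proj (CV.proj _) (a := a)
        (x := t • c' - c' - iot (sObj M) e) (by
          have h1 : a • iot (sObj M) e = iot (sObj M) e - (a • t • (a • c' - c') + (a • c' - c')) := by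
            rw [← hc', ← map_act (iot (sObj M)) a e, ← map_act (iot (sObj M)) t w,
              ← map_act (iot (sObj M)) a (t • w), ← map_add, ← map_sub]
            congr 1
            have := congrArg (fun x => e + x) he2
            simp only [add_sub_cancel] at this
            rw [← this]
            abel
          rw [smul_sub, smul_sub, h1, smul_sub, smul_sub, smul_smul t a, smul_smul a (t * a), hat]
          abel)
      refine ⟨(sSES (sObj M)).p c2, ?_⟩
      rw [← map_nrm_sub, ← hc2, map_sub, map_sub, map_act]
      rw [sSES_p_iot, sub_zero]
  obtain ⟨y, hy⟩ := hg.nrm_of_normalizer hΩ ho hm hzf hzN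
  obtain ⟨n, hn⟩ := dif_of_sMap hb' hh' hc' hy
  exact nrm_of_sMap hb hh hc hn

theorem IsGhost.nrm_of_fixed (hp : p = 2 ∨ p = 3) {M N : GMod k G} (hM : InThick (triv k G) M)
    {f : M ⟶ N} (hf : IsGhost Ω f) {v : M} (hv : a • v = v) :
    ∃ n, f v = nrm (Subgroup.zpowers a) n := by
  have hP : ∀ t : G, t⁻¹ * a * t ∈ Subgroup.zpowers a → t * a = a * t ∨ t * a = a⁻¹ * t := by
    intro t ht
    have h1 : t⁻¹ * a * t ≠ 1 := by
      intro h
      have : a = 1 := by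
        rw [mul_assoc, inv_mul_eq_one] at h
        exact (mul_eq_right.1 h.symm)
      rw [this, orderOf_one] at ho
      rcases hp with rfl | rfl <;> omega
    obtain ⟨n, hn⟩ := (mem_powers_iff_mem_zpowers.2 ht)
    simp only at hn
    rw [← pow_mod_orderOf, ho] at hn
    have hmod := Nat.mod_lt n (Fact.out : p.Prime).pos
    have h2 : t⁻¹ * a * t = a ∨ t⁻¹ * a * t = a⁻¹ := by
      have hord := pow_orderOf_eq_one a
      rw [ho] at hord
      rcases hp with rfl | rfl
      · interval_cases h : n % 2
        · exact (h1 (by rw [← hn, pow_zero])).elim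
        · exact Or.inl (by rw [← hn, pow_one])
      · interval_cases h : n % 3
        · exact (h1 (by rw [← hn, pow_zero])).elim
        · exact Or.inl (by rw [← hn, pow_one])
        · refine Or.inr ?_
          rw [← hn, eq_inv_iff_mul_eq_one, ← pow_succ, hord]
    rcases h2 with h2 | h2
    · left
      rw [mul_assoc, inv_mul_eq_iff_eq_mul] at h2
      exact h2.symm
    · right
      rw [← inv_inj, inv_inv, mul_inv_rev, mul_inv_rev, inv_inv, ← mul_assoc] at h2
      rw [eq_inv_mul_iff_mul_eq, ← mul_assoc]
      have h3 : t⁻¹ * a⁻¹ * t = a := h2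
      have h4 : a⁻¹ * t = t * a := by
        rw [mul_assoc, inv_mul_eq_iff_eq_mul] at h3
        exact h3
      rw [mul_assoc, ← h4, mul_inv_cancel_left]
  by_cases hinv : ∃ t : G, t * a = a⁻¹ * t ∧ ¬ t * a = a * t
  swap
  · refine hf.nrm_of_normalizer hΩ ho hm hv fun t ht => ?_
    have hta : t * a = a * t := by
      by_contra h
      exact hinv ⟨t, (hP t ht).resolve_left h, h⟩
    exact thick_comm ho hm hta hM hv
  obtain ⟨t, hta, hta'⟩ := hinv
  have hp3 : p = 3 := by
    refine hp.resolve_left fun h => hta' ?_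
    have h1 := pow_orderOf_eq_one a
    rw [ho, h, pow_two] at h1
    rw [hta, inv_eq_of_mul_eq_one_left h1]
  have hchar : (2 : k) = -1 := by
    have : ((3 : ℕ) : k) = 0 := by rw [← hp3]; exact CharP.cast_eq_zero k p
    push_cast at this
    linear_combination this
  have hneg : ∀ x : M, x + x = -x := fun x => by
    rw [← two_smul k, hchar, neg_one_smul]
  have htv : a • t • v = t • v := by
    have : a * t = t * a⁻¹ := by
      rw [eq_mul_inv_iff_mul_eq, mul_assoc, hta, mul_inv_cancel_left]
    rw [smul_smul, this, mul_smul, inv_smul_eq_iff.2 hv.symm]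
  set σ := Subgroup.zpowers a
  have hsq : (t * t) * a = a * (t * t) := by
    have h2 : t * a⁻¹ = a * t := by
      rw [mul_inv_eq_iff_eq_mul, mul_assoc, hta, mul_inv_cancel_left]
    rw [mul_assoc, hta, ← mul_assoc, h2, mul_assoc]
  obtain ⟨w0, hw0⟩ := thick_comm ho hm hsq hM hv
  have hcomm : ∀ s : G, s * a = a⁻¹ * s → (s * t⁻¹) * a = a * (s * t⁻¹) := by
    intro s hs
    have h1 : t⁻¹ * a = a⁻¹ * t⁻¹ := by
      rw [inv_mul_eq_iff_eq_mul, ← mul_assoc]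
      have h2 : t * a⁻¹ = a * t := by
        rw [mul_inv_eq_iff_eq_mul, mul_assoc, hta, mul_inv_cancel_left]
      rw [h2, mul_inv_cancel_right]
    have h2 : s * a⁻¹ = a * s := by
      rw [mul_inv_eq_iff_eq_mul, mul_assoc, hs, mul_inv_cancel_left]
    rw [mul_assoc, h1, ← mul_assoc, h2, mul_assoc]
  have hplus : ∃ n, f (v + t • v) = nrm σ n := by
    have hf1 : a • (v + t • v) = v + t • v := by rw [smul_add, hv, htv]
    refine hf.nrm_of_normalizer hΩ ho hm hf1 fun s hs => ?_
    rcases hP s hs with hsa | hsa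
    · exact thick_comm ho hm hsa hM hf1
    · obtain ⟨w1, hw1⟩ := thick_comm ho hm (hcomm s hsa) hM hf1
      refine ⟨w1 + (s * t⁻¹) • w0, ?_⟩
      rw [nrm_add, ← hw1, ← smul_nrm_of_comm (hcomm s hsa), ← hw0]
      simp only [smul_add, smul_sub, smul_smul, ← mul_assoc, inv_mul_cancel_right]
      abel
  have hminus : ∃ n, f (v - t • v) = nrm σ n := by
    have hf1 : a • (v - t • v) = v - t • v := by rw [smul_sub, hv, htv]
    refine hf.nrm_of_skew hΩ ho hm hM hP hf1 fun s hsa => ?_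
    obtain ⟨w1, hw1⟩ := thick_comm ho hm (hcomm s hsa) hM hf1
    refine ⟨-w1 - (s * t⁻¹) • w0, ?_⟩
    rw [nrm_sub, nrm_neg, ← hw1, ← smul_nrm_of_comm (hcomm s hsa), ← hw0]
    simp only [smul_sub, smul_smul, ← mul_assoc, inv_mul_cancel_right]
    abel
  obtain ⟨n1, hn1⟩ := hplus
  obtain ⟨n2, hn2⟩ := hminus
  refine ⟨-(n1 + n2), ?_⟩
  rw [nrm_neg, nrm_add, ← hn1, ← hn2, ← map_add, ← map_neg]
  congr 1
  have : v + t • v + (v - t • v) = v + v := by abel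
  rw [this, hneg, neg_neg]

theorem IsGhost.stablyZero (hp : p = 2 ∨ p = 3) {M N : GMod k G} (hM : InThick (triv k G) M)
    {f : M ⟶ N} (hf : IsGhost Ω f) : StablyZero f := by
  rw [stablyZero_iff]
  refine SZ.of_restrict (lin_isHom f) (Subgroup.zpowers a) ?_ hm
  have hfP : IsHom (Subgroup.zpowers a) (lin f) := fun g v => lin_isHom f (g : G) v
  let a' : Subgroup.zpowers a := ⟨a, Subgroup.mem_zpowers a⟩
  have ha' : ∀ x : Subgroup.zpowers a, x ∈ Subgroup.zpowers a' := by
    rintro ⟨x, n, rfl⟩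
    exact ⟨n, by ext; simp [a']⟩
  have ho' : orderOf a' = p := by rw [Subgroup.orderOf_mk, ho]
  have h1 : ∀ v : M, a' • v = v → ∃ w : N, lin f v = nm a' p w := by
    intro v hv
    obtain ⟨n, hn⟩ := hf.nrm_of_fixed hΩ ho hm hp hM (v := v) hv
    exact ⟨n, by rw [← ho', ← nrm_eq_nm ha']; exact hn⟩
  rcases hp with hp | hp
  · subst hp
    exact sz_cyclic_two ha' ho' hfP h1
  · subst hp
    refine sz_cyclic_three ha' ho' hfP h1 fun v hv => ?_
    rw [← ho', ← nrm_eq_nm ha'] at hv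
    obtain ⟨h, b, hb, hh⟩ := exists_sMap f
    obtain ⟨c, hc⟩ := exists_dif_of_proj (CV.proj _) (x := iot M v) (a := a) (by
      rw [← map_nrm_sub, hv, map_zero])
    obtain ⟨y, hy⟩ := (hf.sMap hΩ hb hh).nrm_of_fixed hΩ ho hm (Or.inr rfl) (inThick_sObj hM)
      (v := (sSES M).p c) (by
        rw [← sub_eq_zero, ← map_act, ← map_sub, ← hc]
        exact ((sSES M).exact _).2 ⟨v, rfl⟩)
    exact dif_of_sMap hb hh hc hy

end SmallSylow

theorem gHolds_of_card_sylow {k G : Type} [Field k] [Group G] [Fintype G] {p : ℕ}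
    [Fact p.Prime] [CharP k p] (P : Sylow p G) (hP : Nat.card P = 2 ∨ Nat.card P = 3) :
    GHolds k G := by
  intro Ω hΩ M N hM _ f hf
  have hp : Nat.card P = p := by
    obtain ⟨n, hn⟩ := IsPGroup.iff_card.1 P.isPGroup'
    have : (Nat.card P).Prime := by rcases hP with h | h <;> rw [h] <;> norm_num
    rw [hn] at this ⊢
    rw [this.eq_one_of_pow, pow_one]
  rw [hp] at hP
  obtain ⟨⟨a, haP⟩, hgen⟩ := (isCyclic_of_prime_card (p := p) hp).exists_generator
  have hz : Subgroup.zpowers a = P := by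
    refine le_antisymm (by rwa [Subgroup.zpowers_le]) fun x hx => ?_
    obtain ⟨n, hn⟩ := hgen ⟨x, hx⟩
    exact ⟨n, by simpa using congrArg Subtype.val hn⟩
  have ho : orderOf a = p := by
    rw [← Nat.card_zpowers, hz]
    exact hp
  have hm : ((Subgroup.zpowers a).index : k) ≠ 0 := by
    rw [hz]
    intro h
    exact P.not_dvd_index ((CharP.cast_eq_zero_iff k p _).1 h)
  exact IsGhost.stablyZero hΩ ho hm hP hM hf

/-! ### Maps generated by the syzygies -/

section TraceForm

variable {k V W : Type} [Field k] [AddCommGroup V] [Module k V] [AddCommGroup W] [Module k W]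
  [Module.Finite k V]

theorem exists_trace_rep (μ : (V →ₗ[k] W) →ₗ[k] k) :
    ∃ h : W →ₗ[k] V, ∀ g, μ g = LinearMap.trace k V (h ∘ₗ g) := by
  classical
  let b := Module.finBasis k V
  refine ⟨{ toFun := fun w => ∑ i, μ ((b.coord i).smulRight w) • b i
            map_add' := fun w w' => ?_
            map_smul' := fun c w => ?_ }, fun g => ?_⟩
  · rw [← Finset.sum_add_distrib]
    refine Finset.sum_congr rfl fun i _ => ?_
    have : (b.coord i).smulRight (w + w') = (b.coord i).smulRight w + (b.coord i).smulRight w' := by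
      ext; simp
    rw [this, map_add, add_smul]
  · rw [RingHom.id_apply, Finset.smul_sum]
    refine Finset.sum_congr rfl fun i _ => ?_
    have : (b.coord i).smulRight (c • w) = c • (b.coord i).smulRight w := by
      ext; simp [smul_comm c]
    rw [this, map_smul, smul_assoc]
  · rw [LinearMap.trace_eq_matrix_trace k b, Matrix.trace]
    have hg : g = ∑ i, (b.coord i).smulRight (g (b i)) := by
      refine b.ext fun j => ?_
      simp [Finsupp.single_apply]
    conv_lhs => rw [hg]
    rw [map_sum]
    refine Finset.sum_congr rfl fun i _ => ?_
    simp [LinearMap.toMatrix_apply, Finsupp.single_apply]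

theorem eq_zero_of_trace {y : W →ₗ[k] V}
    (h : ∀ s : V →ₗ[k] W, LinearMap.trace k V (y ∘ₗ s) = 0) : y = 0 := by
  let b := Module.finBasis k V
  ext w
  refine b.ext_elem fun i => ?_
  have := h ((b.coord i).smulRight w)
  have e : y ∘ₗ (b.coord i).smulRight w = (b.coord i).smulRight (y w) := by
    ext; simp
  rw [e, LinearMap.trace_smulRight] at this
  simpa using this

end TraceForm

section Gen

variable {k S V W : Type} [Field k] [Group S]
  [AddCommGroup V] [Module k V] [DistribMulAction S V] [SMulCommClass S k V]
  [AddCommGroup W] [Module k W] [DistribMulAction S W] [SMulCommClass S k W]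

/-- The conjugate of a linear map by a group element. -/
def conj (g : S) (s : V →ₗ[k] W) : V →ₗ[k] W :=
  DistribSMul.toLinearMap k W g ∘ₗ s ∘ₗ DistribSMul.toLinearMap k V g⁻¹

@[simp] theorem conj_apply (g : S) (s : V →ₗ[k] W) (v : V) : conj g s v = g • s (g⁻¹ • v) := rfl

theorem tr_eq_sum [Fintype S] (s : V →ₗ[k] W) : tr S s = ∑ g : S, conj g s := by
  ext v
  rw [tr_apply, LinearMap.sum_apply]
  rfl

theorem trace_conj_comp [Module.Finite k V] [Module.Finite k W] (g : S) (h : W →ₗ[k] V)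
    (s : V →ₗ[k] W) :
    LinearMap.trace k V (h ∘ₗ conj g s) = LinearMap.trace k V (conj g⁻¹ h ∘ₗ s) := by
  have e1 : h ∘ₗ conj g s = (h ∘ₗ DistribSMul.toLinearMap k W g ∘ₗ s) ∘ₗ
      DistribSMul.toLinearMap k V g⁻¹ := rfl
  rw [e1, LinearMap.trace_comp_comm']
  congr 1
  ext v
  simp

variable (k S V) in
/-- The space of endomorphisms spanned by the traces and by the maps factoring through members
of a family of representations. -/
def Gen {ι : Type} (X : ι → Type) [∀ i, AddCommGroup (X i)] [∀ i, Module k (X i)]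
    [∀ i, DistribMulAction S (X i)] [∀ i, SMulCommClass S k (X i)] [Finite S] :
    Submodule k (V →ₗ[k] V) :=
  Submodule.span k ({f | SZ S f} ∪ {f | ∃ (i : ι) (a : V →ₗ[k] X i) (b : X i →ₗ[k] V),
    IsHom S a ∧ IsHom S b ∧ f = b ∘ₗ a})

end Gen

section Serre

variable {k G : Type} [Field k] [Group G] [Fintype G]

theorem finite_kObj (M : GMod k G) [Module.Finite k M] : Module.Finite k (kObj M) := by
  have : Module.Finite k (CV k G M) := Module.Finite.equiv (cvEquiv k G M).symm
  exact Module.Finite.of_injective (lin (kSES M).i) (kSES M).inj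

theorem finite_sObj (M : GMod k G) [Module.Finite k M] : Module.Finite k (sObj M) := by
  have : Module.Finite k (CV k G M) := Module.Finite.equiv (cvEquiv k G M).symm
  exact Module.Finite.of_surjective (lin (sSES M).p) (sSES M).surj

theorem exists_lin_factor {A B V : Type} [AddCommGroup A] [Module k A] [AddCommGroup B] [Module k B]
    [AddCommGroup V] [Module k V] {i : A →ₗ[k] B} (hi : Function.Injective i) (f : V →ₗ[k] B)
    (h : ∀ v, ∃ a, i a = f v) : ∃ t : V →ₗ[k] A, i ∘ₗ t = f := by
  obtain ⟨r, hr⟩ := LinearMap.exists_leftInverse_of_injective i (LinearMap.ker_eq_bot.2 hi)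
  refine ⟨r ∘ₗ f, ?_⟩
  ext v
  obtain ⟨a, ha⟩ := h v
  have : r (i a) = a := LinearMap.congr_fun hr a
  simp only [LinearMap.comp_apply]
  rw [← ha, this]

theorem eps_toC {X M : GMod k G} (y : X →ₗ[k] M) (v : X) : eps M (toC y v) = tr G y v := by
  rw [eps_apply, tr_apply, ← Equiv.sum_comp (Equiv.inv G)]
  refine Finset.sum_congr rfl fun g _ => ?_
  rw [toC_apply]
  simp

/-- The linear map placing the values of a map at a single group element. -/
noncomputable def delta {X M : GMod k G} (g : G) (y : X →ₗ[k] M) : X →ₗ[k] CV k G M :=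
  haveI := Classical.decEq G
  (cvEquiv k G M).symm.toLinearMap ∘ₗ
    { toFun := fun v => Fn.of fun x => if x = g then y v else 0
      map_add' := fun v w => Fn.ext' fun x => by
        by_cases h : x = g <;> simp [h]
      map_smul' := fun c w => Fn.ext' fun x => by
        by_cases h : x = g <;> simp [h] }

theorem delta_apply [DecidableEq G] {X M : GMod k G} (g : G) (y : X →ₗ[k] M) (v : X) (x : G) :
    cvEquiv k G M (delta g y v) x = if x = g then y v else 0 := by
  simp only [delta, LinearMap.comp_apply, LinearEquiv.coe_coe, LinearEquiv.apply_symm_apply,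
    LinearMap.coe_mk, AddHom.coe_mk, Fn.of_apply]
  congr

theorem eps_delta {X M : GMod k G} (g : G) (y : X →ₗ[k] M) (v : X) :
    eps M (delta g y v) = g⁻¹ • y v := by
  classical
  rw [eps_apply, Finset.sum_eq_single g]
  · rw [delta_apply, if_pos rfl]
  · intro b _ hb
    rw [delta_apply, if_neg hb, smul_zero]
  · simp

theorem tr_delta {X M : GMod k G} (g : G) (y : X →ₗ[k] M) (v : X) :
    tr G (delta g y) v = toC (y ∘ₗ DistribSMul.toLinearMap k X g⁻¹) v := by
  classical
  refine CV.ext fun x => ?_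
  rw [toC_apply, tr_apply, map_sum, Fn.sum_apply, Finset.sum_eq_single (x⁻¹ * g)]
  · rw [cvEquiv_smul, Fn.smul_apply, delta_apply, if_pos (by group)]
    simp [smul_smul]
  · intro b _ hb
    rw [cvEquiv_smul, Fn.smul_apply, delta_apply, if_neg]
    rintro rfl
    exact hb (by group)
  · simp

theorem sz_of_mem_span {X M : GMod k G} {y : X →ₗ[k] M}
    (hy : y ∈ Submodule.span k {y | ∃ (a : G) (w : X →ₗ[k] M), y = conj a w - w}) :
    ∃ t : X →ₗ[k] kObj M, SZ G t ∧ ∀ v, (kSES M).i (t v) = toC y v := by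
  have hadd : ∀ (c : k) (y z : X →ₗ[k] M) (v : X), toC (y + c • z) v = toC y v + c • toC z v := by
    intro c y z v
    refine CV.ext fun x => ?_
    rw [toC_apply, map_add (cvEquiv k G M), map_smul (cvEquiv k G M)]
    change _ = cvEquiv k G M (toC y v) x + c • cvEquiv k G M (toC z v) x
    rw [toC_apply, toC_apply]
    rfl
  have hz : ∀ v : X, toC (0 : X →ₗ[k] M) v = 0 := fun v => by
    have := hadd (-1) 0 0 v
    rw [smul_zero, add_zero, neg_one_smul, add_neg_cancel] at this
    exact this
  induction hy using Submodule.span_induction with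
  | mem y hy =>
    obtain ⟨a, w, rfl⟩ := hy
    let d : X →ₗ[k] CV k G M := delta a (DistribSMul.toLinearMap k M a ∘ₗ w) - delta 1 w
    obtain ⟨s, hs⟩ := exists_lin_factor (i := lin (kSES M).i) (kSES M).inj d (fun v => by
      refine ((kSES M).exact _).1 ?_
      change eps M (delta a (DistribSMul.toLinearMap k M a ∘ₗ w) v - delta 1 w v) = 0
      rw [map_sub, eps_delta, eps_delta]
      simp)
    refine ⟨tr G s, ⟨s, rfl⟩, fun v => ?_⟩
    have h1 := LinearMap.congr_fun (comp_tr (lin_isHom (kSES M).i) s) v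
    rw [hs] at h1
    change (kSES M).i (tr G s v) = _ at h1
    rw [h1, tr_apply]
    have h2 : ∀ g : G, g • d (g⁻¹ • v) = g • delta a (DistribSMul.toLinearMap k M a ∘ₗ w) (g⁻¹ • v)
      - g • delta 1 w (g⁻¹ • v) := fun g => smul_sub _ _ _
    rw [Finset.sum_congr rfl fun g _ => h2 g, Finset.sum_sub_distrib, ← tr_apply, ← tr_apply,
      tr_delta, tr_delta]
    have h3 := hadd (-1) (conj a w) w v
    rw [neg_one_smul, neg_one_smul, ← sub_eq_add_neg, ← sub_eq_add_neg] at h3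
    rw [h3]
    have h4 : (DistribSMul.toLinearMap k M a ∘ₗ w) ∘ₗ DistribSMul.toLinearMap k X a⁻¹ = conj a w :=
      rfl
    have h5 : w ∘ₗ DistribSMul.toLinearMap k X (1 : G)⁻¹ = w := by
      ext
      simp
    rw [h4, h5]
  | zero => exact ⟨0, .zero, fun v => by rw [hz]; exact map_zero _⟩
  | add y z _ _ hy hz =>
    obtain ⟨t, ht, ht'⟩ := hy
    obtain ⟨u, hu, hu'⟩ := hz
    refine ⟨t + u, ht.add hu, fun v => ?_⟩
    have := hadd 1 y z v
    rw [one_smul, one_smul] at this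
    rw [this, ← ht', ← hu', ← map_add]
    rfl
  | smul c y _ hy =>
    obtain ⟨t, ht, ht'⟩ := hy
    refine ⟨c • t, ht.smul c, fun v => ?_⟩
    have := hadd c 0 y v
    rw [zero_add, hz, zero_add] at this
    rw [this, ← ht', ← map_scal]
    rfl

theorem id_mem_gen (hG : GHolds k G) {Ω : ℤ → GMod k G} (hΩ : IsSyzygyFamily (triv k G) Ω)
    {M : GMod k G} (hM : InThick (triv k G) M) [Module.Finite k M] :
    LinearMap.id ∈ Gen k G M (fun i => Ω i) := by
  by_contra hid
  obtain ⟨l, hl, hle⟩ := Submodule.exists_le_ker_of_notMem hid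
  obtain ⟨θ, hθ⟩ := exists_trace_rep l
  have hgen : ∀ x ∈ Gen k G M (fun i => Ω i), LinearMap.trace k M (θ ∘ₗ x) = 0 := fun x hx => by
    rw [← hθ]
    exact hle hx
  have htr : tr G θ = 0 := by
    refine eq_zero_of_trace fun s => ?_
    have h := hgen (tr G s) (Submodule.subset_span (Or.inl ⟨s, rfl⟩))
    rw [tr_eq_sum] at h ⊢
    have e : ∀ F : G → (M →ₗ[k] M), (∑ g, F g) ∘ₗ s = ∑ g, F g ∘ₗ s := fun F => by
      ext
      simp
    rw [e, map_sum, ← Equiv.sum_comp (Equiv.inv G)]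
    have e' : ∀ F : G → (M →ₗ[k] M), θ ∘ₗ (∑ g, F g) = ∑ g, θ ∘ₗ F g := fun F => by
      ext
      simp
    rw [e', map_sum] at h
    rw [← h]
    exact Finset.sum_congr rfl fun g _ => (trace_conj_comp g θ s).symm
  obtain ⟨φ, hφ, hφ'⟩ := exists_factor_inj (lin_isHom (toC θ)) (lin_isHom (kSES M).i)
    (kSES M).inj (fun x => by
      refine ((kSES M).exact _).1 ?_
      change eps M (toC θ x) = 0
      rw [eps_toC, htr, LinearMap.zero_apply])
  have hφv : ∀ v, (kSES M).i (φ v) = toC θ v := fun v => LinearMap.congr_fun hφ' v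
  have hghost : ∀ (i : ℤ) (g : Ω i ⟶ M), StablyZero (g ≫ mkHom φ hφ) := by
    intro i g
    have hfin : Module.Finite k (Ω i) := (finite_iff _).1 (hΩ.1 i)
    rw [stablyZero_iff]
    obtain ⟨t, ht, ht'⟩ := sz_of_mem_span (y := θ ∘ₗ lin g) (by
      by_contra hn
      obtain ⟨μ, hμ, hμle⟩ := Submodule.exists_le_ker_of_notMem hn
      obtain ⟨h, hh⟩ := exists_trace_rep μ
      have hconj : ∀ a : G, conj a h = h := by
        intro a
        rw [← sub_eq_zero]
        refine eq_zero_of_trace fun s => ?_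
        have : μ (conj a⁻¹ s - s) = 0 := hμle (Submodule.subset_span ⟨a⁻¹, s, rfl⟩)
        rw [hh, LinearMap.comp_sub, map_sub, trace_conj_comp, inv_inv] at this
        rw [LinearMap.sub_comp, map_sub, this]
      have hhom : IsHom G h := fun a v => by
        conv_lhs => rw [← hconj a]
        simp
      apply hμ
      rw [hh, LinearMap.trace_comp_comm', LinearMap.comp_assoc]
      exact hgen _ (Submodule.subset_span (Or.inr ⟨i, h, lin g, hhom, lin_isHom g, rfl⟩)))
    convert ht using 1
    ext v
    apply (kSES M).inj
    rw [ht']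
    change (kSES M).i (φ (g v)) = _
    rw [hφv]
    refine CV.ext fun x => ?_
    rw [toC_apply, toC_apply, ← map_act]
    rfl
  have hsz := (stablyZero_iff _).1 (hG Ω hΩ M (kObj M) hM (inThick_kObj hM) _ hghost)
  rw [lin_mkHom] at hsz
  obtain ⟨β, hβ⟩ := hsz
  apply hl
  rw [hθ]
  let ev : G → (CV k G M →ₗ[k] M) := fun g =>
    { toFun := fun x => cvEquiv k G M x g
      map_add' := fun x y => by rw [map_add]; rfl
      map_smul' := fun c x => by rw [map_smul]; rfl }
  let B : M →ₗ[k] CV k G M := lin (kSES M).i ∘ₗ β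
  have h1 : θ = ∑ g : G, (ev g ∘ₗ B) ∘ₗ DistribSMul.toLinearMap k M g⁻¹ := by
    ext v
    have h2 : θ v = cvEquiv k G M (toC θ v) 1 := by rw [toC_apply, one_smul]
    rw [h2, ← hφv, ← hβ, tr_apply, map_sum, map_sum, Fn.sum_apply, LinearMap.sum_apply]
    refine Finset.sum_congr rfl fun g _ => ?_
    rw [map_act, cvEquiv_smul, Fn.smul_apply, one_mul]
    rfl
  have h3 : LinearMap.trace k M θ = LinearMap.trace k M (lin (eps M) ∘ₗ B) := by
    rw [h1, map_sum, Finset.sum_congr rfl fun g _ => LinearMap.trace_comp_comm' _ _, ← map_sum]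
    congr 1
    ext v
    rw [LinearMap.sum_apply]
    rfl
  rw [LinearMap.comp_id, h3]
  have h4 : lin (eps M) ∘ₗ B = 0 := by
    ext v
    exact ((kSES M).exact _).2 ⟨β v, rfl⟩
  rw [h4, map_zero]

end Serre

/-! ### Representations of `p`-groups in characteristic `p` -/

section PGroup

variable {k S V : Type} [Field k] [Group S] [Finite S]
  [AddCommGroup V] [Module k V] [DistribMulAction S V] [SMulCommClass S k V]
  {p : ℕ} [Fact p.Prime] [CharP k p]

theorem exists_fixed_mem (hS : IsPGroup p S) (K : Submodule k V)
    (hK : ∀ (g : S), ∀ v ∈ K, g • v ∈ K) (h0 : K ≠ ⊥) :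
    ∃ v ∈ K, v ≠ 0 ∧ ∀ g : S, g • v = v := by
  classical
  have := Fintype.ofFinite S
  obtain ⟨v, hv, hv0⟩ := Submodule.exists_mem_ne_zero_of_ne_bot h0
  let _ : Algebra (ZMod p) k := ZMod.algebra k p
  let F : (S → ZMod p) →+ V :=
    { toFun := fun c => ∑ g : S, algebraMap (ZMod p) k (c g) • g • v
      map_zero' := by simp
      map_add' := fun c d => by simp [add_smul, Finset.sum_add_distrib] }
  have hF : ∀ c, F c = ∑ g : S, algebraMap (ZMod p) k (c g) • g • v := fun c => rfl
  have hst : ∀ (a : S), ∀ w ∈ F.range, a • w ∈ F.range := by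
    rintro a _ ⟨c, rfl⟩
    refine ⟨fun g => c (a⁻¹ * g), ?_⟩
    rw [hF, hF, Finset.smul_sum, ← Equiv.sum_comp (Equiv.mulLeft a)]
    refine Finset.sum_congr rfl fun g _ => ?_
    simp [smul_comm a, mul_smul]
  let _ : MulAction S F.range :=
    { smul := fun a w => ⟨a • w.1, hst a _ w.2⟩
      one_smul := fun w => Subtype.ext (one_smul S w.1)
      mul_smul := fun a b w => Subtype.ext (mul_smul a b w.1) }
  have hfin : Finite F.range := Set.finite_range F
  have hvF : v ∈ F.range := by
    refine ⟨Pi.single 1 1, ?_⟩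
    rw [hF, Finset.sum_eq_single 1]
    · simp
    · intro b _ hb
      simp [hb]
    · simp
  have hcard : p ∣ Nat.card F.range := by
    have h1 : Nat.card F.range ∣ p ^ Nat.card S := by
      have := AddSubgroup.card_range_dvd F
      rwa [Nat.card_fun, Nat.card_zmod] at this
    obtain ⟨m, -, hm⟩ := (Nat.dvd_prime_pow Fact.out).1 h1
    rw [hm]
    refine dvd_pow_self p ?_
    rintro rfl
    rw [pow_zero, Nat.card_eq_one_iff_unique] at hm
    have := hm.1
    exact hv0 (congrArg Subtype.val (Subsingleton.elim (⟨v, hvF⟩ : F.range) 0))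
  obtain ⟨b, hb, hb0⟩ := hS.exists_fixed_point_of_prime_dvd_card_of_fixed_point F.range hcard
    (a := 0) (fun g => Subtype.ext (smul_zero g))
  refine ⟨b.1, ?_, fun h => hb0 (Subtype.ext h.symm), fun g => congrArg Subtype.val (hb g)⟩
  obtain ⟨c, hc⟩ := b.2
  rw [← hc, hF]
  exact K.sum_mem fun g _ => K.smul_mem _ (hK g v hv)

theorem dvd_finrank_range (hS : IsPGroup p S) [Module.Finite k V] {π : V →ₗ[k] V}
    (hπ : π ∘ₗ π = π) (hz : SZ S π) : Nat.card S ∣ Module.finrank k (LinearMap.range π) := by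
  classical
  have := Fintype.ofFinite S
  have hhom := hz.isHom
  obtain ⟨s, hs⟩ := hz
  have hππ : ∀ v, π (π v) = π v := fun v => LinearMap.congr_fun hπ v
  let F : Submodule k V :=
    { carrier := {v | π v = v ∧ ∀ g : S, g • v = v}
      add_mem' := fun {v w} hv hw => ⟨by rw [map_add, hv.1, hw.1], fun g => by
        rw [smul_add, hv.2, hw.2]⟩
      zero_mem' := ⟨map_zero _, fun g => smul_zero g⟩
      smul_mem' := fun c v hv => ⟨by rw [map_smul, hv.1], fun g => by
        rw [smul_comm, hv.2]⟩ }
  let Ψ : Fn S F →ₗ[k] V :=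
    { toFun := fun f => ∑ g : S, g⁻¹ • π (s (f g))
      map_add' := fun f h => by simp [Finset.sum_add_distrib]
      map_smul' := fun c f => by simp [Finset.smul_sum, smul_comm _ c] }
  have hΨ : ∀ f, Ψ f = ∑ g : S, g⁻¹ • π (s (f g)) := fun f => rfl
  have hΨhom : IsHom S Ψ := fun a f => by
    rw [hΨ, hΨ, Finset.smul_sum, ← Equiv.sum_comp (Equiv.mulRight a)]
    refine Fintype.sum_equiv (Equiv.mulRight (a * a)) _ _ fun x => ?_
    simp [smul_smul, mul_assoc]
  have hconst : ∀ v : F, Ψ (Fn.of fun _ => v) = v := fun v => by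
    have h1 : π (tr S s v) = v := by rw [hs, hππ, v.2.1]
    conv_rhs => rw [← h1, tr_apply, map_sum]
    rw [hΨ, ← Equiv.sum_comp (Equiv.inv S)]
    refine Finset.sum_congr rfl fun g _ => ?_
    simp [hhom g, v.2.2]
  have hinj : Function.Injective Ψ := by
    rw [← LinearMap.ker_eq_bot]
    by_contra hne
    obtain ⟨f, hf, hf0, hfix⟩ := exists_fixed_mem (S := S) hS _ (fun g v hv => by
      rw [LinearMap.mem_ker] at hv ⊢
      rw [hΨhom, hv, smul_zero]) hne
    have hc : f = Fn.of fun _ => f 1 := Fn.ext' fun x => by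
      conv_rhs => rw [Fn.of_apply, ← hfix x]
      simp
    rw [LinearMap.mem_ker, hc, hconst] at hf
    apply hf0
    rw [hc, show f 1 = 0 from Subtype.ext hf]
    rfl
  obtain ⟨r, hr, hrΨ⟩ := (Fn.proj (k := k) (S := S) (V := F)).exists_extend hΨhom hinj
  have hrΨ' : ∀ f, r (Ψ f) = f := fun f => LinearMap.congr_fun hrΨ f
  have hbot : LinearMap.range π ⊓ LinearMap.ker r = ⊥ := by
    by_contra hne
    obtain ⟨v, ⟨⟨w, rfl⟩, hv⟩, hv0, hfix⟩ := exists_fixed_mem (S := S) hS _ (fun g v hv => by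
      obtain ⟨⟨w, rfl⟩, h2⟩ := hv
      refine ⟨⟨g • w, hhom g w⟩, ?_⟩
      rw [SetLike.mem_coe, LinearMap.mem_ker] at h2 ⊢
      rw [hr.isHom, h2, smul_zero]) hne
    have h3 := hrΨ' (Fn.of fun _ => ⟨π w, hππ w, hfix⟩)
    rw [hconst] at h3
    rw [SetLike.mem_coe, LinearMap.mem_ker] at hv
    change r (π w) = _ at h3
    rw [hv] at h3
    exact hv0 (congrArg (fun f : Fn S F => ((f 1 : F) : V)) h3).symm
  have hmem : ∀ f, Ψ f ∈ LinearMap.range π := fun f => by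
    refine ⟨Ψ f, ?_⟩
    rw [hΨ, map_sum]
    simp [hhom _, hππ]
  have hrange : LinearMap.range Ψ = LinearMap.range π := by
    apply le_antisymm
    · rintro _ ⟨f, rfl⟩
      exact hmem f
    · intro x hx
      have : x - Ψ (r x) ∈ LinearMap.range π ⊓ LinearMap.ker r :=
        ⟨Submodule.sub_mem _ hx (hmem _), by simp [hrΨ']⟩
      rw [hbot, Submodule.mem_bot, sub_eq_zero] at this
      exact ⟨_, this.symm⟩
  rw [← hrange, LinearMap.finrank_range_of_inj hinj, (Fn.lequiv k S F).finrank_eq,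
    Module.finrank_pi_fintype]
  simp [Nat.card_eq_fintype_card]

end PGroup

section Corner

variable {k S V : Type} [Field k] [Group S] [Finite S]
  [AddCommGroup V] [Module k V] [DistribMulAction S V] [SMulCommClass S k V] [Module.Finite k V]

theorem finrank_range_comp_le {U W X : Type} [AddCommGroup U] [Module k U] [AddCommGroup W]
    [Module k W] [AddCommGroup X] [Module k X] [Module.Finite k W]
    (f : W →ₗ[k] X) (g : V →ₗ[k] W) (h : U →ₗ[k] V) :
    Module.finrank k (LinearMap.range (f ∘ₗ g ∘ₗ h)) ≤ Module.finrank k (LinearMap.range g) := by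
  rw [LinearMap.range_comp]
  exact (Submodule.finrank_map_le f _).trans
    (Submodule.finrank_mono (LinearMap.range_comp_le_range h g))

theorem finrank_range_add {π ρ : Module.End k V} (hρ : ρ * ρ = ρ)
    (h1 : π * ρ = ρ) (h2 : ρ * π = ρ) :
    Module.finrank k (LinearMap.range ρ) + Module.finrank k (LinearMap.range (π - ρ)) =
      Module.finrank k (LinearMap.range π) := by
  have e : ∀ {a b c : Module.End k V}, a * b = c → ∀ v, a (b v) = c v := fun h v => by
    rw [← h]; rfl
  rw [← Submodule.finrank_sup_add_finrank_inf_eq]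
  have hinf : LinearMap.range ρ ⊓ LinearMap.range (π - ρ) = ⊥ := by
    rw [eq_bot_iff]
    rintro _ ⟨⟨v, rfl⟩, ⟨w, hw⟩⟩
    have := congrArg ρ hw
    rw [e hρ] at this
    rw [Submodule.mem_bot, ← this, LinearMap.sub_apply, map_sub, e h2, e hρ, sub_self]
  have hsup : LinearMap.range ρ ⊔ LinearMap.range (π - ρ) = LinearMap.range π := by
    apply le_antisymm
    · rw [sup_le_iff]
      constructor
      · rintro _ ⟨v, rfl⟩
        exact ⟨ρ v, e h1 v⟩
      · rintro _ ⟨v, rfl⟩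
        exact ⟨v - ρ v, by rw [map_sub, e h1]; rfl⟩
    · rintro _ ⟨v, rfl⟩
      exact Submodule.mem_sup.2 ⟨ρ v, ⟨v, rfl⟩, (π - ρ) v, ⟨v, rfl⟩, by simp⟩
  rw [hinf, hsup, finrank_bot, add_zero]

theorem IsHom.pow {x : Module.End k V} (hx : IsHom S x) (n : ℕ) : IsHom S (x ^ n) := by
  induction n with
  | zero => exact fun g v => rfl
  | succ n ih => exact fun g v => by rw [pow_succ, Module.End.mul_apply, hx, ih]; rfl

theorem exists_fitting (S : Type) [Group S] [Finite S] [DistribMulAction S V]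
    [SMulCommClass S k V] {x : Module.End k V}
    (hx : IsHom S x) : ∃ (n : ℕ) (ρ : Module.End k V), 0 < n ∧ IsHom S ρ ∧ ρ * ρ = ρ ∧
      LinearMap.ker ρ = LinearMap.ker (x ^ n) ∧ LinearMap.range ρ = LinearMap.range (x ^ n) := by
  obtain ⟨n, hc, hn⟩ := (x.eventually_isCompl_ker_pow_range_pow.and
    (Filter.eventually_gt_atTop 0)).exists
  have hxn : IsHom S (x ^ n) := hx.pow n
  let ρ : Module.End k V := Submodule.projection _ _ hc.symm
  have hk : LinearMap.ker ρ = LinearMap.ker (x ^ n) := Submodule.ker_projection hc.symm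
  have hr : LinearMap.range ρ = LinearMap.range (x ^ n) :=
    Submodule.range_projection hc.symm
  have hρρ : ρ * ρ = ρ := Submodule.isIdempotentElem_projection hc.symm
  have hρ' : ∀ v, ρ (ρ v) = ρ v := fun v => LinearMap.congr_fun hρρ v
  refine ⟨n, ρ, hn, fun g v => ?_, hρρ, hk, hr⟩
  have h1 : ρ (g • ρ v) = g • ρ v := by
    have : ρ v ∈ LinearMap.range (x ^ n) := by
      rw [← hr]
      exact ⟨v, rfl⟩
    obtain ⟨w, hw⟩ := this
    have : g • ρ v ∈ LinearMap.range ρ := by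
      rw [hr, ← hw]
      exact ⟨g • w, hxn g w⟩
    obtain ⟨u, hu⟩ := this
    rw [← hu, hρ']
  have h2 : ρ (g • (v - ρ v)) = 0 := by
    have : v - ρ v ∈ LinearMap.ker (x ^ n) := by
      rw [← hk, LinearMap.mem_ker, map_sub, hρ', sub_self]
    rw [← LinearMap.mem_ker, hk, LinearMap.mem_ker, hxn, LinearMap.mem_ker.1 this, smul_zero]
  have h3 : g • v = g • ρ v + g • (v - ρ v) := by rw [← smul_add, add_sub_cancel]
  conv_lhs => rw [h3, map_add, h1, h2, add_zero]

/-- The endomorphism has a left inverse relative to an idempotent. -/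
def Lft (S : Type) [Group S] [DistribMulAction S V] (π x : Module.End k V) : Prop :=
  ∃ η : Module.End k V, IsHom S η ∧ η * x = π

variable {π : Module.End k V}

theorem lft_or_nilpotent (hhom : IsHom S π) (hπ : π * π = π)
    (hprim : ∀ ρ : Module.End k V, IsHom S ρ → ρ * ρ = ρ → π * ρ = ρ → ρ * π = ρ →
      ρ = 0 ∨ ρ = π)
    {x : Module.End k V} (hx : IsHom S x) (h1 : π * x = x) (h2 : x * π = x) :
    Lft S π x ∨ ∃ n, x ^ n = 0 := by
  have e : ∀ {a b c : Module.End k V}, a * b = c → ∀ v, a (b v) = c v := fun h v => by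
    rw [← h]; rfl
  obtain ⟨n, ρ, hn, hρhom, hρ, hk, hr⟩ := exists_fitting S hx
  obtain ⟨m, rfl⟩ := Nat.exists_eq_succ_of_ne_zero hn.ne'
  have h3 : π * ρ = ρ := by
    ext v
    have : ρ v ∈ LinearMap.range (x ^ (m + 1)) := hr ▸ ⟨v, rfl⟩
    obtain ⟨w, hw⟩ := this
    rw [Module.End.mul_apply, ← hw, pow_succ', Module.End.mul_apply, e h1]
  have h4 : ρ * π = ρ := by
    ext v
    have : π v - v ∈ LinearMap.ker ρ := by
      rw [hk, LinearMap.mem_ker, map_sub, sub_eq_zero, pow_succ, Module.End.mul_apply, e h2]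
      rfl
    rwa [LinearMap.mem_ker, map_sub, sub_eq_zero] at this
  rcases hprim ρ hρhom hρ h3 h4 with rfl | rfl
  · right
    refine ⟨m + 1, ?_⟩
    rw [← LinearMap.range_eq_bot, ← hr, LinearMap.range_zero]
  · left
    let y : Module.End k V := x + (1 - ρ)
    have hy : IsHom S y := hx.add ((IsHom.id).sub hhom)
    have hyv : ∀ v, y v = x v + (v - ρ v) := fun v => rfl
    have hinj : LinearMap.ker y = ⊥ := by
      rw [eq_bot_iff]
      intro v hv
      rw [LinearMap.mem_ker] at hv
      have h5 : x v = 0 := by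
        have := congrArg ρ hv
        rw [hyv, map_add, e h1, map_sub, e hρ, sub_self, add_zero, map_zero] at this
        exact this
      have h6 : ρ v = 0 := by
        rw [← LinearMap.mem_ker, hk, LinearMap.mem_ker, pow_succ, Module.End.mul_apply, h5,
          map_zero]
      rw [hyv, h5, h6] at hv
      simpa using hv
    let E := LinearEquiv.ofInjectiveEndo y (LinearMap.ker_eq_bot.1 hinj)
    have hE : ∀ v, E v = y v := fun v => rfl
    refine ⟨ρ * E.symm.toLinearMap, hhom.comp fun g v => ?_, ?_⟩
    · apply E.injective
      change E (E.symm (g • v)) = E (g • E.symm v)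
      rw [E.apply_symm_apply, hE, hy, ← hE, E.apply_symm_apply]
    · ext v
      have h7 : x v = E (ρ v) := by rw [hE, hyv, e h2, e hρ, sub_self, add_zero]
      change ρ (E.symm (x v)) = _
      rw [h7, E.symm_apply_apply, e hρ]

theorem Lft.of_add (hhom : IsHom S π) (hπ : π * π = π)
    (hprim : ∀ ρ : Module.End k V, IsHom S ρ → ρ * ρ = ρ → π * ρ = ρ → ρ * π = ρ →
      ρ = 0 ∨ ρ = π)
    {a b : Module.End k V} (ha : IsHom S a) (h2 : a * π = a)
    (h : Lft S π (a + b)) : Lft S π a ∨ Lft S π b := by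
  obtain ⟨η, hη, h⟩ := h
  have hb : π * η * b = π - π * η * a := by
    rw [eq_sub_iff_add_eq, ← mul_add, add_comm b a, mul_assoc, h, hπ]
  have hx2 : π * η * a * π = π * η * a := by rw [mul_assoc (π * η) a, h2]
  have hxh : IsHom S (π * η * a) := (hhom.comp hη).comp ha
  rcases lft_or_nilpotent hhom hπ hprim (x := π * η * a) hxh
    (by rw [← mul_assoc, ← mul_assoc, hπ]) hx2 with ⟨η', hη', h'⟩ | ⟨n, hn⟩
  · left
    refine ⟨η' * (π * η), hη'.comp (hhom.comp hη), ?_⟩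
    rw [mul_assoc, h']
  · right
    set x := π * η * a with hxdef
    have key : ∀ m : ℕ, (∑ i ∈ Finset.range m, x ^ i) * (π - x) = π - x ^ m * π := by
      intro m
      induction m with
      | zero => simp
      | succ m ih =>
        rw [Finset.sum_range_succ, add_mul, ih, pow_succ, mul_sub, mul_assoc (x ^ m) x π, hx2]
        abel
    refine ⟨(∑ i ∈ Finset.range n, x ^ i) * (π * η), ?_, ?_⟩
    · exact (IsHom.sum _ fun i _ => hxh.pow i).comp (hhom.comp hη)
    · rw [mul_assoc, hb, key, hn, zero_mul, sub_zero]

end Corner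

section KrullSchmidt

variable {k S V : Type} [Field k] [Group S] [Finite S]
  [AddCommGroup V] [Module k V] [DistribMulAction S V] [SMulCommClass S k V] [Module.Finite k V]
  {p : ℕ} [Fact p.Prime] [CharP k p]
  {ι : Type} {X : ι → Type} [∀ i, AddCommGroup (X i)] [∀ i, Module k (X i)]
  [∀ i, DistribMulAction S (X i)] [∀ i, SMulCommClass S k (X i)]

theorem Lft.sz {π x : Module.End k V} (h : Lft S π x) (hx : SZ S x) : SZ S π := by
  obtain ⟨η, hη, rfl⟩ := h
  exact hx.comp_left hη

/-- A stably indecomposable idempotent has rank one. -/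
theorem finrank_range_of_factor (hS : IsPGroup p S) {W : Type} [AddCommGroup W] [Module k W]
    [DistribMulAction S W] [SMulCommClass S k W] [Module.Finite k W]
    (hbrick : ∀ e : W →ₗ[k] W, IsHom S e → ∃ c : k, SZ S (e - c • LinearMap.id))
    (hdim : (Nat.card S : ℤ) ∣ Module.finrank k W - 1 ∨
      (Nat.card S : ℤ) ∣ Module.finrank k W + 1)
    {π : V →ₗ[k] V} (hπ : π ∘ₗ π = π) (hnz : ¬ SZ S π)
    (hsmall : Module.finrank k (LinearMap.range π) + 2 ≤ Nat.card S)
    {a : V →ₗ[k] W} {r : W →ₗ[k] V} (ha : IsHom S a) (hr : IsHom S r) (hra : r ∘ₗ a = π)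
    (haπ : a ∘ₗ π = a) (hrπ : π ∘ₗ r = r) : Module.finrank k (LinearMap.range π) = 1 := by
  have ev : ∀ {A B C : Type} [AddCommGroup A] [AddCommGroup B] [AddCommGroup C] [Module k A]
      [Module k B] [Module k C] {f : B →ₗ[k] C} {g : A →ₗ[k] B} {h : A →ₗ[k] C}, f ∘ₗ g = h →
      ∀ v, f (g v) = h v := fun h v => by rw [← h]; rfl
  set e : W →ₗ[k] W := a ∘ₗ r with he
  have hee : e ∘ₗ e = e := by
    ext w
    simp only [he, LinearMap.comp_apply, ev hra, ev hrπ]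
  have hrea : r ∘ₗ e ∘ₗ a = π := by
    ext v
    simp only [he, LinearMap.comp_apply, ev hra, ev hπ]
  obtain ⟨c, hc⟩ := hbrick e (ha.comp hr)
  have hc1 : c = 1 := by
    by_contra hc1
    apply hnz
    have h1 : SZ S ((1 - c) • e) := by
      convert hc.comp_left (ha.comp hr) using 1
      rw [LinearMap.comp_sub, ← he, hee, LinearMap.comp_smul, LinearMap.comp_id, sub_smul, one_smul]
    have h2 : SZ S e := by
      have := h1.smul (1 - c)⁻¹
      rwa [smul_smul, inv_mul_cancel₀ (sub_ne_zero.2 (Ne.symm hc1)), one_smul] at this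
    rw [← hrea]
    exact (h2.comp_right ha).comp_left hr
  subst hc1
  rw [one_smul] at hc
  have hsub : SZ S (LinearMap.id - e) := by simpa using hc.neg
  have hidem : (LinearMap.id - e) ∘ₗ (LinearMap.id - e) = LinearMap.id - e := by
    ext w
    simp [ev hee]
  have hdvd := dvd_finrank_range hS hidem hsub
  have hsum : Module.finrank k (LinearMap.range e) +
      Module.finrank k (LinearMap.range (LinearMap.id - e)) = Module.finrank k W := by
    have := finrank_range_add (π := (1 : Module.End k W)) (ρ := e) hee (one_mul _) (mul_one _)
    rw [show LinearMap.range (1 : Module.End k W) = ⊤ from LinearMap.range_id, finrank_top] at this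
    exact this
  have hrank : Module.finrank k (LinearMap.range π) = Module.finrank k (LinearMap.range e) := by
    apply le_antisymm
    · rw [← hrea]
      exact finrank_range_comp_le r e a
    · have : e = a ∘ₗ π ∘ₗ r := by rw [hrπ]
      rw [this]
      exact finrank_range_comp_le a π r
  have hpos : 0 < Module.finrank k (LinearMap.range π) := by
    rw [Nat.pos_iff_ne_zero, Ne, Submodule.finrank_eq_zero, LinearMap.range_eq_bot]
    rintro rfl
    exact hnz .zero
  rw [← hrank] at hsum
  have hdvd' : (Nat.card S : ℤ) ∣ Module.finrank k (LinearMap.range (LinearMap.id - e)) :=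
    Int.natCast_dvd_natCast.2 hdvd
  rw [← hsum] at hdim
  push_cast at hdim
  rcases hdim with hd | hd
  · have : (Nat.card S : ℤ) ∣ Module.finrank k (LinearMap.range π) - 1 := by
      obtain ⟨x, hx⟩ := hd
      obtain ⟨y, hy⟩ := hdvd'
      exact ⟨x - y, by rw [mul_sub]; linarith⟩
    by_contra hne
    have := Int.le_of_dvd (by omega) this
    omega
  · have : (Nat.card S : ℤ) ∣ Module.finrank k (LinearMap.range π) + 1 := by
      obtain ⟨x, hx⟩ := hd
      obtain ⟨y, hy⟩ := hdvd'
      exact ⟨x - y, by rw [mul_sub]; linarith⟩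
    have := Int.le_of_dvd (by omega) this
    omega

theorem fixed_of_primitive [∀ i, Module.Finite k (X i)] (hS : IsPGroup p S)
    (hbrick : ∀ i, ∀ e : X i →ₗ[k] X i, IsHom S e → ∃ c : k, SZ S (e - c • LinearMap.id))
    (hdim : ∀ i, (Nat.card S : ℤ) ∣ Module.finrank k (X i) - 1 ∨
      (Nat.card S : ℤ) ∣ Module.finrank k (X i) + 1)
    (hgen : LinearMap.id ∈ Gen k S V X) {π : Module.End k V} (hhom : IsHom S π)
    (hπ : π * π = π) (hsmall : Module.finrank k (LinearMap.range π) + 2 ≤ Nat.card S)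
    (hprim : ∀ ρ : Module.End k V, IsHom S ρ → ρ * ρ = ρ → π * ρ = ρ → ρ * π = ρ →
      ρ = 0 ∨ ρ = π) (g : S) (v : V) : g • π v = π v := by
  by_cases h0 : π = 0
  · simp [h0]
  have hpos : 0 < Module.finrank k (LinearMap.range π) := by
    rwa [Nat.pos_iff_ne_zero, Ne, Submodule.finrank_eq_zero, LinearMap.range_eq_bot]
  have hnz : ¬ SZ S π := fun h => by
    have := Nat.le_of_dvd hpos (dvd_finrank_range hS hπ h)
    omega
  have hone : Module.finrank k (LinearMap.range π) = 1 := by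
    by_contra hne
    have key : ∀ x ∈ Gen k S V X, IsHom S x ∧ ¬ Lft S π (π * x * π : Module.End k V) := by
      intro x hx
      induction hx using Submodule.span_induction with
      | mem x hx =>
        rcases hx with hx | ⟨i, a, b, ha, hb, rfl⟩
        · exact ⟨hx.isHom, fun h => hnz (h.sz ((hx.comp_left hhom).comp_right hhom))⟩
        · refine ⟨hb.comp ha, fun ⟨η, hη, h⟩ => hne ?_⟩
          refine finrank_range_of_factor hS (hbrick i) (hdim i) hπ hnz hsmall (a := a ∘ₗ π)
            (r := π ∘ₗ η ∘ₗ π ∘ₗ b) (ha.comp hhom) (hhom.comp (hη.comp (hhom.comp hb))) ?_ ?_ ?_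
          · change π * (η * (π * (b ∘ₗ a) * π)) = π
            rw [h, hπ]
          · rw [LinearMap.comp_assoc]
            congr 1
          · rw [← LinearMap.comp_assoc]
            congr 1
      | zero =>
        refine ⟨.zero, fun ⟨η, hη, h⟩ => h0 ?_⟩
        rw [← h]
        simp
      | add x y _ _ hx hy =>
        refine ⟨hx.1.add hy.1, fun h => ?_⟩
        rw [mul_add, add_mul] at h
        rcases h.of_add hhom hπ hprim ((hhom.comp hx.1).comp hhom)
            (show π * x * π * π = π * x * π by rw [mul_assoc, hπ]) with h | h
        · exact hx.2 h
        · exact hy.2 h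
      | smul c x _ hx =>
        refine ⟨hx.1.smul c, fun ⟨η, hη, h⟩ => hx.2 ⟨c • η, hη.smul c, ?_⟩⟩
        conv_rhs => rw [← h]
        rw [mul_smul_comm, smul_mul_assoc, smul_mul_assoc, mul_smul_comm]
    apply (key _ hgen).2
    refine ⟨π, hhom, ?_⟩
    change π * (π * π) = π
    rw [hπ, hπ]
  obtain ⟨w, hw, hw0, hfix⟩ := exists_fixed_mem (S := S) hS (LinearMap.range π) (by
    rintro g _ ⟨v, rfl⟩
    exact ⟨g • v, hhom g v⟩) (by rwa [Ne, LinearMap.range_eq_bot])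
  obtain ⟨c, hc⟩ := (finrank_eq_one_iff_of_nonzero' (⟨w, hw⟩ : LinearMap.range π)
    (fun h => hw0 (congrArg Subtype.val h))).1 hone ⟨π v, v, rfl⟩
  have hc' : c • w = π v := congrArg Subtype.val hc
  rw [← hc', smul_comm, hfix]

/-- If the identity of a representation of a `p`-group is generated by bricks of dimension `±1`
modulo the order of the group, then every small summand is trivial. -/
theorem fixed_of_gen [∀ i, Module.Finite k (X i)] (hS : IsPGroup p S)
    (hbrick : ∀ i, ∀ e : X i →ₗ[k] X i, IsHom S e → ∃ c : k, SZ S (e - c • LinearMap.id))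
    (hdim : ∀ i, (Nat.card S : ℤ) ∣ Module.finrank k (X i) - 1 ∨
      (Nat.card S : ℤ) ∣ Module.finrank k (X i) + 1)
    (hgen : LinearMap.id ∈ Gen k S V X) {π : Module.End k V} (hhom : IsHom S π)
    (hπ : π * π = π) (hsmall : Module.finrank k (LinearMap.range π) + 2 ≤ Nat.card S)
    (g : S) (v : V) : g • π v = π v := by
  obtain ⟨n, hn⟩ : ∃ n, Module.finrank k (LinearMap.range π) ≤ n := ⟨_, le_rfl⟩
  induction n generalizing π with
  | zero =>
    rw [Nat.le_zero, Submodule.finrank_eq_zero, LinearMap.range_eq_bot] at hn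
    simp [hn]
  | succ n ih =>
    by_cases hprim : ∀ ρ : Module.End k V, IsHom S ρ → ρ * ρ = ρ → π * ρ = ρ → ρ * π = ρ →
        ρ = 0 ∨ ρ = π
    · refine fixed_of_primitive hS hbrick hdim hgen hhom hπ hsmall hprim g v
    · push Not at hprim
      obtain ⟨ρ, hρ, h1, h2, h3, h4, h5⟩ := hprim
      have hsum := finrank_range_add h1 h2 h3
      have e1 : 0 < Module.finrank k (LinearMap.range ρ) := by
        rwa [Nat.pos_iff_ne_zero, Ne, Submodule.finrank_eq_zero, LinearMap.range_eq_bot]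
      have e2 : 0 < Module.finrank k (LinearMap.range (π - ρ)) := by
        rwa [Nat.pos_iff_ne_zero, Ne, Submodule.finrank_eq_zero, LinearMap.range_eq_bot,
          sub_eq_zero, eq_comm]
      have r1 := ih hρ h1 (by omega) (by omega)
      have r2 := ih (hhom.sub hρ) (by
        rw [mul_sub, sub_mul, sub_mul, hπ, h3, h2, h1, sub_self, sub_zero]) (by omega) (by omega)
      have : π v = ρ v + (π - ρ) v := by simp
      rw [this, smul_add, r1, r2]

end KrullSchmidt

/-! ### The standard syzygies of the trivial module -/

section Brick

/-- Every endomorphism is a scalar up to traces. -/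
def Brick (k S X : Type) [Field k] [Group S] [Finite S] [AddCommGroup X] [Module k X]
    [DistribMulAction S X] [SMulCommClass S k X] : Prop :=
  ∀ e : X →ₗ[k] X, IsHom S e → ∃ c : k, SZ S (e - c • LinearMap.id)

variable {k S X' Q X : Type} [Field k] [Group S] [Finite S]
  [AddCommGroup X'] [Module k X'] [DistribMulAction S X'] [SMulCommClass S k X']
  [AddCommGroup Q] [Module k Q] [DistribMulAction S Q] [SMulCommClass S k Q]
  [AddCommGroup X] [Module k X] [DistribMulAction S X] [SMulCommClass S k X]
  {i : X' →ₗ[k] Q} {p : Q →ₗ[k] X}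

theorem EqSES.exists_right (E : EqSES S i p) {b : Q →ₗ[k] Q} (hb : IsHom S b) {a : X' →ₗ[k] X'}
    (h : b ∘ₗ i = i ∘ₗ a) : ∃ c : X →ₗ[k] X, IsHom S c ∧ p ∘ₗ b = c ∘ₗ p := by
  obtain ⟨c, hc, hcp⟩ := exists_factor_surj (E.hp.comp hb) E.hp E.surj (fun v hv => by
    obtain ⟨x, rfl⟩ := E.exact v hv
    have := LinearMap.congr_fun h x
    simp only [LinearMap.comp_apply] at this ⊢
    rw [this, E.zero])
  exact ⟨c, hc, hcp.symm⟩

theorem EqSES.exists_left (E : EqSES S i p) {b : Q →ₗ[k] Q} (hb : IsHom S b) {c : X →ₗ[k] X}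
    (h : p ∘ₗ b = c ∘ₗ p) : ∃ a : X' →ₗ[k] X', IsHom S a ∧ b ∘ₗ i = i ∘ₗ a := by
  obtain ⟨a, ha, hai⟩ := exists_factor_inj (hb.comp E.hi) E.hi E.inj (fun x => by
    apply E.exact
    have := LinearMap.congr_fun h (i x)
    simp only [LinearMap.comp_apply] at this ⊢
    rw [this, E.zero, map_zero])
  exact ⟨a, ha, hai.symm⟩

theorem Brick.left (E : EqSES S i p) (hQ : Proj k S Q) (hX : Brick k S X) : Brick k S X' := by
  intro e he
  obtain ⟨b, hb, hbi⟩ := (hQ.sz_to (E.hi.comp he)).exists_extend E.hi E.inj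
  obtain ⟨c, hc, hpc⟩ := E.exists_right hb.isHom hbi
  obtain ⟨l, hl⟩ := hX c hc
  refine ⟨l, sz_left_of_right E E (b := b - l • LinearMap.id)
    (hb.isHom.sub (IsHom.id.smul l)) ?_ ?_ hQ hl⟩
  · rw [LinearMap.sub_comp, hbi, LinearMap.comp_sub]
    ext
    simp
  · rw [LinearMap.comp_sub, hpc, LinearMap.sub_comp]
    ext
    simp

theorem Brick.right (E : EqSES S i p) (hQ : Proj k S Q) (hX : Brick k S X') : Brick k S X := by
  intro e he
  obtain ⟨b, hb, hbp⟩ := (hQ.sz_from (he.comp E.hp)).exists_lift E.hp E.surj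
  obtain ⟨a, ha, hia⟩ := E.exists_left hb.isHom hbp
  obtain ⟨l, hl⟩ := hX a ha
  refine ⟨l, sz_right_of_left E E (b := b - l • LinearMap.id)
    (hb.isHom.sub (IsHom.id.smul l)) ?_ ?_ hQ hl⟩
  · rw [LinearMap.sub_comp, hia, LinearMap.comp_sub]
    ext
    simp
  · rw [LinearMap.comp_sub, hbp, LinearMap.sub_comp]
    ext
    simp

end Brick

section Syzygies

variable (k G : Type) [Field k] [Group G] [Fintype G]

/-- Iterated syzygies of the trivial module. -/
noncomputable def kIter : ℕ → GMod k G
  | 0 => triv k G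
  | n + 1 => kObj (kIter n)

/-- Iterated cosyzygies of the trivial module. -/
noncomputable def sIter : ℕ → GMod k G
  | 0 => triv k G
  | n + 1 => sObj (sIter n)

/-- The family of all syzygies and cosyzygies of the trivial module. -/
noncomputable def syz : ℤ → GMod k G
  | .ofNat n => kIter k G n
  | .negSucc n => sIter k G (n + 1)

variable {k G}

/-- An induction principle for the standard syzygies. -/
theorem syz_induction {C : GMod k G → Prop} (h0 : C (triv k G))
    (hk : ∀ M, C M → C (kObj M)) (hs : ∀ M, C M → C (sObj M)) (i : ℤ) : C (syz k G i) := by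
  have h1 : ∀ n, C (kIter k G n) := fun n => by
    induction n with
    | zero => exact h0
    | succ n ih => exact hk _ ih
  have h2 : ∀ n, C (sIter k G n) := fun n => by
    induction n with
    | zero => exact h0
    | succ n ih => exact hs _ ih
  cases i with
  | ofNat n => exact h1 n
  | negSucc n => exact h2 _

variable (k G) in
theorem finite_triv : Module.Finite k (triv k G) := Module.Finite.equiv (trivEquiv k G).symm

instance finite_syz (i : ℤ) : Module.Finite k (syz k G i) :=
  syz_induction (C := fun M => Module.Finite k M) (finite_triv k G)
    (fun M _ => finite_kObj M) (fun M _ => finite_sObj M) i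

theorem stablyIso_refl (M : GMod k G) : StablyIso M M := by
  have : StablyZero (𝟙 M ≫ 𝟙 M - 𝟙 M) := by
    rw [stablyZero_iff, Category.comp_id, sub_self]
    exact .zero
  exact ⟨𝟙 M, 𝟙 M, this, this⟩

theorem isSyzygyFamily_syz : IsSyzygyFamily (triv k G) (syz k G) := by
  refine ⟨fun i => (finite_iff _).2 (finite_syz i), stablyIso_refl _, fun i => ?_⟩
  match i with
  | .ofNat n => exact ⟨CV k G (kIter k G n), CV.projective _, ⟨kSES (kIter k G n)⟩⟩
  | .negSucc 0 => exact ⟨CV k G (triv k G), CV.projective _, ⟨sSES (triv k G)⟩⟩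
  | .negSucc (n + 1) =>
    exact ⟨CV k G (sIter k G (n + 1)), CV.projective _, ⟨sSES (sIter k G (n + 1))⟩⟩

theorem finrank_CV (V : Type) [AddCommGroup V] [Module k V] [Module.Finite k V] :
    Module.finrank k (CV k G V) = Fintype.card G * Module.finrank k V := by
  rw [(cvEquiv k G V).finrank_eq, (Fn.lequiv k G V).finrank_eq, Module.finrank_pi_fintype]
  simp

theorem SES.finrank_add {X Y Z : GMod k G} (s : SES X Y Z) [Module.Finite k Y] :
    Module.finrank k X + Module.finrank k Z = Module.finrank k Y := by
  have h1 := (lin s.p).finrank_range_add_finrank_ker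
  have h2 : LinearMap.range (lin s.p) = ⊤ := LinearMap.range_eq_top.2 s.surj
  have h3 : LinearMap.ker (lin s.p) = LinearMap.range (lin s.i) := by
    ext y
    exact s.exact y
  have h4 : Module.finrank k (LinearMap.range (lin s.i)) = Module.finrank k X :=
    LinearMap.finrank_range_of_inj s.inj
  rw [h2, h3, finrank_top, h4] at h1
  omega

theorem dvd_finrank_syz (i : ℤ) : (Fintype.card G : ℤ) ∣ Module.finrank k (syz k G i) - 1 ∨
    (Fintype.card G : ℤ) ∣ Module.finrank k (syz k G i) + 1 := by
  have key : ∀ (M N : GMod k G), Module.finrank k M + Module.finrank k N =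
      Fintype.card G * Module.finrank k M →
      ((Fintype.card G : ℤ) ∣ Module.finrank k M - 1 ∨
        (Fintype.card G : ℤ) ∣ Module.finrank k M + 1) →
      ((Fintype.card G : ℤ) ∣ Module.finrank k N - 1 ∨
        (Fintype.card G : ℤ) ∣ Module.finrank k N + 1) := by
    intro M N h1 h2
    have h1' : (Module.finrank k M + Module.finrank k N : ℤ) =
      Fintype.card G * Module.finrank k M := by exact_mod_cast h1
    rcases h2 with ⟨x, hx⟩ | ⟨x, hx⟩
    · right
      exact ⟨Module.finrank k M - x, by rw [mul_sub]; linarith⟩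
    · left
      exact ⟨Module.finrank k M - x, by rw [mul_sub]; linarith⟩
  refine (syz_induction (C := fun M => Module.Finite k M ∧ ((Fintype.card G : ℤ) ∣
    Module.finrank k M - 1 ∨ (Fintype.card G : ℤ) ∣ Module.finrank k M + 1)) ?_ ?_ ?_ i).2
  · refine ⟨finite_triv k G, Or.inl ?_⟩
    rw [(trivEquiv k G).finrank_eq, Module.finrank_self]
    simp
  · rintro M ⟨_, h⟩
    have : Module.Finite k (CV k G M) := Module.Finite.equiv (cvEquiv k G M).symm
    refine ⟨finite_kObj M, key M _ ?_ h⟩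
    rw [← finrank_CV, ← (kSES M).finrank_add, add_comm]
  · rintro M ⟨_, h⟩
    have : Module.Finite k (CV k G M) := Module.Finite.equiv (cvEquiv k G M).symm
    refine ⟨finite_sObj M, key M _ ?_ h⟩
    rw [← finrank_CV, ← (sSES M).finrank_add]

theorem brick_syz (P : Subgroup G) (i : ℤ) : Brick k P (syz k G i) := by
  refine syz_induction (C := fun M => Brick k P M) ?_ ?_ ?_ i
  · intro e _
    let E := trivEquiv k G
    refine ⟨E (e (E.symm 1)), ?_⟩
    have h0 : e - E (e (E.symm 1)) • LinearMap.id = 0 := by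
      ext v
      apply E.injective
      have hv : v = E v • E.symm 1 := by
        apply E.injective
        simp
      have : E (e v) = E v * E (e (E.symm 1)) := by
        conv_lhs => rw [hv, map_smul, map_smul, smul_eq_mul]
      simp [this, mul_comm]
    rw [h0]
    exact .zero
  · intro M hM
    exact .left ((kSES M).eqSES.restrict P) (SZ.restrict (CV.proj M) P) hM
  · intro M hM
    exact .right ((sSES M).eqSES.restrict P) (SZ.restrict (CV.proj M) P) hM

theorem fixed_of_gHolds {p : ℕ} [Fact p.Prime] [CharP k p] (P : Subgroup G) (hP : IsPGroup p P)
    {V : Type} [AddCommGroup V] [Module k V] [DistribMulAction P V] [SMulCommClass P k V]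
    [Module.Finite k V] (hgen : LinearMap.id ∈ Gen k P V (fun i => syz k G i))
    {π : Module.End k V} (hhom : IsHom P π) (hπ : π * π = π)
    (hsmall : Module.finrank k (LinearMap.range π) + 2 ≤ Nat.card P)
    (g : P) (v : V) : g • π v = π v := by
  refine fixed_of_gen hP (fun i => brick_syz P i) (fun i => ?_) hgen hhom hπ hsmall g v
  have h : (Nat.card P : ℤ) ∣ Fintype.card G := by
    rw [← Nat.card_eq_fintype_card]
    exact Int.natCast_dvd_natCast.2 (Subgroup.card_subgroup_dvd_card P)
  exact (dvd_finrank_syz i).imp h.trans h.trans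

end Syzygies

/-! ### A small summand of the heart of the regular representation -/

section Heart

variable {k : Type} [Field k]

theorem exists_quot {V W U : Type} [AddCommGroup V] [Module k V] [AddCommGroup W] [Module k W]
    [AddCommGroup U] [Module k U] {p : V →ₗ[k] W} (hp : Function.Surjective p) (f : V →ₗ[k] U)
    (h : ∀ v, p v = 0 → f v = 0) : ∃ t : W →ₗ[k] U, ∀ v, t (p v) = f v := by
  obtain ⟨s, hs⟩ := p.exists_rightInverse_of_surjective (LinearMap.range_eq_top.2 hp)
  refine ⟨f ∘ₗ s, fun v => ?_⟩
  have := h (s (p v) - v) (by rw [map_sub, sub_eq_zero]; exact LinearMap.congr_fun hs (p v))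
  rw [map_sub, sub_eq_zero] at this
  exact this

variable {G : Type} [Group G]

/-- The component in `P` of a group element, with respect to chosen coset representatives. -/
noncomputable def cosetPart (P : Subgroup G) (g : G) : P :=
  ⟨(g : G ⧸ P).out⁻¹ * g, QuotientGroup.eq.1 (QuotientGroup.out_eq' _)⟩

theorem cosetPart_mul (P : Subgroup G) (g : G) (a : P) :
    cosetPart P (g * a) = cosetPart P g * a := by
  have : ((g * a : G) : G ⧸ P) = g := QuotientGroup.mk_mul_of_mem g a.2
  ext
  simp [cosetPart, this, mul_assoc]

theorem cosetPart_out (P : Subgroup G) (q : G ⧸ P) (h : P) : cosetPart P (q.out * h) = h := by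
  have : cosetPart P q.out = 1 := by
    ext
    simp [cosetPart]
  rw [cosetPart_mul, this, one_mul]

variable [Fintype G]

/-- Pulling back functions on `P` along `cosetPart`. -/
noncomputable def spread (P : Subgroup G) : (P → k) →ₗ[k] CV k G (triv k G) where
  toFun φ := (cvEquiv k G _).symm (Fn.of fun g => (trivEquiv k G).symm (φ (cosetPart P g)))
  map_add' φ ψ := by
    apply (cvEquiv k G _).injective
    ext x
    simp
  map_smul' c ψ := by
    apply (cvEquiv k G _).injective
    ext x
    simp [-smul_eq_mul]

theorem spread_apply (P : Subgroup G) (φ : P → k) (g : G) :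
    cvEquiv k G _ (spread P φ) g = (trivEquiv k G).symm (φ (cosetPart P g)) := by
  simp [spread]

/-- Averaging functions over coset representatives. -/
noncomputable def gather (P : Subgroup G) [Fintype (G ⧸ P)] : CV k G (triv k G) →ₗ[k] (P → k) where
  toFun f h := (P.index : k)⁻¹ * ∑ q : G ⧸ P, trivEquiv k G (cvEquiv k G _ f (q.out * h))
  map_add' f f' := by
    ext h
    simp [Finset.sum_add_distrib, mul_add]
  map_smul' c f := by
    ext h
    simp [← Finset.mul_sum, mul_left_comm]

theorem gather_apply (P : Subgroup G) [Fintype (G ⧸ P)] (f : CV k G (triv k G)) (h : P) :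
    gather P f h = (P.index : k)⁻¹ * ∑ q : G ⧸ P, trivEquiv k G (cvEquiv k G _ f (q.out * h)) :=
  rfl

theorem gather_smul (P : Subgroup G) [Fintype (G ⧸ P)] (f : CV k G (triv k G)) (h a : P) :
    gather P ((a : G) • f) h = gather P f (h * a) := by
  simp [gather_apply, cvEquiv_smul, mul_assoc]

theorem gather_spread {P : Subgroup G} [Fintype (G ⧸ P)] (hm : (P.index : k) ≠ 0) (φ : P → k) :
    gather P (spread P φ) = φ := by
  ext h
  have hc : (Fintype.card (G ⧸ P) : k) = P.index := by
    rw [← Nat.card_eq_fintype_card]; rfl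
  simp [gather_apply, spread_apply, cosetPart_out, hc, hm]

theorem spread_smul (P : Subgroup G) (φ : P → k) (a : P) :
    (a : G) • spread P φ = spread P fun h => φ (h * a) := by
  refine CV.ext fun x => ?_
  rw [cvEquiv_smul, Fn.smul_apply, spread_apply, spread_apply, cosetPart_mul]

theorem eps_triv (f : CV k G (triv k G)) : eps _ f = ∑ x, cvEquiv k G _ f x := by
  rw [eps_apply]
  exact Finset.sum_congr rfl fun x _ => triv_smul _ _

theorem eps_spread (P : Subgroup G) [Fintype P] (φ : P → k) (h : ∑ x, φ x = 0) :
    eps _ (spread P φ) = 0 := by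
  have := Fintype.ofFinite (G ⧸ P)
  apply (trivEquiv k G).injective
  rw [eps_triv, sum_out_mul P]
  simp [spread_apply, cosetPart_out, h]

theorem sum_gather (P : Subgroup G) [Fintype P] [Fintype (G ⧸ P)] {f : CV k G (triv k G)} (h : eps _ f = 0) :
    ∑ x, gather P f x = 0 := by
  rw [eps_triv, sum_out_mul P] at h
  simp only [gather_apply]
  rw [← Finset.mul_sum, Finset.sum_comm]
  have := congrArg (trivEquiv k G) h
  simp only [map_sum, map_zero] at this
  rw [this, mul_zero]

variable (k) in
/-- Functions on `P` with sum zero. -/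
noncomputable def sumZero (P : Type) [Fintype P] : Submodule k (P → k) :=
  LinearMap.ker (∑ x, LinearMap.proj x : (P → k) →ₗ[k] k)

theorem mem_sumZero {P : Type} [Fintype P] {φ : P → k} : φ ∈ sumZero k P ↔ ∑ x, φ x = 0 := by
  simp [sumZero]

theorem finrank_sumZero (P : Type) [Fintype P] [Nonempty P] :
    Module.finrank k (sumZero k P) + 1 = Fintype.card P := by
  classical
  have h1 := (∑ x, LinearMap.proj x : (P → k) →ₗ[k] k).finrank_range_add_finrank_ker
  have h2 : LinearMap.range (∑ x, LinearMap.proj x : (P → k) →ₗ[k] k) = ⊤ := by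
    refine LinearMap.range_eq_top.2 fun c => ⟨Pi.single (Classical.arbitrary P) c, ?_⟩
    simp
  rw [h2, finrank_top, Module.finrank_self, Module.finrank_fintype_fun_eq_card] at h1
  rw [← h1, add_comm]
  rfl

theorem exists_summand (P : Subgroup G) [Fintype P] (hm : (P.index : k) ≠ 0)
    (hP : (Nat.card P : k) = 0) :
    ∃ (H : GMod k G) (ρ : kObj (triv k G) ⟶ H) (π : Module.End k H),
      InThick (triv k G) H ∧ Module.Finite k H ∧ Function.Surjective ρ ∧ IsHom P π ∧
      π * π = π ∧ Module.finrank k (LinearMap.range π) + 2 ≤ Nat.card P ∧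
      ∀ φ : P → k, ∑ x, φ x = 0 → ∃ z : H, π z = z ∧
        (∀ a : P, a • z = z → ∃ v : k, ∀ h, φ (h * a) - φ h = v) ∧
        (z = 0 → ∃ v : k, ∀ h, φ h = v) := by
  have := Fintype.ofFinite (G ⧸ P)
  have hG : (Fintype.card G : k) = 0 := by
    rw [← Nat.card_eq_fintype_card, ← P.card_mul_index, Nat.cast_mul, hP, zero_mul]
  have hfin := finite_triv k G
  have hfinK : Module.Finite k (kObj (triv k G)) := finite_kObj _
  let T := triv k G
  let ι := (kSES T).i
  have hex : ∀ f : CV k G T, eps T f = 0 → ∃ y, lin ι y = f := fun f hf =>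
    ((kSES T).exact f).1 hf
  have hz : ∀ y, eps T (lin ι y) = 0 := fun y => ((kSES T).exact _).2 ⟨y, rfl⟩
  obtain ⟨j, hj, hjι⟩ := exists_factor_inj (lin_isHom (iot T)) (lin_isHom ι) (kSES T).inj
    (fun v => hex _ (by
      rw [eps_apply]
      simp only [lin_apply, iot_apply, inv_smul_smul, Finset.sum_const, Finset.card_univ]
      rw [← Nat.cast_smul_eq_nsmul k, hG, zero_smul]))
  have hjinj : Function.Injective (mkHom j hj) := fun v w h => iot_inj T (by
    have h1 := LinearMap.congr_fun hjι v
    have h2 := LinearMap.congr_fun hjι w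
    have h3 : j v = j w := h
    simp only [LinearMap.comp_apply, lin_apply] at h1 h2
    rw [← h1, ← h2, h3])
  let ρ := cokP (mkHom j hj)
  have hρ : Function.Surjective (lin ρ) := cokP_surj _
  have hρ0 : ∀ y, lin ρ y = 0 ↔ ∃ v, ∀ x, cvEquiv k G T (lin ι y) x = v := fun y => by
    refine (cokP_eq_zero (mkHom j hj) y).trans ⟨?_, ?_⟩
    · rintro ⟨v, rfl⟩
      refine ⟨v, fun x => ?_⟩
      have h1 := LinearMap.congr_fun hjι v
      simp only [LinearMap.comp_apply] at h1
      rw [mkHom_apply, h1, lin_apply, iot_apply, triv_smul]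
    · rintro ⟨v, hv⟩
      refine ⟨v, (kSES T).inj ?_⟩
      refine CV.ext fun x => ?_
      have h1 := LinearMap.congr_fun hjι v
      simp only [LinearMap.comp_apply] at h1
      refine Eq.trans ?_ (hv x).symm
      rw [mkHom_apply]
      refine (congrArg (fun u => cvEquiv k G T u x) h1).trans ?_
      rw [lin_apply, iot_apply, triv_smul]
  obtain ⟨B, hB⟩ := exists_lin_factor (i := lin ι) (kSES T).inj
    (spread P ∘ₗ (sumZero k P).subtype)
    (fun φ => hex _ (eps_spread P _ (mem_sumZero.1 φ.2)))
  have hB' : ∀ φ, lin ι (B φ) = spread P φ := fun φ => LinearMap.congr_fun hB φ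
  let R : kObj T →ₗ[k] sumZero k P := LinearMap.codRestrict _ (gather P ∘ₗ lin ι)
    (fun y => mem_sumZero.2 (sum_gather P (hz y)))
  have hR : ∀ y, (R y : P → k) = gather P (lin ι y) := fun y => rfl
  have hRB : ∀ φ, R (B φ) = φ := fun φ => by
    ext1
    rw [hR, hB', gather_spread hm]
  obtain ⟨π, hπ⟩ := exists_quot hρ (lin ρ ∘ₗ B ∘ₗ R) (fun y hy => by
    obtain ⟨v, hv⟩ := (hρ0 y).1 hy
    refine (hρ0 _).2 ⟨(trivEquiv k G).symm ((P.index : k)⁻¹ * ∑ q : G ⧸ P, trivEquiv k G v),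
      fun x => ?_⟩
    rw [LinearMap.comp_apply, hB', spread_apply, hR, gather_apply]
    congr 2
    exact Finset.sum_congr rfl fun q _ => congrArg _ (hv _))
  have hπB : ∀ φ, π (lin ρ (B φ)) = lin ρ (B φ) := fun φ => by
    rw [hπ, LinearMap.comp_apply, LinearMap.comp_apply, hRB]
  have hone : (fun _ => 1 : P → k) ∈ sumZero k P := by
    rw [mem_sumZero, Finset.sum_const, Finset.card_univ, ← Nat.card_eq_fintype_card,
      nsmul_eq_mul, hP, zero_mul]
  refine ⟨cokObj (mkHom j hj), ρ, π, .ext₁ (cokSES _ hjinj) .gen (inThick_kObj .gen),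
    Module.Finite.of_surjective (lin ρ) hρ, hρ, ?_, ?_, ?_, ?_⟩
  · intro a z
    obtain ⟨y, rfl⟩ := hρ z
    have h1 : (a : G) • lin ρ y = lin ρ ((a : G) • y) := (lin_isHom ρ _ _).symm
    change π ((a : G) • lin ρ y) = (a : G) • π (lin ρ y)
    rw [h1, hπ, hπ]
    simp only [LinearMap.comp_apply]
    rw [← lin_isHom ρ]
    congr 1
    refine (kSES T).inj ?_
    change lin ι _ = lin ι _
    rw [lin_isHom ι, hB', hB', spread_smul]
    congr 1
    ext h
    rw [hR, lin_isHom ι, gather_smul, hR]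
  · ext z
    obtain ⟨y, rfl⟩ := hρ z
    rw [Module.End.mul_apply, hπ, LinearMap.comp_apply, LinearMap.comp_apply, hπB]
  · have hle : LinearMap.range π ≤ LinearMap.range (lin ρ ∘ₗ B) := by
      rintro _ ⟨z, rfl⟩
      obtain ⟨y, rfl⟩ := hρ z
      exact ⟨R y, (hπ y).symm⟩
    have h1 := Submodule.finrank_mono hle
    have h2 := (lin ρ ∘ₗ B).finrank_range_add_finrank_ker
    have h3 : 0 < Module.finrank k (LinearMap.ker (lin ρ ∘ₗ B)) := by
      have hmem : (⟨_, hone⟩ : sumZero k P) ∈ LinearMap.ker (lin ρ ∘ₗ B) := by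
        refine (hρ0 _).2 ⟨(trivEquiv k G).symm 1, fun x => ?_⟩
        rw [hB', spread_apply]
      refine Submodule.one_le_finrank_iff.2 fun h => ?_
      rw [h, Submodule.mem_bot] at hmem
      have := congrFun (congrArg (fun u => (u.1 : P → k)) hmem) 1
      exact one_ne_zero this
    have h4 := finrank_sumZero (k := k) P
    rw [Nat.card_eq_fintype_card]
    omega
  · intro φ hφ
    let φ' : sumZero k P := ⟨φ, mem_sumZero.2 hφ⟩
    have key : ∀ (x : P), cosetPart P ((cosetPart P 1)⁻¹ * x : G) = x := fun x => by
      have h1 : ((cosetPart P 1)⁻¹ * x : G) = 1 * ((cosetPart P 1)⁻¹ * x : P) := by simp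
      rw [h1, cosetPart_mul]
      simp
    refine ⟨lin ρ (B φ'), hπB φ', fun a ha => ?_, fun h0 => ?_⟩
    · have h1 : lin ρ ((a : G) • B φ' - B φ') = 0 := by
        rw [map_sub, lin_isHom ρ, sub_eq_zero]
        exact ha
      obtain ⟨v, hv⟩ := (hρ0 _).1 h1
      refine ⟨trivEquiv k G v, fun h => ?_⟩
      have := hv ((cosetPart P 1)⁻¹ * h : G)
      rw [map_sub, lin_isHom ι, hB', spread_smul, map_sub, Fn.sub_apply, spread_apply,
        spread_apply, key] at this
      rw [← this]
      simp [φ']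
    · obtain ⟨v, hv⟩ := (hρ0 _).1 h0
      refine ⟨trivEquiv k G v, fun h => ?_⟩
      have := hv ((cosetPart P 1)⁻¹ * h : G)
      rw [hB', spread_apply, key] at this
      rw [← this]
      simp [φ']

end Heart

/-! ### Non-periodicity for the Klein four group -/

section Nonperiodic

variable {k S M N M' Q : Type} [Field k] [Group S] [Finite S]
  [AddCommGroup M] [Module k M] [DistribMulAction S M] [SMulCommClass S k M]
  [AddCommGroup N] [Module k N] [DistribMulAction S N] [SMulCommClass S k N]
  [AddCommGroup M'] [Module k M'] [DistribMulAction S M'] [SMulCommClass S k M']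
  [AddCommGroup Q] [Module k Q] [DistribMulAction S Q] [SMulCommClass S k Q]

/-- A functional which is a coboundary along the action of `b`. -/
def Nul (b : S) (v : M →ₗ[k] k) : Prop := ∃ u : M →ₗ[k] k, ∀ m, v m = u (b • m) - u m

theorem exists_twisted {χ : S → k} (hχ : ∀ g h, χ (g * h) = χ g + χ h) (θ : N →ₗ[k] k)
    (s : M →ₗ[k] N) : ∃ t : M →ₗ[k] k, ∀ h : S, (∀ n, θ (h • n) = θ n) →
      ∀ m, t (h • m) = t m + χ h * θ (tr S s m) := by
  have := Fintype.ofFinite S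
  refine ⟨∑ g : S, χ g • (θ ∘ₗ conj g s), fun h hh m => ?_⟩
  simp only [LinearMap.sum_apply, LinearMap.smul_apply, LinearMap.comp_apply, conj_apply,
    smul_eq_mul]
  rw [tr_apply, map_sum, Finset.mul_sum, ← Finset.sum_add_distrib,
    ← Equiv.sum_comp (Equiv.mulLeft h)]
  refine Finset.sum_congr rfl fun g _ => ?_
  simp only [Equiv.coe_mulLeft, hχ, mul_inv_rev, mul_smul, inv_smul_smul, hh]
  ring

theorem exists_step {a b : S} (hb : b * b = 1) (h2 : ∀ x : k, x + x = 0)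
    {χ χ' : S → k} (hχ : ∀ g h, χ (g * h) = χ g + χ h) (hχa : χ a = 0) (hχb : χ b = 1)
    (hχ' : ∀ g h, χ' (g * h) = χ' g + χ' h) (hχ'a : χ' a = 1)
    {i : M' →ₗ[k] Q} {p : Q →ₗ[k] M} (E : EqSES S i p) (hQ : Proj k S Q)
    {v : M →ₗ[k] k} (hv : ∀ (g : S) m, v (g • m) = v m) (hvb : ¬ Nul b v) :
    ∃ v' : M' →ₗ[k] k, (∀ (g : S) m, v' (g • m) = v' m) ∧ Nul a v' ∧ ¬ Nul b v' := by
  obtain ⟨s, hs⟩ := hQ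
  have hs' : ∀ x, tr S s x = x := fun x => LinearMap.congr_fun hs x
  obtain ⟨t, ht⟩ := exists_twisted hχ (v ∘ₗ p) s
  have ht : ∀ h x, t (h • x) = t x + χ h * v (p x) := fun h x => by
    rw [ht h (fun n => by simp [E.hp h, hv]), hs', LinearMap.comp_apply]
  obtain ⟨w, hw⟩ := exists_twisted hχ' t s
  have hw : ∀ x, w (a • x) = w x + t x := fun x => by
    rw [hw a (fun n => by rw [ht, hχa, zero_mul, add_zero]), hs', hχ'a, one_mul]
  refine ⟨t ∘ₗ i, fun g m => ?_, ⟨w ∘ₗ i, fun m => ?_⟩, ?_⟩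
  · simp [E.hi g, ht, E.zero]
  · simp [E.hi a, hw]
  · rintro ⟨u, hu⟩
    obtain ⟨r, hr⟩ := LinearMap.exists_leftInverse_of_injective i (LinearMap.ker_eq_bot.2 E.inj)
    have hr' : ∀ m, r (i m) = m := fun m => LinearMap.congr_fun hr m
    let U := u ∘ₗ r
    have hU : ∀ m, U (i m) = u m := fun m => by simp [U, hr']
    obtain ⟨c, hc⟩ := exists_quot E.surj
      (t - (U ∘ₗ DistribSMul.toLinearMap k Q b - U)) (fun x hx => by
        obtain ⟨m, rfl⟩ := E.exact x hx
        have := hu m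
        simp only [LinearMap.comp_apply] at this
        simp [← E.hi b, hU, this])
    refine hvb ⟨c, fun m => ?_⟩
    obtain ⟨x, rfl⟩ := E.surj m
    rw [← E.hp, hc, hc]
    simp only [LinearMap.sub_apply, LinearMap.comp_apply, DistribSMul.toLinearMap_apply, ht, hχb,
      one_mul, smul_smul, hb, one_smul]
    linear_combination h2 (U x) - h2 (U (b • x))

theorem tr_functional {l : M →ₗ[k] k} (hl : ∀ (g : S) m, l (g • m) = l m)
    (hS : (Nat.card S : k) = 0) (s : N →ₗ[k] M) {w : N} (hw : ∀ g : S, g • w = w) :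
    l (tr S s w) = 0 := by
  have := Fintype.ofFinite S
  rw [tr_apply, map_sum]
  simp only [hl, hw]
  rw [Finset.sum_const, Finset.card_univ, ← Nat.card_eq_fintype_card, nsmul_eq_mul, hS, zero_mul]

theorem eq_zero_of_brick {a b : S} {χ : S → k} (hχ : ∀ g h, χ (g * h) = χ g + χ h)
    (hχb : χ b = 1) (hS : (Nat.card S : k) = 0) (hM : Brick k S M)
    {v : M →ₗ[k] k} (hv : ∀ (g : S) m, v (g • m) = v m) (hva : Nul a v) (hvb : ¬ Nul b v)
    {l : M →ₗ[k] k} (hl : ∀ (g : S) m, l (g • m) = l m) {w : M} (hw : ∀ g : S, g • w = w) :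
    l w = 0 := by
  by_contra h0
  let e : M →ₗ[k] M := (l w)⁻¹ • l.smulRight w
  have he : ∀ m, e m = ((l w)⁻¹ * l m) • w := fun m => by simp [e, mul_smul]
  obtain ⟨c, s, hs⟩ := hM e (fun g m => by rw [he, he, hl, smul_comm, hw])
  have hs' : ∀ m, tr S s m = ((l w)⁻¹ * l m) • w - c • m := fun m => by
    rw [hs, ← he]
    simp
  have hc : c = 1 := by
    have := tr_functional hl hS s hw
    rw [hs', inv_mul_cancel₀ h0, map_sub, map_smul, map_smul, ← sub_smul, smul_eq_mul] at this
    rcases mul_eq_zero.1 this with h | h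
    · exact (sub_eq_zero.1 h).symm
    · exact absurd h h0
  have hvw : v w = 0 := by
    obtain ⟨u, hu⟩ := hva
    rw [hu, hw, sub_self]
  obtain ⟨t, ht⟩ := exists_twisted hχ v s
  refine hvb ⟨-t, fun m => ?_⟩
  simp only [LinearMap.neg_apply]
  rw [ht b (hv b), hχb, hs', hc, map_sub, map_smul, hvw]
  simp

end Nonperiodic

section Syzygies

variable {k G : Type} [Field k] [Group G] [Fintype G]

theorem functional_syz_eq_zero {P : Subgroup G} {a b : P} (hb : b * b = 1)
    (h2 : ∀ x : k, x + x = 0)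
    {χ χ' : P → k} (hχ : ∀ g h, χ (g * h) = χ g + χ h) (hχa : χ a = 0) (hχb : χ b = 1)
    (hχ' : ∀ g h, χ' (g * h) = χ' g + χ' h) (hχ'a : χ' a = 1)
    (hP : (Nat.card P : k) = 0) {i : ℤ} (hi : i ≠ 0)
    {l : syz k G i →ₗ[k] k} (hl : ∀ (g : P) m, l (g • m) = l m)
    {w : syz k G i} (hw : ∀ g : P, g • w = w) : l w = 0 := by
  have hC : ∀ M : GMod k G, Proj k P (CV k G M) := fun M => SZ.restrict (CV.proj M) P
  have htriv : ∀ (g : P) (m : triv k G), g • m = m := fun g m => triv_smul (g : G) m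
  match i with
  | .ofNat 0 => exact absurd rfl hi
  | .ofNat (n + 1) =>
    have key : ∀ n, ∃ v : kIter k G n →ₗ[k] k, (∀ (g : P) m, v (g • m) = v m) ∧ ¬ Nul b v := by
      intro n
      induction n with
      | zero =>
        refine ⟨(trivEquiv k G).toLinearMap, fun g m => congrArg _ (htriv g m), ?_⟩
        rintro ⟨u, hu⟩
        have h3 : u (b • ((trivEquiv k G).symm 1)) = u ((trivEquiv k G).symm 1) :=
          congrArg u (htriv b _)
        have h1 : trivEquiv k G ((trivEquiv k G).symm 1) = 0 :=
          (hu ((trivEquiv k G).symm 1)).trans (sub_eq_zero.2 h3)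
        simp at h1
      | succ n ih =>
        obtain ⟨v, hv, hvb⟩ := ih
        obtain ⟨v', hv', -, hvb'⟩ := exists_step hb h2 hχ hχa hχb hχ' hχ'a
          ((kSES (kIter k G n)).eqSES.restrict P) (hC _) hv hvb
        exact ⟨v', hv', hvb'⟩
    obtain ⟨v, hv, hvb⟩ := key n
    obtain ⟨v', hv', hva', hvb'⟩ := exists_step hb h2 hχ hχa hχb hχ' hχ'a
          ((kSES (kIter k G n)).eqSES.restrict P) (hC _) hv hvb
    exact eq_zero_of_brick hχ hχb hP (brick_syz P (Int.ofNat (n + 1))) hv' hva' hvb' hl hw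
  | .negSucc n =>
    have key : ∀ n, ∀ v : sIter k G n →ₗ[k] k, (∀ (g : P) m, v (g • m) = v m) →
        Nul a v → Nul b v := by
      intro n
      induction n with
      | zero =>
        rintro v - ⟨u, hu⟩
        refine ⟨0, fun m => ?_⟩
        have h3 : u (a • m) = u m := congrArg u (htriv a m)
        rw [hu, h3]
        simp
      | succ n ih =>
        intro v hv _
        by_contra hvb
        obtain ⟨v', hv', hva', hvb'⟩ := exists_step hb h2 hχ hχa hχb hχ' hχ'a
          ((sSES (sIter k G n)).eqSES.restrict P) (hC _) hv hvb
        exact hvb' (ih v' hv' hva')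
    have hlb : Nul b l := by
      by_contra hvb
      obtain ⟨v', hv', hva', hvb'⟩ := exists_step hb h2 hχ hχa hχb hχ' hχ'a
          ((sSES (sIter k G n)).eqSES.restrict P) (hC _) hl hvb
      exact hvb' (key n v' hv' hva')
    obtain ⟨u, hu⟩ := hlb
    rw [hu, hw, sub_self]

end Syzygies

/-! ### The generating hypothesis bounds the Sylow subgroup -/

section KleinFour

variable {k P : Type} [Field k] [Group P] [Fintype P]

theorem klein_four_of_differences (h4 : 4 ≤ Nat.card P)
    (H : ∀ φ : P → k, ∑ x, φ x = 0 → ∀ a : P, ∃ v : k, ∀ h, φ (h * a) - φ h = v) :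
    Nat.card P = 4 := by
  classical
  rw [Nat.card_eq_fintype_card] at h4 ⊢
  obtain ⟨h, hh⟩ := Fintype.exists_ne_of_one_lt_card (by omega : 1 < Fintype.card P) 1
  have : ∃ a, a ∉ ({1, h} : Finset P) := by
    by_contra hc
    push Not at hc
    have := Finset.card_le_card (fun x _ => hc x : (Finset.univ : Finset P) ⊆ {1, h})
    have h3 := Finset.card_le_two (a := (1 : P)) (b := h)
    rw [Finset.card_univ] at this
    omega
  obtain ⟨a, ha⟩ := this
  simp only [Finset.mem_insert, Finset.mem_singleton, not_or] at ha
  obtain ⟨v, hv⟩ := H (Pi.single 1 1 - Pi.single h 1) (by simp) a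
  have h1 : v = -1 := by
    rw [← hv 1]
    simp [ha.1, ha.2, hh.symm]
  have hsub : (Finset.univ : Finset P) ⊆ {1, h, a⁻¹, h * a⁻¹} := by
    intro x _
    by_contra hx
    simp only [Finset.mem_insert, Finset.mem_singleton, not_or] at hx
    have := hv x
    rw [h1] at this
    have e1 : x * a ≠ 1 := fun e => hx.2.2.1 (eq_inv_of_mul_eq_one_left e)
    have e2 : x * a ≠ h := fun e => hx.2.2.2 (eq_mul_inv_of_mul_eq e)
    simp [hx.1, hx.2.1, e1, e2] at this
  have h5 := Finset.card_le_card hsub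
  have h6 := Finset.card_le_four (a := (1 : P)) (b := h) (c := a⁻¹) (d := h * a⁻¹)
  rw [Finset.card_univ] at h5
  omega

theorem mul_self_of_differences (h2 : ∀ x : k, x + x = 0)
    (H : ∀ φ : P → k, ∑ x, φ x = 0 → ∀ a : P, ∃ v : k, ∀ h, φ (h * a) - φ h = v) (h : P) :
    h * h = 1 := by
  classical
  by_cases hh : h = 1
  · simp [hh]
  obtain ⟨v, hv⟩ := H (Pi.single 1 1 - Pi.single h 1) (by simp) h
  have h0 : v = 0 := by
    rw [← hv 1]
    have := h2 1
    simp [hh, Ne.symm hh]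
    linear_combination -this
  by_contra hc
  have := hv h
  simp [hh, hc, h0] at this

theorem exists_character (h2 : ∀ x : k, x + x = 0) (h4 : Nat.card P = 4)
    {a b : P} (ha : a ≠ 1) (haa : a * a = 1) (hb : b ≠ 1) (hba : b ≠ a) :
    ∃ χ : P → k, (∀ g h, χ (g * h) = χ g + χ h) ∧ χ a = 0 ∧ χ b = 1 := by
  classical
  have hord : orderOf a = 2 := orderOf_eq_prime (by rw [pow_two, haa]) ha
  have hindex : (Subgroup.zpowers a).index = 2 := by
    have := (Subgroup.zpowers a).card_mul_index
    rw [Nat.card_zpowers, hord, h4] at this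
    omega
  refine ⟨fun g => if g ∈ Subgroup.zpowers a then 0 else 1, fun g h => ?_, ?_, ?_⟩
  · have := Subgroup.mul_mem_iff_of_index_two hindex (a := g) (b := h)
    have h3 : (1 : k) + 1 = 0 := h2 1
    by_cases hg : g ∈ Subgroup.zpowers a <;> by_cases hh : h ∈ Subgroup.zpowers a <;>
      simp [this, hg, hh, h3]
  · simp
  · have : b ∉ Subgroup.zpowers a := by
      intro hm
      obtain ⟨n, hn⟩ := (mem_zpowers_iff_mem_range_orderOf.1 hm |> Finset.mem_image.1)
      rw [hord] at hn
      obtain ⟨hn1, hn2⟩ := hn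
      rw [Finset.mem_range] at hn1
      interval_cases n
      · exact hb (by simpa using hn2.symm)
      · exact hba (by simpa using hn2.symm)
    simp [this]

end KleinFour

section Sylow

variable {k G : Type} [Field k] [Group G] [Fintype G] {p : ℕ} [Fact p.Prime] [CharP k p]

theorem Gen.restrict {V : Type} [AddCommGroup V] [Module k V] [DistribMulAction G V]
    [SMulCommClass G k V] (X : ℤ → GMod k G) (P : Subgroup G) :
    Gen k G V (fun i => X i) ≤ Gen k P V (fun i => X i) := by
  refine Submodule.span_mono ?_
  rintro f (hf | ⟨i, a, b, ha, hb, rfl⟩)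
  · exact Or.inl (SZ.restrict hf P)
  · exact Or.inr ⟨i, a, b, ha.restrict P, hb.restrict P, rfl⟩

theorem fixed_of_inThick (hG : GHolds k G) (P : Subgroup G) (hP : IsPGroup p P) {M : GMod k G}
    [Module.Finite k M] (hM : InThick (triv k G) M) {π : Module.End k M} (hhom : IsHom P π)
    (hπ : π * π = π) (hsmall : Module.finrank k (LinearMap.range π) + 2 ≤ Nat.card P)
    (g : P) (v : M) : g • π v = π v :=
  fixed_of_gHolds P hP (Gen.restrict (syz k G) P (id_mem_gen hG isSyzygyFamily_syz hM))
    hhom hπ hsmall g v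

theorem additive_eq_zero (P : Subgroup G) (hm : (P.index : k) ≠ 0) {D : G → k}
    (hD : ∀ g h, D (g * h) = D g + D h) (hP : ∀ g ∈ P, D g = 0) (g : G) : D g = 0 := by
  let F : G →* Multiplicative k :=
    MonoidHom.mk' (fun g => Multiplicative.ofAdd (D g)) fun a b => by
      rw [hD, ofAdd_add]
  have hF : ∀ g, g ∈ F.ker ↔ D g = 0 := fun g => by
    rw [MonoidHom.mem_ker]
    exact ofAdd_eq_one
  have hle : P ≤ F.ker := fun g hg => (hF g).2 (hP g hg)
  have hpow : F (g ^ F.ker.index) = 1 := F.ker.pow_index_mem g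
  rw [map_pow] at hpow
  have h1 : F.ker.index • D g = 0 := congrArg Multiplicative.toAdd hpow
  rw [nsmul_eq_mul] at h1
  obtain ⟨c, hc⟩ := Subgroup.index_dvd_of_le hle
  rcases mul_eq_zero.1 h1 with h | h
  · rw [hc, Nat.cast_mul, h, zero_mul] at hm
    exact absurd rfl hm
  · exact h

theorem hom_kObj_triv_eq_zero (hG : GHolds k G) (P : Subgroup G) (hP : IsPGroup p P)
    (hm : (P.index : k) ≠ 0) (h4 : 4 ≤ Nat.card P) (ψ : kObj (triv k G) ⟶ triv k G)
    (y : kObj (triv k G)) : ψ y = 0 := by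
  classical
  by_contra hy
  have hfin := finite_triv k G
  have hfinK : Module.Finite k (kObj (triv k G)) := finite_kObj _
  have hfinC : Module.Finite k (CV k G (triv k G)) :=
    Module.Finite.equiv (cvEquiv k G (triv k G)).symm
  let E := trivEquiv k G
  let ι := (kSES (triv k G)).i
  have hsurj : Function.Surjective ψ := fun v => by
    refine ⟨(E v / E (ψ y)) • y, ?_⟩
    rw [map_scal]
    apply E.injective
    have : E (ψ y) ≠ 0 := by simpa using hy
    rw [map_smul, smul_eq_mul, div_mul_cancel₀ _ this]
  have hinj : Function.Injective (kerI ψ ≫ ι) := fun a b h =>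
    kerI_inj ψ ((kSES (triv k G)).inj h)
  have hthick : InThick (triv k G) (cokObj (kerI ψ ≫ ι)) :=
    .ext₁ (cokSES _ hinj) (.ext₃ (kerSES ψ hsurj) (inThick_kObj .gen) .gen)
      (.proj _ (CV.projective _))
  have hfinM : Module.Finite k (cokObj (kerI ψ ≫ ι)) :=
    Module.Finite.of_surjective (lin (cokP (kerI ψ ≫ ι))) (cokP_surj _)
  have hrank : Module.finrank k (cokObj (kerI ψ ≫ ι)) = 2 := by
    have h1 := (kerSES ψ hsurj).finrank_add
    have h2 := (cokSES _ hinj).finrank_add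
    have h3 := (kSES (triv k G)).finrank_add
    have h5 : Module.finrank k (triv k G) = 1 := by
      rw [E.finrank_eq, Module.finrank_self]
    omega
  have hfix : ∀ (g : P) (v : cokObj (kerI ψ ≫ ι)), g • v = v := fun g v =>
    fixed_of_inThick hG P hP hthick (π := 1) (fun _ _ => rfl) (one_mul 1) (by
      have : LinearMap.range (1 : Module.End k (cokObj (kerI ψ ≫ ι))) = ⊤ :=
        LinearMap.range_eq_top.2 fun x => ⟨x, rfl⟩
      rw [this, finrank_top, hrank]
      omega) g v
  obtain ⟨r, hr⟩ := LinearMap.exists_leftInverse_of_injective (lin ι)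
    (LinearMap.ker_eq_bot.2 (kSES (triv k G)).inj)
  have hr' : ∀ y, r (lin ι y) = y := fun y => LinearMap.congr_fun hr y
  let D : CV k G (triv k G) → G → k := fun f g => E (ψ (r (g • f - f)))
  have hmem : ∀ (f : CV k G (triv k G)) (g : G), ∃ y, lin ι y = g • f - f := fun f g => by
    refine ((kSES (triv k G)).exact _).1 ?_
    change lin (eps (triv k G)) (g • f - f) = 0
    rw [map_sub, lin_isHom (eps _), triv_smul, sub_self]
  have hD : ∀ f g h, D f (g * h) = D f g + D f h := fun f g h => by
    obtain ⟨y, hy⟩ := hmem f h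
    have e : (g * h) • f - f = (g • f - f) + lin ι (g • y) := by
      rw [lin_isHom ι, hy, smul_sub, mul_smul]
      abel
    simp only [D]
    rw [e, map_add, hr', ← lin_apply, map_add, lin_apply, lin_apply, map_act ψ, triv_smul,
      ← hy, hr', map_add]
  have hDP : ∀ f, ∀ g ∈ P, D f g = 0 := fun f g hg => by
    have h1 : cokP (kerI ψ ≫ ι) (g • f - f) = 0 := by
      change lin (cokP (kerI ψ ≫ ι)) (g • f - f) = 0
      rw [map_sub, lin_isHom (cokP _), sub_eq_zero]
      exact hfix ⟨g, hg⟩ _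
    obtain ⟨x, hx⟩ := (cokP_eq_zero _ _).1 h1
    have h2 : lin ι (kerI ψ x) = g • f - f := hx
    simp only [D]
    rw [← h2, hr', (exists_kerI ψ _).2 ⟨x, rfl⟩, map_zero]
  have hD0 := fun f g => additive_eq_zero P hm (hD f) (hDP f) g
  let δ : CV k G (triv k G) := (cvEquiv k G _).symm (Fn.of (Pi.single 1 (E.symm 1)))
  have hδ : ∀ x, cvEquiv k G _ δ x = (Pi.single 1 (E.symm 1) : G → triv k G) x := fun x => by
    simp [δ]
  have hsum : ∑ x, E (cvEquiv k G _ (lin ι y) x) = 0 := by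
    rw [← map_sum, ← eps_triv]
    refine (congrArg E ?_).trans (map_zero E)
    exact ((kSES (triv k G)).exact _).2 ⟨y, rfl⟩
  have hexp : lin ι y = ∑ x : G, E (cvEquiv k G _ (lin ι y) x) • (x⁻¹ • δ - δ) := by
    simp only [smul_sub]
    rw [Finset.sum_sub_distrib, ← Finset.sum_smul, hsum, zero_smul, sub_zero]
    refine CV.ext fun z => ?_
    rw [map_sum, Fn.sum_apply, Finset.sum_eq_single z]
    · rw [map_smul, cvEquiv_smul, Fn.scal_apply, Fn.smul_apply, hδ, mul_inv_cancel,
        Pi.single_eq_same, ← map_smul, smul_eq_mul, mul_one, LinearEquiv.symm_apply_apply]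
    · intro x _ hx
      have : z * x⁻¹ ≠ 1 := fun h => hx (mul_inv_eq_one.1 h).symm
      rw [map_smul, cvEquiv_smul, Fn.scal_apply, Fn.smul_apply, hδ, Pi.single_eq_of_ne this,
        smul_zero]
    · simp
  apply hy
  apply E.injective
  have h6 : E (ψ y) = (E.toLinearMap ∘ₗ lin ψ ∘ₗ r) (lin ι y) := by
    simp only [LinearMap.comp_apply, hr']
    rfl
  rw [h6, hexp, map_sum, map_zero]
  refine Finset.sum_eq_zero fun x _ => ?_
  rw [map_smul]
  exact (congrArg _ (hD0 δ x⁻¹)).trans (smul_zero _)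

theorem card_sylow_of_gHolds (hp : p ∣ Fintype.card G) (P : Sylow p G) (hG : GHolds k G) :
    Nat.card P = 2 ∨ Nat.card P = 3 := by
  classical
  have hpP : p ∣ Nat.card P := P.dvd_card_of_dvd_card (by rwa [Nat.card_eq_fintype_card])
  have hPk : (Nat.card P : k) = 0 := (CharP.cast_eq_zero_iff k p _).2 hpP
  have hp2 : 2 ≤ p := (Fact.out : p.Prime).two_le
  have hpos : 0 < Nat.card P := Nat.card_pos
  have hle := Nat.le_of_dvd hpos hpP
  by_contra hcard
  have h4 : 4 ≤ Nat.card P := by omega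
  have hm : (((P : Subgroup G).index : ℕ) : k) ≠ 0 := fun h =>
    P.not_dvd_index ((CharP.cast_eq_zero_iff k p _).1 h)
  obtain ⟨H, ρ, π, hthick, hfin, hρ, hhom, hπ, hsmall, hrep⟩ :=
    exists_summand (P : Subgroup G) hm hPk
  have hfix := fixed_of_inThick hG P P.isPGroup' hthick hhom hπ hsmall
  have hdiff : ∀ φ : P → k, ∑ x, φ x = 0 → ∀ a : P, ∃ v : k, ∀ h, φ (h * a) - φ h = v := by
    intro φ hφ a
    obtain ⟨z, hz, h1, -⟩ := hrep φ hφ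
    exact h1 a (by rw [← hz]; exact hfix a z)
  have hcard4 := klein_four_of_differences h4 hdiff
  have hp2 : p = 2 := by
    rw [hcard4] at hpP
    have : p ∣ 2 ^ 2 := hpP
    exact (Nat.prime_dvd_prime_iff_eq Fact.out Nat.prime_two).1
      ((Fact.out : p.Prime).dvd_of_dvd_pow this)
  subst hp2
  have h2 : ∀ x : k, x + x = 0 := fun x => CharTwo.add_self_eq_zero x
  have hsq := mul_self_of_differences h2 hdiff
  have hcF : Fintype.card P = 4 := by rw [← Nat.card_eq_fintype_card, hcard4]
  obtain ⟨a, ha⟩ := Fintype.exists_ne_of_one_lt_card (by omega : 1 < Fintype.card P) 1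
  have : ∃ b, b ∉ ({1, a} : Finset P) := by
    by_contra hc
    push Not at hc
    have := Finset.card_le_card (fun x _ => hc x : (Finset.univ : Finset P) ⊆ {1, a})
    have h3 := Finset.card_le_two (a := (1 : P)) (b := a)
    rw [Finset.card_univ] at this
    omega
  obtain ⟨b, hb⟩ := this
  simp only [Finset.mem_insert, Finset.mem_singleton, not_or] at hb
  obtain ⟨χ, hχ, hχa, hχb⟩ := exists_character (k := k) h2 hcard4 ha (hsq a) hb.1 hb.2
  obtain ⟨χ', hχ', -, hχ'a⟩ := exists_character (k := k) h2 hcard4 hb.1 (hsq b) ha (Ne.symm hb.2)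
  obtain ⟨z, hz, -, h0⟩ := hrep (Pi.single 1 1 - Pi.single a 1) (by simp)
  have hzfix : ∀ g : P, g • z = z := fun g => by
    rw [← hz]
    exact hfix g z
  have hz0 : z ≠ 0 := fun h => by
    obtain ⟨v, hv⟩ := h0 h
    have h1 := hv 1
    rw [← hv b] at h1
    simp [hb.1, hb.2, Ne.symm ha] at h1
  obtain ⟨μ, hμ⟩ : ∃ μ : H →ₗ[k] k, μ z ≠ 0 := by
    by_contra hc
    push Not at hc
    exact hz0 ((Module.forall_dual_apply_eq_zero_iff k z).1 hc)
  let l : H →ₗ[k] k := μ ∘ₗ π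
  have hl : ∀ (g : P) m, l (g • m) = l m := fun g m => by
    simp only [l, LinearMap.comp_apply]
    rw [hhom g, hfix]
  have hlz : l z ≠ 0 := by
    simpa only [l, LinearMap.comp_apply, hz] using hμ
  let L : (H →ₗ[k] H) →ₗ[k] k := l ∘ₗ LinearMap.applyₗ z
  have hgen : Gen k G H (fun i => syz k G i) ≤ LinearMap.ker L := by
    refine Submodule.span_le.2 ?_
    rintro f (hf | ⟨i, α, β, hα, hβ, rfl⟩)
    · obtain ⟨s, rfl⟩ := SZ.restrict hf (P : Subgroup G)
      exact tr_functional hl hPk s hzfix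
    · by_cases hi : i = 0
      · subst hi
        obtain ⟨y, rfl⟩ := hρ z
        have : α (ρ y) = 0 := hom_kObj_triv_eq_zero hG P P.isPGroup' hm h4
          (ρ ≫ mkHom (N := triv k G) α hα) y
        change l (β (α (ρ y))) = 0
        rw [this, map_zero, map_zero]
      · exact functional_syz_eq_zero (hsq b) h2 hχ hχa hχb hχ' hχ'a hPk hi
          (l := l ∘ₗ β) (fun g m => by
            simp only [LinearMap.comp_apply]
            rw [hβ.restrict (P : Subgroup G) g, hl])
          (w := α z) (fun g => by rw [← hα.restrict (P : Subgroup G) g, hzfix])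
  exact hlz (hgen (id_mem_gen hG isSyzygyFamily_syz hthick))

theorem gHolds_iff_card_sylow (hp : p ∣ Fintype.card G) (P : Sylow p G) :
    GHolds k G ↔ Nat.card P = 2 ∨ Nat.card P = 3 :=
  ⟨card_sylow_of_gHolds hp P, gHolds_of_card_sylow P⟩

end Sylow

/-- Let `G` be a finite group and `k₁, k₂` two fields of the same
characteristic `p` dividing `|G|`. Then the generating hypothesis holds for `k₁G` if and
only if it holds for `k₂G`. -/
theorem GH_independent_of_field
    (k₁ k₂ G : Type) [Field k₁] [Field k₂] [Group G] [Fintype G]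
    (p : ℕ) [Fact p.Prime] [CharP k₁ p] [CharP k₂ p] (hp : p ∣ Fintype.card G) :
    GHolds k₁ G ↔ GHolds k₂ G := by
  obtain ⟨P⟩ : Nonempty (Sylow p G) := inferInstance
  rw [gHolds_iff_card_sylow hp P, gHolds_iff_card_sylow hp P]
end StmodGH
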